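/- The cone group 𝒞₂ is isomorphic to the quotient group Red_c/⟪Pure(Red_c)⟫ of the reduced-word group of the Hawaiian earring by the normal closure of its pure words. (Since 𝒞₂ ≅ π₁ of the Griffiths double cone and Red_c/⟪Pure(Red_c)⟫ ≅ π₁ of the harmonic archipelago, the fundamental groups of the Griffiths double cone and of the harmonic archipelago are isomorphic.) -/

import Mathlib

noncomputable section

namespace GriffithsWords

/-- A (transfinite) word over the alphabet `𝒜 = {a_{α,n}^{±1} : α ∈ ι, n ∈ ℕ}`.
Since the finiteness condition forces the domain of a word to be a countable linear order,
and every countable linear order embeds in `ℚ`, we realize words (up to letter-preserving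
order isomorphism) as functions on subsets of `ℚ`.  A letter is recorded as a triple
`(α, n, sign)`, standing for `a_{α,n}` if `sign = true` and for `a_{α,n}⁻¹` otherwise. -/
structure Word (ι : Type) : Type where
  /-- The (totally ordered) domain `W̄` of the word. -/
  dom : Set ℚ
  /-- The letter occupying each position (values outside `dom` are irrelevant). -/
  letter : ℚ → ι × ℕ × Bool
  /-- For each `N` only finitely many positions carry a letter with second subscript `≤ N`. -/
  finite_le : ∀ N : ℕ, {q | q ∈ dom ∧ (letter q).2.1 ≤ N}.Finite

namespace Word

variable {ι : Type}

/-- The positions of `W` carrying a letter with second subscript `≤ N`, listed in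
increasing order. -/
def truncList (W : Word ι) (N : ℕ) : List ℚ :=
  (W.finite_le N).toFinset.sort (· ≤ ·)

/-- `p_N(W)`: the finite truncation of `W` at level `N`, as an element of the free group
on the positive letters. -/
def trunc (W : Word ι) (N : ℕ) : FreeGroup (ι × ℕ) :=
  FreeGroup.mk ((W.truncList N).map fun q =>
    (((W.letter q).1, (W.letter q).2.1), (W.letter q).2.2))

/-- The family of all finite truncations of a word; two words are `∼`-equivalent
precisely when their `Phi`-values agree. -/
def Phi (W : Word ι) : (N : ℕ) → FreeGroup (ι × ℕ) := fun N => W.trunc N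

/-- `W ∼ U`: all finite truncations agree in the free group. -/
def Equiv (W U : Word ι) : Prop := ∀ N, W.trunc N = U.trunc N

/-- `W ∼ E`: all finite truncations are freely trivial. -/
def SimE (W : Word ι) : Prop := ∀ N, W.trunc N = 1

/-- `W ≡ U`: there is an order isomorphism of the domains carrying the letters of `W` to
those of `U`. -/
def OrdEquiv (W U : Word ι) : Prop :=
  ∃ e : W.dom ≃o U.dom, ∀ q : W.dom, U.letter (e q) = W.letter (q : ℚ)

/-- The restriction `W ↾ I` of a word to a subset of its domain. -/
def restrict (W : Word ι) (I : Set ℚ) : Word ι where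
  dom := W.dom ∩ I
  letter := W.letter
  finite_le := fun N => (W.finite_le N).subset (by intro q hq; exact ⟨hq.1.1, hq.2⟩)

/-- `I` is an interval (order-convex subset) of the domain of `W`. -/
def IsIntervalIn (W : Word ι) (I : Set ℚ) : Prop :=
  I ⊆ W.dom ∧ ∀ a ∈ I, ∀ c ∈ I, ∀ b ∈ W.dom, a ≤ b → b ≤ c → b ∈ I

/-- A word is *reduced* if in any decomposition `W ≡ W₀W₁W₂` with `W₁ ∼ E` the middle
word `W₁` is empty; equivalently, the restriction of `W` to any nonempty interval of its
domain is not `∼ E`. -/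
def Reduced (W : Word ι) : Prop :=
  ∀ I : Set ℚ, W.IsIntervalIn I → (W.restrict I).SimE → I = ∅

/-- A word is `α`-pure if all of its letters have first subscript `α`; it is *pure* if it
is `α`-pure for some `α`. -/
def IsPure (W : Word ι) : Prop :=
  ∃ α : ι, ∀ q ∈ W.dom, (W.letter q).1 = α

end Word

open Word

/-- The group of (`∼`-classes of) words over `𝒜_ι`, realized concretely: it is the subgroup
of `∏_N FreeGroup (ι × ℕ)` generated by the truncation data `Φ(W)` of words `W` (this set
of generators is already closed under the group operations, since words can be concatenated
and inverted; the resulting group is `𝒲_ι/∼ ≅ Red_ι`). -/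
def wordGroup (ι : Type) : Subgroup ((N : ℕ) → FreeGroup (ι × ℕ)) :=
  Subgroup.closure (Set.range (Phi (ι := ι)))

lemma Phi_mem_wordGroup {ι : Type} (W : Word ι) : W.Phi ∈ wordGroup ι :=
  Subgroup.subset_closure ⟨W, rfl⟩

/-- The elements of the word group represented by pure reduced words. -/
def pureClasses (ι : Type) : Set (wordGroup ι) :=
  {g | ∃ W : Word ι, W.Reduced ∧ W.IsPure ∧ W.Phi = (g : (N : ℕ) → FreeGroup (ι × ℕ))}

/-- The cone group `𝒞_ι`: the quotient of the group of reduced words by the normal closure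
of the set of pure reduced words. -/
def ConeGroup (ι : Type) : Type :=
  wordGroup ι ⧸ Subgroup.normalClosure (pureClasses ι)

instance (ι : Type) : Group (ConeGroup ι) := by
  unfold ConeGroup; infer_instance

/-- `[[W]]`: the class of a word in the cone group. -/
def coneClass {ι : Type} (W : Word ι) : ConeGroup ι :=
  QuotientGroup.mk ⟨W.Phi, Phi_mem_wordGroup W⟩

end GriffithsWords

namespace GriffithsWords

/-! Words over the alphabet `{c_n^{±1} : n ∈ ℕ}` of the Hawaiian earring are realized as
words over `𝒜_ι` with a one-point index type `ι = Unit`: the letter `(⟨⟩, n, sign)` stands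
for `c_n^{±1}`.  The group `Red_c` of reduced such words is (isomorphic to) `wordGroup Unit`.
For these words, purity has a different meaning: a word is `m`-pure when all of its letters
lie in `{c_m, c_m⁻¹}`. -/

/-- A word over the Hawaiian-earring alphabet is *pure* if all of its letters are
`c_m^{±1}` for one single `m`. -/
def Word.IsCPure (W : Word Unit) : Prop :=
  ∃ m : ℕ, ∀ q ∈ W.dom, (W.letter q).2.1 = m

/-- The elements of `Red_c` represented by pure reduced words, `Pure(Red_c)`. -/
def cPureClasses : Set (wordGroup Unit) :=
  {g | ∃ W : Word Unit, W.Reduced ∧ W.IsCPure ∧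
        W.Phi = (g : (N : ℕ) → FreeGroup (Unit × ℕ))}

/-- The group `Red_c/⟪Pure(Red_c)⟫`, isomorphic to the fundamental group of the harmonic
archipelago. -/
def HAGroup : Type :=
  wordGroup Unit ⧸ Subgroup.normalClosure cPureClasses

instance : Group HAGroup := by
  unfold HAGroup; infer_instance

end GriffithsWords

set_option linter.all false

noncomputable section

namespace GW

open Set

/-! ### Ordered products over finite sets -/

section oprod
variable {L L' : Type} [LinearOrder L] [LinearOrder L'] {G H : Type} [Group G] [Group H]

open Classical in
/-- Ordered product of `g` over the set `s` (junk value `1` if infinite). -/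
def oprod (s : Set L) (g : L → G) : G :=
  if h : s.Finite then ((h.toFinset.sort (· ≤ ·)).map g).prod else 1

lemma oprod_def (s : Set L) (h : s.Finite) (g : L → G) :
    oprod s g = ((h.toFinset.sort (· ≤ ·)).map g).prod := by
  simp [oprod, h]

@[simp] lemma oprod_empty (g : L → G) : oprod ∅ g = 1 := by
  rw [oprod_def _ finite_empty]; simp

lemma sort_insert_max [DecidableEq L] (s : Finset L) (a : L) (h : ∀ x ∈ s, x < a) :
    (insert a s).sort (· ≤ ·) = s.sort (· ≤ ·) ++ [a] := by
  have h1 : ((s.sort (· ≤ ·) ++ [a]).toFinset).sort (· ≤ ·) = s.sort (· ≤ ·) ++ [a] := by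
    apply List.toFinset_sort (r := (· ≤ ·)) _ |>.2
    · rw [List.pairwise_append]
      refine ⟨Finset.pairwise_sort _ _, by simp, ?_⟩
      intro x hx y hy
      simp at hx hy
      subst hy
      exact (h x hx).le
    · rw [List.nodup_append]
      refine ⟨Finset.sort_nodup _ _, by simp, ?_⟩
      intro x hx y hy
      simp at hx hy
      subst hy
      exact (h x hx).ne
  rw [← h1]
  congr 1
  ext x
  simp [or_comm]

lemma oprod_insert_max {s : Set L} (hs : s.Finite) (a : L) (h : ∀ x ∈ s, x < a) (g : L → G) :
    oprod (insert a s) g = oprod s g * g a := by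
  classical
  rw [oprod_def _ (hs.insert a), oprod_def _ hs]
  have : (hs.insert a).toFinset = insert a hs.toFinset := by ext; simp
  rw [this, sort_insert_max _ _ (by simpa using h)]
  simp

/-- Induction for finite sets of a linear order, adding a maximum each time. -/
lemma finset_ind {p : Set L → Prop} {s : Set L} (hs : s.Finite) (h0 : p ∅)
    (h1 : ∀ (a : L) (s : Set L), s.Finite → (∀ x ∈ s, x < a) → p s → p (insert a s)) : p s := by
  classical
  obtain ⟨t, rfl⟩ := hs.exists_finset_coe
  clear hs
  induction t using Finset.induction_on_max with
  | empty => simpa using h0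
  | insert a t h ih =>
    rw [Finset.coe_insert]
    exact h1 a t t.finite_toSet (by simpa using h) ih

lemma oprod_union {s t : Set L} (hs : s.Finite) (ht : t.Finite) (h : ∀ x ∈ s, ∀ y ∈ t, x < y)
    (g : L → G) : oprod (s ∪ t) g = oprod s g * oprod t g := by
  revert h
  refine finset_ind (p := fun t => (∀ x ∈ s, ∀ y ∈ t, x < y) →
    oprod (s ∪ t) g = oprod s g * oprod t g) ht (by simp) ?_
  intro a t ht hat ih h
  rw [union_insert, oprod_insert_max (hs.union ht), oprod_insert_max ht a hat, ih, mul_assoc]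
  · intro x hx y hy; exact h x hx y (mem_insert_of_mem _ hy)
  · rintro x (hx | hx)
    · exact h x hx a (mem_insert _ _)
    · exact hat x hx

lemma oprod_singleton (a : L) (g : L → G) : oprod {a} g = g a := by
  have := oprod_insert_max (s := ∅) finite_empty a (by simp) g
  simpa using this

lemma oprod_congr {s : Set L} {g g' : L → G} (h : ∀ x ∈ s, g x = g' x) :
    oprod s g = oprod s g' := by
  by_cases hs : s.Finite
  · rw [oprod_def _ hs, oprod_def _ hs]
    congr 1
    apply List.map_congr_left
    intro x hx
    simp at hx
    exact h x hx
  · simp [oprod, hs]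

lemma oprod_map (φ : G →* H) (s : Set L) (g : L → G) :
    φ (oprod s g) = oprod s (fun x => φ (g x)) := by
  by_cases hs : s.Finite
  · rw [oprod_def _ hs, oprod_def _ hs, map_list_prod, List.map_map]; rfl
  · simp [oprod, hs]

lemma oprod_one {s : Set L} {g : L → G} (h : ∀ x ∈ s, g x = 1) : oprod s g = 1 := by
  by_cases hs : s.Finite
  · revert h
    refine finset_ind (p := fun s => (∀ x ∈ s, g x = 1) → oprod s g = 1) hs (by simp) ?_
    intro a s hs ha ih h
    rw [oprod_insert_max hs a ha, ih (fun x hx => h x (mem_insert_of_mem _ hx)),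
      h a (mem_insert _ _), one_mul]
  · simp [oprod, hs]

lemma oprod_subset {s t : Set L} (hs : s.Finite) (hts : t ⊆ s) {g : L → G}
    (h : ∀ x ∈ s, x ∉ t → g x = 1) : oprod t g = oprod s g := by
  classical
  revert hts h t
  refine finset_ind (p := fun s => ∀ {t : Set L}, t ⊆ s → (∀ x ∈ s, x ∉ t → g x = 1) →
    oprod t g = oprod s g) hs ?_ ?_
  · intro t ht _
    rw [subset_empty_iff.1 ht]
  · intro a s hs ha ih t ht h
    rw [oprod_insert_max hs a ha]
    by_cases hat : a ∈ t
    · have : t = insert a (t ∩ s) := by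
        ext x; constructor
        · intro hx
          rcases ht hx with rfl | h'
          · exact mem_insert _ _
          · exact mem_insert_of_mem _ ⟨hx, h'⟩
        · rintro (rfl | hx)
          · exact hat
          · exact hx.1
      rw [this, oprod_insert_max (hs.subset inter_subset_right) a (fun x hx => ha x hx.2),
        ih inter_subset_right]
      intro x hx hxt
      exact h x (mem_insert_of_mem _ hx) (fun h' => hxt ⟨h', hx⟩)
    · rw [h a (mem_insert _ _) hat, mul_one]
      apply ih
      · intro x hx
        rcases ht hx with rfl | h'
        · exact absurd hx hat
        · exact h'
      · intro x hx hxt; exact h x (mem_insert_of_mem _ hx) hxt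

lemma oprod_image {s : Set L} (hs : s.Finite) {e : L → L'} (he : StrictMonoOn e s) (g : L' → G) :
    oprod (e '' s) g = oprod s (fun x => g (e x)) := by
  revert he
  refine finset_ind (p := fun s => StrictMonoOn e s →
    oprod (e '' s) g = oprod s (fun x => g (e x))) hs (by simp) ?_
  intro a s hs ha ih he
  rw [image_insert_eq, oprod_insert_max (hs.image e), oprod_insert_max hs a ha,
    ih (he.mono (subset_insert _ _))]
  rintro _ ⟨x, hx, rfl⟩
  exact he (mem_insert_of_mem _ hx) (mem_insert _ _) (ha x hx)

lemma oprod_image_anti {s : Set L} (hs : s.Finite) {e : L → L'} (he : StrictAntiOn e s)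
    (g : L' → G) :
    oprod (e '' s) g = (oprod s (fun x => (g (e x))⁻¹))⁻¹ := by
  revert he
  refine finset_ind (p := fun s => StrictAntiOn e s →
    oprod (e '' s) g = (oprod s (fun x => (g (e x))⁻¹))⁻¹) hs (by simp) ?_
  intro a s hs ha ih he
  rw [image_insert_eq, oprod_insert_max hs a ha, insert_eq,
    oprod_union (finite_singleton _) (hs.image e), oprod_singleton,
    ih (he.mono (subset_insert _ _))]
  · simp
  rintro _ rfl _ ⟨x, hx, rfl⟩
  exact he (mem_insert_of_mem _ hx) (mem_insert _ _) (ha x hx)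

lemma oprod_fiber {s : Set L} {t : Set L'} (hs : s.Finite) (ht : t.Finite) {b : L → L'}
    (hb : MonotoneOn b s) (hst : MapsTo b s t) (g : L → G) :
    oprod s g = oprod t (fun l => oprod (s ∩ b ⁻¹' {l}) g) := by
  revert hst hb hs s
  refine finset_ind (p := fun t => ∀ {s : Set L}, s.Finite → MonotoneOn b s → MapsTo b s t →
    oprod s g = oprod t (fun l => oprod (s ∩ b ⁻¹' {l}) g)) ht ?_ ?_
  · intro s _ _ h
    have : s = ∅ := by
      ext x; constructor
      · intro hx; exact h hx
      · simp
    rw [this]; simp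
  · intro a t ht ha ih s hs hb hst
    rw [oprod_insert_max ht a ha]
    have e : s = (s ∩ b ⁻¹' t) ∪ (s ∩ b ⁻¹' {a}) := by
      ext x; constructor
      · intro hx
        rcases hst hx with h | h
        · exact Or.inr ⟨hx, h⟩
        · exact Or.inl ⟨hx, h⟩
      · rintro (h | h) <;> exact h.1
    conv_lhs => rw [e]
    rw [oprod_union (hs.subset inter_subset_left) (hs.subset inter_subset_left)]
    · congr 1
      rw [ih (s := s ∩ b ⁻¹' t) (hs.subset inter_subset_left) (hb.mono inter_subset_left)
        (fun x hx => hx.2)]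
      apply oprod_congr
      intro l hl
      congr 1
      ext x; constructor
      · rintro ⟨h, h2⟩; exact ⟨h.1, h2⟩
      · rintro ⟨h, h2⟩
        simp at h2
        refine ⟨⟨h, ?_⟩, h2⟩
        simp [h2, hl]
    · rintro x ⟨hx, hx2⟩ y ⟨hy, hy2⟩
      simp at hy2 hx2
      have := ha _ hx2
      by_contra hxy
      have := hb hy hx (not_lt.1 hxy)
      rw [hy2] at this
      exact absurd (ha _ hx2) (not_lt.2 this)

end oprod

/-! ### Words on arbitrary linear orders -/

open GriffithsWords

/-- The free group element of a letter. -/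
def gen {ι : Type} (c : ι × ℕ × Bool) : FreeGroup (ι × ℕ) := FreeGroup.mk [((c.1, c.2.1), c.2.2)]

/-- The inverse letter. -/
def linv {ι : Type} (c : ι × ℕ × Bool) : ι × ℕ × Bool := (c.1, c.2.1, !c.2.2)

@[simp] lemma linv_linv {ι : Type} (c : ι × ℕ × Bool) : linv (linv c) = c := by
  simp [linv]

@[simp] lemma linv_level {ι : Type} (c : ι × ℕ × Bool) : (linv c).2.1 = c.2.1 := rfl

lemma gen_linv {ι : Type} (c : ι × ℕ × Bool) : gen (linv c) = (gen c)⁻¹ := by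
  simp [gen, linv, FreeGroup.inv_mk, FreeGroup.invRev]

/-- Kill all letters of level `> N`. -/
def kill {ι : Type} (N : ℕ) : FreeGroup (ι × ℕ) →* FreeGroup (ι × ℕ) :=
  FreeGroup.lift (fun p => if p.2 ≤ N then FreeGroup.of p else 1)

lemma kill_gen {ι : Type} (N : ℕ) (c : ι × ℕ × Bool) :
    kill N (gen c) = if c.2.1 ≤ N then gen c else 1 := by
  rcases c with ⟨a, n, b⟩
  cases b <;> simp [kill, gen, FreeGroup.lift_mk] <;> split_ifs <;>
    simp [FreeGroup.of, FreeGroup.inv_mk, FreeGroup.invRev]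

section word
variable {ι : Type} {L L' : Type} [LinearOrder L] [LinearOrder L']

/-- positions of level `≤ N`. -/
def lev (f : L → ι × ℕ × Bool) (A : Set L) (N : ℕ) : Set L := {i | i ∈ A ∧ (f i).2.1 ≤ N}

/-- local finiteness: every level is finite. -/
def LF (f : L → ι × ℕ × Bool) (A : Set L) : Prop := ∀ N, (lev f A N).Finite

lemma LF.mono {f : L → ι × ℕ × Bool} {A B : Set L} (h : LF f A) (hB : B ⊆ A) : LF f B :=
  fun N => (h N).subset (fun _ hi => ⟨hB hi.1, hi.2⟩)

/-- level-`N` value -/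
def ev (f : L → ι × ℕ × Bool) (A : Set L) : (N : ℕ) → FreeGroup (ι × ℕ) :=
  fun N => oprod (lev f A N) (fun i => gen (f i))

lemma ev_congr {f f' : L → ι × ℕ × Bool} {A : Set L} (h : ∀ i ∈ A, f i = f' i) :
    ev f A = ev f' A := by
  funext N
  have : lev f A N = lev f' A N := by
    ext i; constructor
    · rintro ⟨h1, h2⟩; exact ⟨h1, by rw [← h i h1]; exact h2⟩
    · rintro ⟨h1, h2⟩; exact ⟨h1, by rw [h i h1]; exact h2⟩
  simp only [ev, this]
  apply oprod_congr
  intro i hi; rw [h i hi.1]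

@[simp] lemma ev_empty (f : L → ι × ℕ × Bool) : ev f ∅ = 1 := by
  funext N
  have : lev f ∅ N = ∅ := by ext; simp [lev]
  simp [ev, this]

lemma lev_union (f : L → ι × ℕ × Bool) (A B : Set L) (N : ℕ) :
    lev f (A ∪ B) N = lev f A N ∪ lev f B N := by
  ext i; simp [lev, or_and_right]

lemma LF.union {f : L → ι × ℕ × Bool} {A B : Set L} (h : LF f A) (h' : LF f B) :
    LF f (A ∪ B) := fun N => by rw [lev_union]; exact (h N).union (h' N)

lemma ev_union {f : L → ι × ℕ × Bool} {A B : Set L} (hA : LF f A) (hB : LF f B)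
    (h : ∀ x ∈ A, ∀ y ∈ B, x < y) : ev f (A ∪ B) = ev f A * ev f B := by
  funext N
  simp only [ev, lev_union, Pi.mul_apply]
  exact oprod_union (hA N) (hB N) (fun x hx y hy => h x hx.1 y hy.1) _

lemma LF.image {f : L → ι × ℕ × Bool} {f' : L' → ι × ℕ × Bool} {A : Set L} (h : LF f A)
    {e : L → L'} (hf : ∀ i ∈ A, (f' (e i)).2.1 = (f i).2.1) : LF f' (e '' A) := by
  intro N
  refine ((h N).image e).subset ?_
  rintro _ ⟨⟨i, hi, rfl⟩, h2⟩
  exact ⟨i, ⟨hi, by rw [← hf i hi]; exact h2⟩, rfl⟩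

lemma lev_image {f : L → ι × ℕ × Bool} {f' : L' → ι × ℕ × Bool} {A : Set L}
    {e : L → L'} (hf : ∀ i ∈ A, (f' (e i)).2.1 = (f i).2.1) (N : ℕ) :
    lev f' (e '' A) N = e '' (lev f A N) := by
  ext x; constructor
  · rintro ⟨⟨i, hi, rfl⟩, h2⟩
    exact ⟨i, ⟨hi, by rw [← hf i hi]; exact h2⟩, rfl⟩
  · rintro ⟨i, hi, rfl⟩
    exact ⟨⟨i, hi.1, rfl⟩, by rw [hf i hi.1]; exact hi.2⟩

lemma ev_image {f : L → ι × ℕ × Bool} {f' : L' → ι × ℕ × Bool} {A : Set L} (h : LF f A)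
    {e : L → L'} (he : StrictMonoOn e A) (hf : ∀ i ∈ A, f' (e i) = f i) :
    ev f' (e '' A) = ev f A := by
  funext N
  simp only [ev]
  rw [lev_image (fun i hi => by rw [hf i hi]),
    oprod_image (h N) (he.mono (fun _ hi => hi.1))]
  exact oprod_congr (fun i hi => by rw [hf i hi.1])

lemma ev_image_anti {f : L → ι × ℕ × Bool} {f' : L' → ι × ℕ × Bool} {A : Set L} (h : LF f A)
    {e : L → L'} (he : StrictAntiOn e A) (hf : ∀ i ∈ A, f' (e i) = linv (f i)) :
    ev f' (e '' A) = (ev f A)⁻¹ := by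
  funext N
  simp only [ev, Pi.inv_apply]
  rw [lev_image (f := f) (fun i hi => by rw [hf i hi, linv_level]),
    oprod_image_anti (h N) (he.mono (fun _ hi => hi.1))]
  congr 1
  exact oprod_congr (fun i hi => by rw [hf i hi.1, gen_linv, inv_inv])

lemma kill_ev {f : L → ι × ℕ × Bool} {A : Set L} (h : LF f A) {N M : ℕ} (hNM : N ≤ M) :
    kill N (ev f A M) = ev f A N := by
  simp only [ev, oprod_map]
  rw [← oprod_subset (t := lev f A N) (h M)]
  · apply oprod_congr
    intro i hi
    rw [kill_gen, if_pos hi.2]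
  · intro i hi; exact ⟨hi.1, hi.2.trans hNM⟩
  · intro i hi hi2
    rw [kill_gen, if_neg]
    intro h3; exact hi2 ⟨hi.1, h3⟩

lemma LF.countable {f : L → ι × ℕ × Bool} {A : Set L} (h : LF f A) : A.Countable := by
  have : A = ⋃ N, lev f A N := by
    ext i; simp only [mem_iUnion]; constructor
    · intro hi; exact ⟨(f i).2.1, hi, le_rfl⟩
    · rintro ⟨N, hi⟩; exact hi.1
  rw [this]
  exact countable_iUnion (fun N => (h N).countable)

lemma prod_gen (l : List (ι × ℕ × Bool)) :
    (l.map gen).prod = FreeGroup.mk (l.map fun c => ((c.1, c.2.1), c.2.2)) := by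
  induction l with
  | nil => rfl
  | cons a l ih => rw [List.map_cons, List.prod_cons, ih]; simp [gen, FreeGroup.mul_mk]

lemma Phi_eq (W : Word ι) : W.Phi = ev W.letter W.dom := by
  funext N
  have h := W.finite_le N
  have h2 : lev W.letter W.dom N = {q | q ∈ W.dom ∧ (W.letter q).2.1 ≤ N} := rfl
  rw [ev, oprod_def _ (by rw [h2]; exact h), Word.Phi, Word.trunc, Word.truncList]
  rw [show (fun i => gen (W.letter i)) = gen ∘ W.letter from rfl, ← List.map_map, prod_gen,
    List.map_map]
  rfl

/-- Every locally finite word can be re-indexed by rationals. -/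
lemma exists_rat (f : L → ι × ℕ × Bool) (A : Set L) (h : LF f A) [Inhabited ι] :
    ∃ (e : L → ℚ) (f' : ℚ → ι × ℕ × Bool), StrictMonoOn e A ∧ (∀ i ∈ A, f' (e i) = f i) := by
  classical
  have : Countable A := h.countable
  obtain ⟨e⟩ := Order.embedding_from_countable_to_dense A ℚ
  refine ⟨fun i => if hi : i ∈ A then e ⟨i, hi⟩ else 0,
    fun q => if hq : ∃ i : A, e i = q then f hq.choose else default, ?_, ?_⟩
  · intro i hi j hj hij
    simp only [hi, hj, dif_pos]
    exact e.strictMono hij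
  · intro i hi
    simp only [hi, dif_pos]
    have hq : ∃ j : A, e j = e ⟨i, hi⟩ := ⟨_, rfl⟩
    rw [dif_pos hq, e.injective hq.choose_spec]

lemma ev_mem (f : L → ι × ℕ × Bool) (A : Set L) (h : LF f A) : ev f A ∈ wordGroup ι := by
  classical
  by_cases hA : A = ∅
  · rw [hA, ev_empty]; exact one_mem _
  obtain ⟨i0, hi0⟩ := nonempty_iff_ne_empty.2 hA
  haveI : Inhabited ι := ⟨(f i0).1⟩
  obtain ⟨e, f', he, hf⟩ := exists_rat f A h
  have h' : LF f' (e '' A) := h.image (fun i hi => by rw [hf i hi])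
  rw [← ev_image h he hf]
  rw [← Phi_eq ⟨e '' A, f', h'⟩]
  exact Phi_mem_wordGroup _

open Classical in
/-- The element represented by a word (junk `1` if not locally finite). -/
def el (f : L → ι × ℕ × Bool) (A : Set L) : wordGroup ι :=
  if h : LF f A then ⟨ev f A, ev_mem f A h⟩ else 1

lemma coe_el {f : L → ι × ℕ × Bool} {A : Set L} (h : LF f A) :
    (el f A : (N : ℕ) → FreeGroup (ι × ℕ)) = ev f A := by simp [el, h]

lemma el_eq_iff {f : L → ι × ℕ × Bool} {A : Set L} (h : LF f A) {f' : L' → ι × ℕ × Bool}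
    {A' : Set L'} (h' : LF f' A') : el f A = el f' A' ↔ ev f A = ev f' A' := by
  rw [← coe_el h, ← coe_el h', Subtype.ext_iff]

lemma LF_empty (f : L → ι × ℕ × Bool) : LF f ∅ := fun N => by
  have : lev f ∅ N = ∅ := by ext; simp [lev]
  rw [this]; exact finite_empty

@[simp] lemma el_empty (f : L → ι × ℕ × Bool) : el f ∅ = 1 := by
  apply Subtype.ext; rw [coe_el (LF_empty f)]; simp

lemma el_union {f : L → ι × ℕ × Bool} {A B : Set L} (hA : LF f A) (hB : LF f B)
    (h : ∀ x ∈ A, ∀ y ∈ B, x < y) : el f (A ∪ B) = el f A * el f B := by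
  apply Subtype.ext
  rw [Subgroup.coe_mul, coe_el hA, coe_el hB, coe_el (hA.union hB), ev_union hA hB h]

lemma el_image {f : L → ι × ℕ × Bool} {f' : L' → ι × ℕ × Bool} {A : Set L} (h : LF f A)
    {e : L → L'} (he : StrictMonoOn e A) (hf : ∀ i ∈ A, f' (e i) = f i) :
    el f' (e '' A) = el f A := by
  rw [el_eq_iff (h.image (fun i hi => by rw [hf i hi])) h, ev_image h he hf]

lemma el_image_anti {f : L → ι × ℕ × Bool} {f' : L' → ι × ℕ × Bool} {A : Set L} (h : LF f A)
    {e : L → L'} (he : StrictAntiOn e A) (hf : ∀ i ∈ A, f' (e i) = linv (f i)) :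
    el f' (e '' A) = (el f A)⁻¹ := by
  apply Subtype.ext
  rw [Subgroup.coe_inv, coe_el h, coe_el (h.image (fun i hi => by rw [hf i hi, linv_level])),
    ev_image_anti h he hf]

lemma el_congr {f f' : L → ι × ℕ × Bool} {A : Set L} (h : ∀ i ∈ A, f i = f' i) :
    el f A = el f' A := by
  have : ∀ N, lev f A N = lev f' A N := by
    intro N
    ext i; constructor
    · rintro ⟨h1, h2⟩; exact ⟨h1, by rw [← h i h1]; exact h2⟩
    · rintro ⟨h1, h2⟩; exact ⟨h1, by rw [h i h1]; exact h2⟩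
  by_cases h1 : LF f A
  · have h2 : LF f' A := fun N => by rw [← this]; exact h1 N
    rw [el_eq_iff h1 h2, ev_congr h]
  · have h2 : ¬ LF f' A := fun h2 => h1 (fun N => by rw [this]; exact h2 N)
    simp [el, h1, h2]

/-- splitting a word at a lower set -/
lemma el_split {f : L → ι × ℕ × Bool} {A : Set L} (hA : LF f A) {D : Set L} (hD : IsLowerSet D) :
    el f A = el f (A ∩ D) * el f (A ∩ Dᶜ) := by
  rw [← el_union (hA.mono inter_subset_left) (hA.mono inter_subset_left), inter_union_compl]
  rintro x ⟨_, hx⟩ y ⟨_, hy⟩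
  by_contra h
  exact hy (hD (not_lt.1 h) hx)

/-- The dual word -/
def dl (f : L → ι × ℕ × Bool) : Lᵒᵈ → ι × ℕ × Bool := fun i => linv (f (OrderDual.ofDual i))

/-- the dual set -/
def dS (A : Set L) : Set Lᵒᵈ := OrderDual.ofDual ⁻¹' A

lemma dS_eq (A : Set L) : dS A = OrderDual.toDual '' A := by
  ext x; simp [dS]

lemma LF.dual {f : L → ι × ℕ × Bool} {A : Set L} (h : LF f A) : LF (dl f) (dS A) := by
  rw [dS_eq]; exact h.image (fun i _ => rfl)

lemma el_dual {f : L → ι × ℕ × Bool} {A : Set L} (h : LF f A) :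
    el (dl f) (dS A) = (el f A)⁻¹ := by
  rw [dS_eq]
  exact el_image_anti h (fun x _ y _ hxy => hxy) (fun i _ => rfl)

lemma ev_dual {f : L → ι × ℕ × Bool} {A : Set L} (h : LF f A) :
    ev (dl f) (dS A) = (ev f A)⁻¹ := by
  rw [dS_eq]
  exact ev_image_anti h (fun x _ y _ hxy => hxy) (fun i _ => rfl)

/-! concatenation -/

/-- concatenated letters -/
def catf (f : L → ι × ℕ × Bool) (f' : L' → ι × ℕ × Bool) : L ⊕ₗ L' → ι × ℕ × Bool :=
  fun x => Sum.elim f f' (ofLex x)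

/-- concatenated set -/
def catS (A : Set L) (A' : Set L') : Set (L ⊕ₗ L') :=
  (fun x => toLex (Sum.inl x)) '' A ∪ (fun x => toLex (Sum.inr x)) '' A'

lemma LF.cat {f : L → ι × ℕ × Bool} {A : Set L} (h : LF f A) {f' : L' → ι × ℕ × Bool}
    {A' : Set L'} (h' : LF f' A') : LF (catf f f') (catS A A') :=
  (LF.image (f' := catf f f') (e := fun x => toLex (Sum.inl x)) h (fun _ _ => rfl)).union
    (LF.image (f' := catf f f') (e := fun x => toLex (Sum.inr x)) h' (fun _ _ => rfl))

lemma el_cat {f : L → ι × ℕ × Bool} {A : Set L} (h : LF f A) {f' : L' → ι × ℕ × Bool}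
    {A' : Set L'} (h' : LF f' A') : el (catf f f') (catS A A') = el f A * el f' A' := by
  rw [catS, el_union (LF.image (f' := catf f f') (e := fun x => toLex (Sum.inl x)) h
    (fun _ _ => rfl)) (LF.image (f' := catf f f') (e := fun x => toLex (Sum.inr x)) h'
    (fun _ _ => rfl))]
  · rw [el_image h (f' := catf f f') _ (fun _ _ => rfl),
      el_image h' (f' := catf f f') _ (fun _ _ => rfl)]
    · intro x _ y _ hxy; exact Sum.Lex.inr_strictMono hxy
    · intro x _ y _ hxy; exact Sum.Lex.inl_strictMono hxy
  · rintro _ ⟨x, _, rfl⟩ _ ⟨y, _, rfl⟩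
    exact Sum.Lex.inl_lt_inr _ _

/-- Re-index by rationals. -/
lemma exists_rat' [Inhabited ι] {f : L → ι × ℕ × Bool} {A : Set L} (h : LF f A) :
    ∃ (f' : ℚ → ι × ℕ × Bool) (A' : Set ℚ), LF f' A' ∧ el f' A' = el f A := by
  obtain ⟨e, f', he, hf⟩ := exists_rat f A h
  exact ⟨f', e '' A, h.image (fun i hi => by rw [hf i hi]), el_image h he hf⟩

/-- Every element is represented by a word on `ℚ`. -/
lemma exists_rep [Inhabited ι] (g : wordGroup ι) : ∃ (f : ℚ → ι × ℕ × Bool) (A : Set ℚ),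
    LF f A ∧ el f A = g := by
  rcases g with ⟨g, hg⟩
  induction hg using Subgroup.closure_induction with
  | mem x hx =>
    obtain ⟨W, rfl⟩ := hx
    refine ⟨W.letter, W.dom, W.finite_le, ?_⟩
    apply Subtype.ext
    exact (coe_el W.finite_le).trans (Phi_eq W).symm
  | one => exact ⟨fun _ => (default, 0, true), ∅, LF_empty _, by simp; rfl⟩
  | mul x y hx hy ihx ihy =>
    obtain ⟨f, A, h, e⟩ := ihx
    obtain ⟨f', A', h', e'⟩ := ihy
    obtain ⟨f2, A2, h2, e2⟩ := exists_rat' (h.cat h')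
    refine ⟨f2, A2, h2, ?_⟩
    rw [e2, el_cat h h', e, e']; rfl
  | inv x hx ih =>
    obtain ⟨f, A, h, e⟩ := ih
    obtain ⟨f2, A2, h2, e2⟩ := exists_rat' h.dual
    refine ⟨f2, A2, h2, ?_⟩
    rw [e2, el_dual h, e]; rfl

end word

end GW

end

set_option linter.all false

noncomputable section

namespace GW

open Set GriffithsWords

section red
variable {ι : Type} {L L' : Type} [LinearOrder L] [LinearOrder L']

/-- reduced words -/
def Red (f : L → ι × ℕ × Bool) (A : Set L) : Prop :=
  LF f A ∧ ∀ C : Set L, C.OrdConnected → el f (A ∩ C) = 1 → A ∩ C = ∅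

lemma Red.lf {f : L → ι × ℕ × Bool} {A : Set L} (h : Red f A) : LF f A := h.1

lemma Red.inter {f : L → ι × ℕ × Bool} {A C : Set L} (h : Red f A) (hC : C.OrdConnected) :
    Red f (A ∩ C) := by
  refine ⟨h.1.mono inter_subset_left, fun D hD => ?_⟩
  rw [inter_assoc]
  exact h.2 _ (hC.inter hD)

lemma ev_split {f : L → ι × ℕ × Bool} {A : Set L} (hA : LF f A) {D : Set L} (hD : IsLowerSet D) :
    ev f A = ev f (A ∩ D) * ev f (A ∩ Dᶜ) := by
  have := congrArg Subtype.val (el_split hA hD)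
  rwa [Subgroup.coe_mul, coe_el hA, coe_el (hA.mono inter_subset_left),
    coe_el (hA.mono inter_subset_left)] at this

lemma el_eq_of_ev {f f' : L → ι × ℕ × Bool} {A A' : Set L} (h : LF f A) (h' : LF f' A')
    (he : ev f A = ev f' A') : el f A = el f' A' := (el_eq_iff h h').2 he

/-- Deleting a trivial interval. -/
lemma el_delete {f : L → ι × ℕ × Bool} {A : Set L} (hA : LF f A) {C : Set L}
    (hC : C.OrdConnected) (h1 : el f (A ∩ C) = 1) : el f (A \ C) = el f A := by
  have hD : IsLowerSet {i : L | ∀ c ∈ C, i < c} :=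
    fun i j hij hi c hc => lt_of_le_of_lt hij (hi c hc)
  have hD2 : IsLowerSet {i : L | i ∈ C ∨ ∀ c ∈ C, i < c} := by
    intro i j hij hi
    by_cases hj : ∀ c ∈ C, j < c
    · exact Or.inr hj
    · push Not at hj
      obtain ⟨c, hc, hcj⟩ := hj
      rcases hi with hi | hi
      · exact Or.inl (hC.out hc hi ⟨hcj, hij⟩)
      · exact absurd (hi c hc) (not_lt.2 (hcj.trans hij))
  have hl : ∀ B : Set L, LF f (A ∩ B) := fun B => hA.mono inter_subset_left
  rw [el_split hA hD2, el_split (hl _) hD, el_split (hA.mono diff_subset) hD]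
  have e1 : A ∩ {i : L | i ∈ C ∨ ∀ c ∈ C, i < c} ∩ {i : L | ∀ c ∈ C, i < c}
    = A \ C ∩ {i : L | ∀ c ∈ C, i < c} := by
    ext i
    simp only [mem_inter_iff, mem_setOf_eq, mem_diff]
    constructor
    · rintro ⟨⟨h, _⟩, h3⟩; exact ⟨⟨h, fun hc => lt_irrefl _ (h3 i hc)⟩, h3⟩
    · rintro ⟨⟨h, _⟩, h3⟩; exact ⟨⟨h, Or.inr h3⟩, h3⟩
  have e2 : A ∩ {i : L | i ∈ C ∨ ∀ c ∈ C, i < c} ∩ {i : L | ∀ c ∈ C, i < c}ᶜ = A ∩ C := by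
    ext i
    simp only [mem_inter_iff, mem_setOf_eq, mem_compl_iff]
    constructor
    · rintro ⟨⟨h, h2⟩, h3⟩; exact ⟨h, h2.resolve_right h3⟩
    · rintro ⟨h, h2⟩; exact ⟨⟨h, Or.inl h2⟩, fun h3 => lt_irrefl _ (h3 i h2)⟩
  have e3 : A ∩ {i : L | i ∈ C ∨ ∀ c ∈ C, i < c}ᶜ = A \ C ∩ {i : L | ∀ c ∈ C, i < c}ᶜ := by
    ext i
    simp only [mem_inter_iff, mem_setOf_eq, mem_compl_iff, mem_diff]
    tauto
  rw [e1, e2, e3, h1, mul_one]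

/-- R1: every word contains a reduced word with the same value. -/
lemma exists_red {f : L → ι × ℕ × Bool} {A : Set L} (hA : LF f A) :
    ∃ B ⊆ A, Red f B ∧ el f B = el f A := by
  have hz := zorn_superset {B : Set L | B ⊆ A ∧ el f B = el f A} ?_
  · obtain ⟨B, hB⟩ := hz
    refine ⟨B, hB.prop.1, ⟨hA.mono hB.prop.1, fun C hC h1 => ?_⟩, hB.prop.2⟩
    have hBl : LF f B := hA.mono hB.prop.1
    have h2 : B \ C ∈ {B : Set L | B ⊆ A ∧ el f B = el f A} :=
      ⟨diff_subset.trans hB.prop.1, by rw [el_delete hBl hC h1, hB.prop.2]⟩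
    have h3 := hB.le_of_le h2 diff_subset
    ext i
    simp only [mem_inter_iff, mem_empty_iff_false, iff_false]
    rintro ⟨hi, hi2⟩
    exact (h3 hi).2 hi2
  · intro c hc hchain
    by_cases hne : c.Nonempty
    swap
    · rw [not_nonempty_iff_eq_empty] at hne
      exact ⟨A, ⟨Subset.rfl, rfl⟩, by simp [hne]⟩
    refine ⟨⋂₀ c, ⟨?_, ?_⟩, fun s hs => sInter_subset_of_mem hs⟩
    · obtain ⟨B, hB⟩ := hne
      exact (sInter_subset_of_mem hB).trans (hc hB).1
    · have hsub : ⋂₀ c ⊆ A := by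
        obtain ⟨B, hB⟩ := hne
        exact (sInter_subset_of_mem hB).trans (hc hB).1
      rw [el_eq_iff (hA.mono hsub) hA]
      funext N
      have key : ∀ F : Set L, F.Finite → ∃ B ∈ c, ∀ i ∈ F, i ∈ B → ∀ B' ∈ c, i ∈ B' := by
        intro F hF
        induction F, hF using Set.Finite.induction_on with
        | empty => obtain ⟨B, hB⟩ := hne; exact ⟨B, hB, by simp⟩
        | @insert a F _ _ ih =>
          obtain ⟨B, hB, h⟩ := ih
          by_cases ha : ∀ B' ∈ c, a ∈ B'
          · refine ⟨B, hB, ?_⟩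
            rintro i (rfl | hi) hiB
            · exact ha
            · exact h i hi hiB
          · push Not at ha
            obtain ⟨B', hB', ha⟩ := ha
            rcases hchain.total hB hB' with h1 | h1
            · refine ⟨B, hB, ?_⟩
              rintro i (rfl | hi) hiB
              · exact absurd (h1 hiB) ha
              · exact h i hi hiB
            · refine ⟨B', hB', ?_⟩
              rintro i (rfl | hi) hiB
              · exact absurd hiB ha
              · exact h i hi (h1 hiB)
      obtain ⟨B, hB, h⟩ := key _ (hA N)
      have e : lev f (⋂₀ c) N = lev f B N := by
        ext i; constructor
        · rintro ⟨h1, h2⟩; exact ⟨h1 B hB, h2⟩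
        · rintro ⟨h1, h2⟩
          exact ⟨fun B' hB' => h i ⟨(hc hB).1 h1, h2⟩ h1 B' hB', h2⟩
      have h4 := (el_eq_iff (hA.mono (hc hB).1) hA).1 (hc hB).2
      rw [← h4, ev, e, ev]

/-! ### gates -/

/-- The gate of a word. -/
def gate (N : ℕ) : List ((ι × ℕ) × Bool) → Option (List ((ι × ℕ) × Bool))
  | [] => none
  | c :: w => match gate N w with
    | some s => some s
    | none => if c.1.2 ≤ N then some (c :: w) else none

lemma gate_some {N : ℕ} {w s : List ((ι × ℕ) × Bool)} (h : gate N w = some s) :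
    ∃ d w', s = d :: w' ∧ d.1.2 ≤ N ∧ gate N w' = none := by
  induction w with
  | nil => simp [gate] at h
  | cons c w ih =>
    rw [gate] at h
    cases hw : gate N w with
    | some s' => rw [hw] at h; simp at h; subst h; exact ih hw
    | none =>
      rw [hw] at h
      simp at h
      exact ⟨c, w, h.2.symm, h.1, hw⟩

lemma kill_mk_single (N : ℕ) (c : (ι × ℕ) × Bool) :
    kill N (FreeGroup.mk [c]) = if c.1.2 ≤ N then FreeGroup.mk [c] else 1 :=
  kill_gen N (c.1.1, c.1.2, c.2)

lemma mk_cons (c : (ι × ℕ) × Bool) (w : List ((ι × ℕ) × Bool)) :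
    FreeGroup.mk (c :: w) = FreeGroup.mk [c] * FreeGroup.mk w := by
  simp [FreeGroup.mul_mk]

lemma kill_of_gate_none {N : ℕ} {w : List ((ι × ℕ) × Bool)} (h : gate N w = none) :
    kill N (FreeGroup.mk w) = 1 := by
  induction w with
  | nil => rw [← FreeGroup.one_eq_mk]; simp
  | cons c w ih =>
    rw [gate] at h
    cases hw : gate N w with
    | some s' => rw [hw] at h; simp at h
    | none =>
      rw [hw] at h
      simp at h
      rw [mk_cons, map_mul, kill_mk_single, if_neg (by omega), ih hw, one_mul]

lemma mk_single_ne_one (c : (ι × ℕ) × Bool) : FreeGroup.mk [c] ≠ 1 := by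
  classical
  intro h
  have := congrArg FreeGroup.toWord h
  simp [FreeGroup.toWord_mk, FreeGroup.reduce] at this

lemma kill_of_gate_self {N : ℕ} {w s : List ((ι × ℕ) × Bool)} (h : gate N w = some s) :
    kill N (FreeGroup.mk s) ≠ 1 := by
  obtain ⟨d, w', rfl, hd, hw⟩ := gate_some h
  rw [mk_cons, map_mul, kill_of_gate_none hw, kill_mk_single, if_pos hd, mul_one]
  exact mk_single_ne_one _

open Classical in
lemma toWord_step (c : (ι × ℕ) × Bool) (z : FreeGroup (ι × ℕ)) :
    FreeGroup.toWord (FreeGroup.mk [c] * z) = c :: FreeGroup.toWord z ∨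
    ∃ d, FreeGroup.toWord z = d :: FreeGroup.toWord (FreeGroup.mk [c] * z) := by
  have h : FreeGroup.toWord (FreeGroup.mk [c] * z) = FreeGroup.reduce (c :: z.toWord) := by
    conv_lhs => rw [← FreeGroup.mk_toWord (x := z)]
    rw [FreeGroup.mul_mk, FreeGroup.toWord_mk]; rfl
  rw [h, FreeGroup.reduce.cons, FreeGroup.reduce_toWord]
  cases hz : z.toWord with
  | nil => left; rfl
  | cons d w =>
    simp only
    split_ifs with h1
    · right; exact ⟨d, rfl⟩
    · left; rfl

open Classical in
lemma gate_step {N : ℕ} (c : (ι × ℕ) × Bool) (z : FreeGroup (ι × ℕ))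
    {s : List ((ι × ℕ) × Bool)} (h : gate N z.toWord = some s) :
    gate N (FreeGroup.toWord (FreeGroup.mk [c] * z)) = some s ∨
    (gate N (FreeGroup.toWord (FreeGroup.mk [c] * z)) = none ∧ z.toWord = s) := by
  rcases toWord_step c z with h1 | ⟨d, h1⟩
  · left; rw [h1, gate, h]
  · rw [h1, gate] at h
    cases hw : gate N (FreeGroup.toWord (FreeGroup.mk [c] * z)) with
    | some s' => rw [hw] at h; left; exact h
    | none =>
      rw [hw] at h
      simp at h
      right; exact ⟨rfl, by rw [h1]; exact h.2⟩

open Classical in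
lemma walk {N : ℕ} (f : L → ι × ℕ × Bool) {s : Set L} (hs : s.Finite) (z0 : FreeGroup (ι × ℕ))
    {p : List ((ι × ℕ) × Bool)} (h : gate N (z0⁻¹).toWord = some p) :
    (∃ D1 D : Set L, IsLowerSet D1 ∧ IsLowerSet D ∧
      ((z0 * oprod (s ∩ D1) (fun i => gen (f i)))⁻¹).toWord = p ∧
      gate N ((z0 * oprod (s ∩ D) (fun i => gen (f i)))⁻¹).toWord = none) ∨
    gate N ((z0 * oprod s (fun i => gen (f i)))⁻¹).toWord = some p := by
  refine finset_ind (p := fun s => (∃ D1 D : Set L, IsLowerSet D1 ∧ IsLowerSet D ∧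
      ((z0 * oprod (s ∩ D1) (fun i => gen (f i)))⁻¹).toWord = p ∧
      gate N ((z0 * oprod (s ∩ D) (fun i => gen (f i)))⁻¹).toWord = none) ∨
    gate N ((z0 * oprod s (fun i => gen (f i)))⁻¹).toWord = some p) hs ?_ ?_
  · right; simpa using h
  · intro a s hs ha ih
    have hcut : ∀ D : Set L, insert a s ∩ (D ∩ Iio a) = s ∩ D := by
      intro D; ext i; constructor
      · rintro ⟨h1, h2, h3⟩
        rcases h1 with rfl | h1
        · exact absurd h3 (lt_irrefl _)
        · exact ⟨h1, h2⟩
      · rintro ⟨h1, h2⟩; exact ⟨Or.inr h1, h2, ha i h1⟩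
    rcases ih with ⟨D1, D, h1, h2, h4, h5⟩ | ih
    · left
      refine ⟨D1 ∩ Iio a, D ∩ Iio a, h1.inter (isLowerSet_Iio a), h2.inter (isLowerSet_Iio a),
        ?_, ?_⟩
      · rw [hcut]; exact h4
      · rw [hcut]; exact h5
    · rw [oprod_insert_max hs a ha]
      have e : (z0 * (oprod s (fun i => gen (f i)) * gen (f a)))⁻¹ =
        FreeGroup.mk [(((f a).1, (f a).2.1), !(f a).2.2)] *
          (z0 * oprod s (fun i => gen (f i)))⁻¹ := by
        rw [← mul_assoc, mul_inv_rev, ← gen_linv]; rfl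
      rcases gate_step (N := N) (((f a).1, (f a).2.1), !(f a).2.2) _ ih with h1 | ⟨h1, h2⟩
      · right; rw [e]; exact h1
      · left
        refine ⟨univ ∩ Iio a, univ, isLowerSet_univ.inter (isLowerSet_Iio a), isLowerSet_univ,
          ?_, ?_⟩
        · rw [hcut, inter_univ]; exact h2
        · rw [inter_univ, oprod_insert_max hs a ha, e]; exact h1

/-! ### limits of sets along an ultrafilter -/

/-- ultrafilter limit of sets -/
def ulim (D : ℕ → Set L) : Set L := {i | ∀ᶠ M in (Filter.hyperfilter ℕ : Filter ℕ), i ∈ D M}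

lemma ulim_spec (D : ℕ → Set L) {F : Set L} (hF : F.Finite) :
    ∀ᶠ M in (Filter.hyperfilter ℕ : Filter ℕ), ∀ i ∈ F, (i ∈ ulim D ↔ i ∈ D M) := by
  rw [Filter.eventually_all_finite hF]
  intro i _
  by_cases h : i ∈ ulim D
  · have h' := h
    simp only [ulim, mem_setOf_eq] at h'
    filter_upwards [h'] with M hM
    simp [h, hM]
  · have h' := h
    simp only [ulim, mem_setOf_eq] at h'
    rw [← Ultrafilter.eventually_not] at h'
    filter_upwards [h'] with M hM
    simp [h, hM]

lemma ulim_ev {f : L → ι × ℕ × Bool} {A : Set L} (hA : LF f A) (D : ℕ → Set L) (N : ℕ) :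
    ∀ᶠ M in (Filter.hyperfilter ℕ : Filter ℕ), ev f (A ∩ ulim D) N = ev f (A ∩ D M) N := by
  filter_upwards [ulim_spec D (hA N)] with M hM
  have : lev f (A ∩ ulim D) N = lev f (A ∩ D M) N := by
    ext i; constructor
    · rintro ⟨⟨h1, h2⟩, h3⟩; exact ⟨⟨h1, (hM i ⟨h1, h3⟩).1 h2⟩, h3⟩
    · rintro ⟨⟨h1, h2⟩, h3⟩; exact ⟨⟨h1, (hM i ⟨h1, h3⟩).2 h2⟩, h3⟩
  rw [ev, this, ev]

lemma ulim_lower {D : ℕ → Set L} (h : ∀ M, IsLowerSet (D M)) : IsLowerSet (ulim D) := by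
  intro i j hij hi
  simp only [ulim, mem_setOf_eq] at hi ⊢
  filter_upwards [hi] with M hM
  exact h M hij hM

lemma hyper_ge (N : ℕ) : ∀ᶠ M in (Filter.hyperfilter ℕ : Filter ℕ), N ≤ M := by
  have := Nat.hyperfilter_le_atTop
  exact this (Filter.eventually_ge_atTop N)

lemma lev_inter (f : L → ι × ℕ × Bool) (A D : Set L) (N : ℕ) :
    lev f (A ∩ D) N = lev f A N ∩ D := by
  ext i; simp only [lev, mem_inter_iff, mem_setOf_eq]; tauto

open Classical in
/-- finite-level part of the separation lemma -/
lemma separation_aux {f : L → ι × ℕ × Bool} {A : Set L} (hA : LF f A)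
    {f' : L' → ι × ℕ × Bool} {A' : Set L'} (hA' : LF f' A') (hg : ev f A = ev f' A')
    {D : Set L} (hD : IsLowerSet D) {N : ℕ}
    (hN : ∀ D' : Set L', IsLowerSet D' → ev f' (A' ∩ D') N ≠ ev f (A ∩ D) N)
    (M : ℕ) (hM : N ≤ M) : ∃ D1 D2 : Set L, IsLowerSet D1 ∧ IsLowerSet D2 ∧ D1 ⊆ D ∧ D ⊆ D2 ∧
      ev f (A ∩ D1) M = ev f (A ∩ D2) M ∧ ev f (A ∩ D1) N ≠ ev f (A ∩ D) N := by
  have hl : ∀ B : Set L, LF f (A ∩ B) := fun B => hA.mono inter_subset_left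
  have hl' : ∀ B : Set L', LF f' (A' ∩ B) := fun B => hA'.mono inter_subset_left
  set x := ev f (A ∩ D) M with hx
  have hxN : kill N x = ev f (A ∩ D) N := kill_ev (hl D) hM
  have hst : ∃ p, gate N ((x⁻¹)⁻¹).toWord = some p := by
    rw [← Option.ne_none_iff_exists']
    intro h
    have := kill_of_gate_none h
    rw [FreeGroup.mk_toWord, inv_inv, hxN] at this
    apply hN ∅ (fun _ _ _ h => h)
    rw [this, inter_empty, ev_empty]; rfl
  obtain ⟨p, hp⟩ := hst
  -- avoid
  have hend : gate N ((x⁻¹ * ev f A M)⁻¹).toWord = some p := by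
    rcases walk f' (hA' M) x⁻¹ hp with ⟨D1, D', h1, h2, h3, h4⟩ | h
    · exfalso
      have := kill_of_gate_none h4
      rw [FreeGroup.mk_toWord, map_inv, inv_eq_one, map_mul, map_inv, hxN, inv_mul_eq_one,
        ← lev_inter] at this
      apply hN D' h2
      rw [this, ← kill_ev (hl' D') hM]; rfl
    · rw [hg]; exact h
  have hone : gate N (((1 : FreeGroup (ι × ℕ)))⁻¹).toWord = none := by
    simp [gate]
  -- first entry
  have hfirst : ∃ D1 : Set L, IsLowerSet D1 ∧ ((x⁻¹ * ev f (A ∩ D ∩ D1) M)⁻¹).toWord = p := by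
    rcases walk f (hl D M) x⁻¹ hp with ⟨D1, D', h1, h2, h3, h4⟩ | h
    · refine ⟨D1, h1, ?_⟩
      rw [← lev_inter] at h3; exact h3
    · rw [show oprod (lev f (A ∩ D) M) (fun i => gen (f i)) = x from rfl, inv_mul_cancel,
        hone] at h
      cases h
  have hlast : ∃ D1 : Set Lᵒᵈ, IsLowerSet D1 ∧
      ((x⁻¹ * ev f A M * ev (dl f) (dS (A ∩ Dᶜ) ∩ D1) M)⁻¹).toWord = p := by
    rcases walk (dl f) ((hl Dᶜ).dual M) (x⁻¹ * ev f A M) hend with ⟨D1, D', h1, h2, h3, h4⟩ | h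
    · refine ⟨D1, h1, ?_⟩
      rw [← lev_inter] at h3; exact h3
    · have e : oprod (lev (dl f) (dS (A ∩ Dᶜ)) M) (fun i => gen (dl f i)) =
          (ev f (A ∩ Dᶜ) M)⁻¹ := by
        have := congrFun (ev_dual (hl Dᶜ)) M
        rw [Pi.inv_apply] at this; exact this
      have e2 : ev f A M = x * ev f (A ∩ Dᶜ) M := by
        rw [ev_split hA hD, Pi.mul_apply]
      rw [e, e2] at h
      rw [show x⁻¹ * (x * ev f (A ∩ Dᶜ) M) * (ev f (A ∩ Dᶜ) M)⁻¹ = 1 by group, hone] at h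
      cases h
  obtain ⟨D1, hD1, h1⟩ := hfirst
  obtain ⟨D2, hD2, h2⟩ := hlast
  have hU : IsLowerSet {i : L | i ∈ D ∨ OrderDual.toDual i ∉ D2} := by
    intro i j hij hi
    rcases hi with hi | hi
    · exact Or.inl (hD hij hi)
    · refine Or.inr (fun hj => hi (hD2 ?_ hj))
      exact hij
  refine ⟨D ∩ D1, {i | i ∈ D ∨ OrderDual.toDual i ∉ D2}, hD.inter hD1, hU, inter_subset_left,
    fun i hi => Or.inl hi, ?_, ?_⟩
  · have e3 : dS (A ∩ Dᶜ) ∩ D2 = dS (A ∩ {i | i ∈ D ∨ OrderDual.toDual i ∉ D2}ᶜ) := by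
      ext i
      simp only [dS, mem_inter_iff, mem_preimage, mem_compl_iff, mem_setOf_eq, not_or, not_not,
        OrderDual.toDual_ofDual]
      tauto
    rw [e3, ev_dual (hl _)] at h2
    have e4 : ev f A M * (ev f (A ∩ {i | i ∈ D ∨ OrderDual.toDual i ∉ D2}ᶜ))⁻¹ M =
        ev f (A ∩ {i | i ∈ D ∨ OrderDual.toDual i ∉ D2}) M := by
      rw [ev_split hA hU, Pi.mul_apply, Pi.inv_apply, mul_assoc, mul_inv_cancel, mul_one]
    rw [mul_assoc, e4] at h2
    have h3 := FreeGroup.toWord_injective (h1.trans h2.symm)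
    rw [inv_inj, mul_right_inj] at h3
    rw [← inter_assoc]; exact h3
  · intro h3
    have := kill_of_gate_self hp
    rw [← h1, FreeGroup.mk_toWord, map_inv, map_mul, map_inv, hxN, kill_ev ((hl _).mono
      inter_subset_left) hM, inter_assoc, h3] at this
    simp at this

/-- The separation lemma. -/
lemma separation {f : L → ι × ℕ × Bool} {A : Set L} (hA : Red f A)
    {f' : L' → ι × ℕ × Bool} {A' : Set L'} (hA' : LF f' A') (hg : el f A = el f' A')
    {D : Set L} (hD : IsLowerSet D) :
    ∃ D' : Set L', IsLowerSet D' ∧ el f' (A' ∩ D') = el f (A ∩ D) := by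
  have hl : ∀ B : Set L, LF f (A ∩ B) := fun B => hA.1.mono inter_subset_left
  have hl' : ∀ B : Set L', LF f' (A' ∩ B) := fun B => hA'.mono inter_subset_left
  rw [el_eq_iff hA.1 hA'] at hg
  by_cases hN : ∀ N, ∃ D' : Set L', IsLowerSet D' ∧ ev f' (A' ∩ D') N = ev f (A ∩ D) N
  · choose D' hD' h using hN
    refine ⟨ulim D', ulim_lower hD', ?_⟩
    rw [el_eq_iff (hl' _) (hl _)]
    funext N
    obtain ⟨M, hM1, hM2⟩ := ((ulim_ev hA' D' N).and (hyper_ge N)).exists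
    rw [hM1, ← kill_ev (hl' _) hM2, h, kill_ev (hl _) hM2]
  · exfalso
    push Not at hN
    obtain ⟨N, hN⟩ := hN
    have key := fun M => separation_aux hA.1 hA' hg hD hN (max N M) (le_max_left _ _)
    choose D1 D2 h1 h2 h3 h4 h5 h6 using key
    have hlim : ev f (A ∩ ulim D1) = ev f (A ∩ ulim D2) := by
      funext K
      obtain ⟨M, ⟨hM1, hM2⟩, hM3⟩ := (((ulim_ev hA.1 D1 K).and (ulim_ev hA.1 D2 K)).and
        (hyper_ge K)).exists
      rw [hM1, hM2, ← kill_ev (hl _) (hM3.trans (le_max_right N M)), h5,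
        kill_ev (hl _) (hM3.trans (le_max_right N M))]
    have s1 : ulim D1 ⊆ D := by
      intro i hi
      obtain ⟨M, hM⟩ := Filter.Eventually.exists hi
      exact h3 M hM
    have s2 : D ⊆ ulim D2 := fun i hi => Filter.Eventually.of_forall (fun M => h4 M hi)
    have hD1 := ulim_lower h1
    have hD2 := ulim_lower h2
    have hm : A ∩ (ulim D2 ∩ (ulim D1)ᶜ) = ∅ := by
      apply hA.2 _ (hD2.ordConnected.inter hD1.compl.ordConnected)
      have := el_split (hl (ulim D2)) hD1
      rw [inter_assoc, inter_assoc, inter_eq_self_of_subset_right (s1.trans s2),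
        ← (el_eq_iff (hl _) (hl _)).2 hlim] at this
      simpa using this
    have hAD : A ∩ ulim D1 = A ∩ D := by
      ext i; constructor
      · rintro ⟨ha, hi⟩; exact ⟨ha, s1 hi⟩
      · rintro ⟨ha, hi⟩
        refine ⟨ha, ?_⟩
        by_contra hc
        have : i ∈ A ∩ (ulim D2 ∩ (ulim D1)ᶜ) := ⟨ha, s2 hi, hc⟩
        rw [hm] at this; exact this
    obtain ⟨M, hM⟩ := (ulim_ev hA.1 D1 N).exists
    apply h6 M
    rw [← hM, hAD]

end red

end GW

end

set_option linter.all false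

noncomputable section

namespace GW

open Set GriffithsWords

section tree
variable {ι : Type} [Inhabited ι] {L L' : Type} [LinearOrder L] [LinearOrder L']

lemma kill_coe (g : wordGroup ι) {N M : ℕ} (h : N ≤ M) : kill N (g.1 M) = g.1 N := by
  obtain ⟨f, A, hA, rfl⟩ := exists_rep g
  rw [coe_el hA, kill_ev hA h]

/-- prefix relation -/
def Pre (x g : wordGroup ι) : Prop :=
  ∀ (f : ℚ → ι × ℕ × Bool) (A : Set ℚ), LF f A → el f A = g →
    ∃ D : Set ℚ, IsLowerSet D ∧ el f (A ∩ D) = x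

lemma pre_of_red {f : L → ι × ℕ × Bool} {A : Set L} (h : Red f A) {D : Set L}
    (hD : IsLowerSet D) : Pre (el f (A ∩ D)) (el f A) := by
  intro f' A' hA' he
  exact separation h hA' he.symm hD

lemma Pre.rep {x g : wordGroup ι} (h : Pre x g) {f : L → ι × ℕ × Bool} {A : Set L}
    (hA : LF f A) (hg : el f A = g) : ∃ D : Set L, IsLowerSet D ∧ el f (A ∩ D) = x := by
  obtain ⟨e, f', he, hf⟩ := exists_rat f A hA
  obtain ⟨D', hD', hx⟩ := h f' (e '' A) (hA.image (fun i hi => by rw [hf i hi]))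
    (by rw [el_image hA he hf, hg])
  refine ⟨{i | ∃ j ∈ A, i ≤ j ∧ e j ∈ D'}, ?_, ?_⟩
  · rintro i j hij ⟨k, hk, h1, h2⟩
    exact ⟨k, hk, hij.trans h1, h2⟩
  · rw [← hx]
    have : e '' A ∩ D' = e '' (A ∩ {i | ∃ j ∈ A, i ≤ j ∧ e j ∈ D'}) := by
      ext q; constructor
      · rintro ⟨⟨i, hi, rfl⟩, hq⟩
        exact ⟨i, ⟨hi, i, hi, le_rfl, hq⟩, rfl⟩
      · rintro ⟨i, ⟨hi, j, hj, hij, hq⟩, rfl⟩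
        exact ⟨⟨i, hi, rfl⟩, hD' ((he.le_iff_le hi hj).2 hij) hq⟩
    rw [this, el_image (hA.mono inter_subset_left) (he.mono inter_subset_left)
      (fun i hi => hf i hi.1)]

lemma exists_redrep (g : wordGroup ι) : ∃ (f : ℚ → ι × ℕ × Bool) (A : Set ℚ),
    Red f A ∧ el f A = g := by
  obtain ⟨f, A, hA, rfl⟩ := exists_rep g
  obtain ⟨B, _, h1, h2⟩ := exists_red hA
  exact ⟨f, B, h1, h2⟩

lemma Red.inj_sub {f : L → ι × ℕ × Bool} {A : Set L} (h : Red f A) {D D' : Set L}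
    (hD : IsLowerSet D) (hD' : IsLowerSet D') (hs : D ⊆ D')
    (he : el f (A ∩ D) = el f (A ∩ D')) : A ∩ D = A ∩ D' := by
  have hl : ∀ B : Set L, LF f (A ∩ B) := fun B => h.1.mono inter_subset_left
  have h1 := el_split (hl D') hD
  rw [inter_assoc, inter_assoc, inter_eq_self_of_subset_right hs, he] at h1
  have h2 := h.2 (D' ∩ Dᶜ) (hD'.ordConnected.inter hD.compl.ordConnected) (by simpa using h1)
  ext i; constructor
  · rintro ⟨ha, hi⟩; exact ⟨ha, hs hi⟩
  · rintro ⟨ha, hi⟩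
    refine ⟨ha, ?_⟩
    by_contra hc
    have : i ∈ A ∩ (D' ∩ Dᶜ) := ⟨ha, hi, hc⟩
    rw [h2] at this; exact this

lemma Red.inj {f : L → ι × ℕ × Bool} {A : Set L} (h : Red f A) {D D' : Set L}
    (hD : IsLowerSet D) (hD' : IsLowerSet D')
    (he : el f (A ∩ D) = el f (A ∩ D')) : A ∩ D = A ∩ D' := by
  rcases hD.total hD' with hs | hs
  · exact h.inj_sub hD hD' hs he
  · exact (h.inj_sub hD' hD hs he.symm).symm

lemma Red.dual {f : L → ι × ℕ × Bool} {A : Set L} (h : Red f A) : Red (dl f) (dS A) := by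
  refine ⟨h.1.dual, fun C hC h1 => ?_⟩
  have e : dS A ∩ C = dS (A ∩ (OrderDual.toDual ⁻¹' C)) := by
    ext i; simp [dS]
  have hC' : (OrderDual.toDual ⁻¹' C : Set L).OrdConnected := by
    constructor
    intro x hx y hy z hz
    exact hC.out hy hx ⟨hz.2, hz.1⟩
  rw [e, el_dual (h.1.mono inter_subset_left), inv_eq_one] at h1
  rw [e, h.2 _ hC' h1]
  ext; simp [dS]

lemma pre_one (g : wordGroup ι) : Pre 1 g := by
  intro f A hA _
  exact ⟨∅, isLowerSet_empty, by simp⟩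

lemma pre_refl (g : wordGroup ι) : Pre g g := by
  intro f A hA h
  exact ⟨univ, isLowerSet_univ, by simpa using h⟩

lemma pre_trans' {x y g : wordGroup ι} (h1 : Pre x y) (h2 : Pre y g) :
    Pre x g ∧ Pre (x⁻¹ * y) (x⁻¹ * g) := by
  obtain ⟨f, A, hA, rfl⟩ := exists_redrep g
  obtain ⟨D, hD, rfl⟩ := h2.rep hA.1 rfl
  obtain ⟨D', hD', rfl⟩ := h1.rep (hA.inter hD.ordConnected).1 rfl
  constructor
  · rw [inter_assoc]; exact pre_of_red hA (hD.inter hD')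
  · have e1 := el_split hA.1 (hD.inter hD')
    have e2 := el_split (hA.inter hD.ordConnected).1 hD'
    have e3 : A ∩ D ∩ D'ᶜ = A ∩ (D ∩ D')ᶜ ∩ D := by
      ext i; simp only [mem_inter_iff, mem_compl_iff]; tauto
    rw [e1, e2, inv_mul_cancel_left, inter_assoc A D D', inv_mul_cancel_left, e3]
    exact pre_of_red (hA.inter (hD.inter hD').compl.ordConnected) hD

lemma Pre.trans {x y g : wordGroup ι} (h1 : Pre x y) (h2 : Pre y g) : Pre x g :=
  (pre_trans' h1 h2).1

lemma Pre.tail {x y g : wordGroup ι} (h1 : Pre x y) (h2 : Pre y g) :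
    Pre (x⁻¹ * y) (x⁻¹ * g) := (pre_trans' h1 h2).2

lemma pre_mul {x y g : wordGroup ι} (h1 : Pre x g) (h2 : Pre y (x⁻¹ * g)) :
    Pre (x * y) g ∧ Pre x (x * y) := by
  obtain ⟨f, A, hA, rfl⟩ := exists_redrep g
  obtain ⟨D, hD, rfl⟩ := h1.rep hA.1 rfl
  have e1 := el_split hA.1 hD
  rw [e1, inv_mul_cancel_left] at h2
  obtain ⟨D', hD', rfl⟩ := h2.rep (hA.inter hD.compl.ordConnected).1 rfl
  have e2 := el_split (hA.inter (hD.union hD').ordConnected).1 hD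
  have e3 : A ∩ (D ∪ D') ∩ D = A ∩ D := by
    ext i; simp only [mem_inter_iff, mem_union]; tauto
  have e4 : A ∩ (D ∪ D') ∩ Dᶜ = A ∩ Dᶜ ∩ D' := by
    ext i; simp only [mem_inter_iff, mem_union, mem_compl_iff]; tauto
  rw [e3, e4] at e2
  rw [← e2]
  refine ⟨pre_of_red hA (hD.union hD'), ?_⟩
  have := pre_of_red (hA.inter (hD.union hD').ordConnected) hD
  rwa [e3] at this

lemma Pre.inv {x g : wordGroup ι} (h : Pre x g) : Pre (g⁻¹ * x) g⁻¹ := by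
  obtain ⟨f, A, hA, rfl⟩ := exists_redrep g
  obtain ⟨D, hD, rfl⟩ := h.rep hA.1 rfl
  have e1 := el_split hA.1 hD
  have hD' : IsLowerSet (dS Dᶜ) := by
    intro i j hij hi hj
    exact hi (hD hij hj)
  have h1 := pre_of_red hA.dual hD'
  have e2 : dS A ∩ dS Dᶜ = dS (A ∩ Dᶜ) := rfl
  rw [e2, el_dual hA.1, el_dual (hA.inter hD.compl.ordConnected).1] at h1
  convert h1 using 1
  rw [e1]; group

lemma Pre.total {x y g : wordGroup ι} (h1 : Pre x g) (h2 : Pre y g) : Pre x y ∨ Pre y x := by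
  obtain ⟨f, A, hA, rfl⟩ := exists_redrep g
  obtain ⟨D, hD, rfl⟩ := h1.rep hA.1 rfl
  obtain ⟨D', hD', rfl⟩ := h2.rep hA.1 rfl
  have key : ∀ {D D' : Set ℚ}, IsLowerSet D → IsLowerSet D' → D ⊆ D' →
      Pre (el f (A ∩ D)) (el f (A ∩ D')) := by
    intro D D' hD hD' hs
    have := pre_of_red (hA.inter hD'.ordConnected) hD
    rwa [inter_assoc, inter_eq_self_of_subset_right hs] at this
  rcases hD.total hD' with h | h
  · exact Or.inl (key hD hD' h)
  · exact Or.inr (key hD' hD h)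

lemma Pre.antisymm {x y : wordGroup ι} (h1 : Pre x y) (h2 : Pre y x) : x = y := by
  obtain ⟨f, A, hA, rfl⟩ := exists_redrep y
  obtain ⟨D, hD, rfl⟩ := h1.rep hA.1 rfl
  obtain ⟨D', hD', h3⟩ := h2.rep (hA.inter hD.ordConnected).1 rfl
  rw [inter_assoc] at h3
  have := hA.inj (hD.inter hD') isLowerSet_univ (by rw [h3, inter_univ])
  congr 1
  ext i; constructor
  · exact fun h => h.1
  · intro h
    have h4 : i ∈ A ∩ univ := ⟨h, trivial⟩
    rw [← this] at h4
    exact ⟨h4.1, h4.2.1⟩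

lemma pre_one_iff {x : wordGroup ι} (h : Pre x 1) : x = 1 := h.antisymm (pre_one x)

/-- the set of prefixes is closed. -/
lemma pre_of_levels {x k : wordGroup ι} (h : ∀ N, ∃ y, Pre y k ∧ y.1 N = x.1 N) : Pre x k := by
  intro f A hA hk
  choose y hy hy2 using h
  choose D hD hD2 using fun N => (hy N).rep hA hk
  refine ⟨ulim D, ulim_lower hD, ?_⟩
  apply Subtype.ext
  rw [coe_el (hA.mono inter_subset_left)]
  funext N
  obtain ⟨M, h1, h2⟩ := ((ulim_ev hA D N).and (hyper_ge N)).exists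
  rw [h1, ← coe_el (hA.mono inter_subset_left), hD2, ← kill_coe _ h2, hy2, kill_coe _ h2]

lemma red_cat {f : L → ι × ℕ × Bool} {A : Set L} (hA : Red f A)
    {f' : L' → ι × ℕ × Bool} {B : Set L'} (hB : Red f' B)
    (h : ∀ (U : Set L) (D : Set L'), IsLowerSet U → IsLowerSet D →
      el f (A ∩ Uᶜ) * el f' (B ∩ D) = 1 → B ∩ D = ∅) : Red (catf f f') (catS A B) := by
  refine ⟨hA.1.cat hB.1, fun C hC h1 => ?_⟩
  have e0 : catS A B ∩ C = catS (A ∩ (fun x => toLex (Sum.inl x)) ⁻¹' C)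
      (B ∩ (fun x => toLex (Sum.inr x)) ⁻¹' C) := by
    ext x
    simp only [catS, mem_inter_iff, mem_union, mem_image, mem_preimage]
    constructor
    · rintro ⟨⟨i, hi, rfl⟩ | ⟨i, hi, rfl⟩, h⟩
      · exact Or.inl ⟨i, ⟨hi, h⟩, rfl⟩
      · exact Or.inr ⟨i, ⟨hi, h⟩, rfl⟩
    · rintro (⟨i, ⟨hi, h⟩, rfl⟩ | ⟨i, ⟨hi, h⟩, rfl⟩)
      · exact ⟨Or.inl ⟨i, hi, rfl⟩, h⟩
      · exact ⟨Or.inr ⟨i, hi, rfl⟩, h⟩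
  set C1 : Set L := (fun x => toLex (Sum.inl x)) ⁻¹' C with hC1
  set C2 : Set L' := (fun x => toLex (Sum.inr x)) ⁻¹' C with hC2
  have o1 : C1.OrdConnected := by
    constructor
    intro x hx y hy z hz
    exact hC.out hx hy ⟨Sum.Lex.inl_mono hz.1, Sum.Lex.inl_mono hz.2⟩
  have o2 : C2.OrdConnected := by
    constructor
    intro x hx y hy z hz
    exact hC.out hx hy ⟨Sum.Lex.inr_mono hz.1, Sum.Lex.inr_mono hz.2⟩
  have l1 : LF f (A ∩ C1) := (hA.inter o1).1
  have l2 : LF f' (B ∩ C2) := (hB.inter o2).1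
  rw [e0] at h1 ⊢
  rw [el_cat l1 l2] at h1
  have fin : A ∩ C1 = ∅ → catS (A ∩ C1) (B ∩ C2) = ∅ := by
    intro h2
    rw [h2, el_empty, one_mul] at h1
    rw [h2, hB.2 _ o2 h1]
    simp [catS]
  have fin2 : B ∩ C2 = ∅ → catS (A ∩ C1) (B ∩ C2) = ∅ := by
    intro h2
    rw [h2, el_empty, mul_one] at h1
    rw [h2, hA.2 _ o1 h1]
    simp [catS]
  by_cases n1 : A ∩ C1 = ∅
  · exact fin n1
  by_cases n2 : B ∩ C2 = ∅
  · exact fin2 n2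
  apply fin2
  obtain ⟨a, ha⟩ := nonempty_iff_ne_empty.2 n1
  obtain ⟨b, hb⟩ := nonempty_iff_ne_empty.2 n2
  have q1 : A ∩ C1 = A ∩ {i : L | ∀ c ∈ C1, i < c}ᶜ := by
    ext i
    simp only [mem_inter_iff, mem_compl_iff, mem_setOf_eq, and_congr_right_iff]
    intro _
    constructor
    · intro hi h; exact lt_irrefl _ (h i hi)
    · intro h; push Not at h
      obtain ⟨c, hc, hci⟩ := h
      exact hC.out hc hb.2 ⟨Sum.Lex.inl_mono hci, (Sum.Lex.inl_lt_inr _ _).le⟩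
  have q2 : B ∩ C2 = B ∩ {i : L' | ∃ c ∈ C2, i ≤ c} := by
    ext i
    simp only [mem_inter_iff, mem_setOf_eq, and_congr_right_iff]
    intro _
    constructor
    · intro hi; exact ⟨i, hi, le_rfl⟩
    · rintro ⟨c, hc, hci⟩
      exact hC.out ha.2 hc ⟨(Sum.Lex.inl_lt_inr _ _).le, Sum.Lex.inr_mono hci⟩
  rw [q2]
  refine h {i : L | ∀ c ∈ C1, i < c} {i : L' | ∃ c ∈ C2, i ≤ c} ?_ ?_ ?_
  · exact fun i j hij hi c hc => lt_of_le_of_lt hij (hi c hc)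
  · rintro i j hij ⟨c, hc, h⟩; exact ⟨c, hc, hij.trans h⟩
  · rw [← q1, ← q2]; exact h1

lemma tripod (g h : wordGroup ι) : ∃ u, Pre u g⁻¹ ∧ Pre u h ∧ Pre (g * u) (g * h) := by
  obtain ⟨f, A, hA, rfl⟩ := exists_redrep g
  obtain ⟨f', B, hB, rfl⟩ := exists_redrep h
  set g := el f A
  let 𝒟 : Set (Set ℚ) := {D | IsLowerSet D ∧ Pre (el f' (B ∩ D)) g⁻¹}
  set D := ⋃₀ 𝒟 with hDdef
  have hD : IsLowerSet D := isLowerSet_sUnion (fun D hD => hD.1)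
  have hl : ∀ C : Set ℚ, LF f' (B ∩ C) := fun C => hB.1.mono inter_subset_left
  have he : ∅ ∈ 𝒟 := ⟨isLowerSet_empty, by rw [inter_empty, el_empty]; exact pre_one _⟩
  have hu : Pre (el f' (B ∩ D)) g⁻¹ := by
    apply pre_of_levels
    intro N
    have key : ∀ F : Set ℚ, F.Finite → ∃ D1 ∈ 𝒟, ∀ i ∈ F, i ∈ D → i ∈ D1 := by
      intro F hF
      induction F, hF using Set.Finite.induction_on with
      | empty => exact ⟨∅, he, by simp⟩
      | @insert a F _ _ ih =>
        obtain ⟨D1, hD1, h⟩ := ih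
        by_cases ha : a ∈ D
        · obtain ⟨D2, hD2, ha2⟩ := ha
          rcases hD1.1.total hD2.1 with hs | hs
          · refine ⟨D2, hD2, ?_⟩
            rintro i (rfl | hi) hiD
            · exact ha2
            · exact hs (h i hi hiD)
          · refine ⟨D1, hD1, ?_⟩
            rintro i (rfl | hi) hiD
            · exact hs ha2
            · exact h i hi hiD
        · refine ⟨D1, hD1, ?_⟩
          rintro i (rfl | hi) hiD
          · exact absurd hiD ha
          · exact h i hi hiD
    obtain ⟨D1, hD1, h⟩ := key _ (hB.1 N)
    refine ⟨_, hD1.2, ?_⟩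
    rw [coe_el (hl _), coe_el (hl _)]
    have : lev f' (B ∩ D1) N = lev f' (B ∩ D) N := by
      ext i; constructor
      · rintro ⟨⟨h1, h2⟩, h3⟩; exact ⟨⟨h1, D1, hD1, h2⟩, h3⟩
      · rintro ⟨⟨h1, h2⟩, h3⟩; exact ⟨⟨h1, h i ⟨h1, h3⟩ h2⟩, h3⟩
    rw [ev, this, ev]
  refine ⟨el f' (B ∩ D), hu, pre_of_red hB hD, ?_⟩
  have hgu : Pre (g * el f' (B ∩ D)) g := by simpa using hu.inv
  obtain ⟨V, hV, hV2⟩ := hgu.rep hA.1 rfl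
  have hsplit := el_split hB.1 hD
  have hR : Red (catf f f') (catS (A ∩ V) (B ∩ Dᶜ)) := by
    refine red_cat (hA.inter hV.ordConnected) (hB.inter hD.compl.ordConnected) ?_
    intro U D' hU hD' h1
    have e1 := el_split (hA.inter hV.ordConnected).1 hU
    have p1 := pre_of_red (hA.inter hV.ordConnected) hU
    have e2 : el f (A ∩ V ∩ U) = g * (el f' (B ∩ D) * el f' (B ∩ Dᶜ ∩ D')) := by
      rw [← mul_assoc, ← hV2, e1, mul_assoc, h1, mul_one]
    have p2 : Pre (el f' (B ∩ D) * el f' (B ∩ Dᶜ ∩ D')) g⁻¹ := by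
      have := (p1.trans (by rw [hV2]; exact hgu)).inv
      rwa [e2, inv_mul_cancel_left] at this
    have e3 : el f' (B ∩ (D ∪ D')) = el f' (B ∩ D) * el f' (B ∩ Dᶜ ∩ D') := by
      rw [el_split (hl (D ∪ D')) hD]
      congr 2
      · ext i; simp only [mem_inter_iff, mem_union]; tauto
      · ext i; simp only [mem_inter_iff, mem_union, mem_compl_iff]; tauto
    have h4 : D ∪ D' ∈ 𝒟 := ⟨hD.union hD', by rw [e3]; exact p2⟩
    ext i
    simp only [mem_inter_iff, mem_compl_iff, mem_empty_iff_false, iff_false]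
    rintro ⟨⟨_, h5⟩, h6⟩
    exact h5 ⟨_, h4, Or.inr h6⟩
  have hlow : IsLowerSet (range (fun x : ℚ => toLex (Sum.inl x : ℚ ⊕ ℚ))) := by
    rintro _ j hij ⟨x, rfl⟩
    induction j using Lex.rec with
    | _ j =>
    rcases j with j | j
    · exact ⟨j, rfl⟩
    · exact absurd hij (not_le.2 (Sum.Lex.inl_lt_inr _ _))
  have := pre_of_red hR hlow
  rw [el_cat (hA.inter hV.ordConnected).1 (hl _), hV2, mul_assoc, ← hsplit] at this
  convert this using 1
  have e5 : catS (A ∩ V) (B ∩ Dᶜ) ∩ (range (fun x : ℚ => toLex (Sum.inl x : ℚ ⊕ ℚ))) =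
      catS (A ∩ V) ∅ := by
    ext x; constructor
    · rintro ⟨⟨i, hi, rfl⟩ | ⟨i, hi, rfl⟩, j, hj⟩
      · exact Or.inl ⟨i, hi, rfl⟩
      · simp at hj
    · rintro (⟨i, hi, rfl⟩ | ⟨i, hi, rfl⟩)
      · exact ⟨Or.inl ⟨i, hi, rfl⟩, i, rfl⟩
      · exact absurd hi (by simp)
  rw [e5, el_cat (hA.inter hV.ordConnected).1 (LF_empty _), el_empty, mul_one, hV2]

/-! ### local to global -/

variable {K : Type} [Group K]

/-- finite concatenations of local elements -/
inductive Val (Lr : wordGroup ι → K → Prop) : wordGroup ι → K → Prop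
  | one : Val Lr 1 1
  | cons {b h : wordGroup ι} {c k : K} : Lr b c → Val Lr h k → Pre b (b * h) →
      Val Lr (b * h) (c * k)

/-- hypotheses of the local-to-global principle -/
structure IsLoc (Lr : wordGroup ι → K → Prop) : Prop where
  func : ∀ g k k', Lr g k → Lr g k' → k = k'
  inv : ∀ g k, Lr g k → Lr g⁻¹ k⁻¹
  split : ∀ g k x, Lr g k → Pre x g → ∃ k1 k2, Lr x k1 ∧ Lr (x⁻¹ * g) k2 ∧ k = k1 * k2

variable {Lr : wordGroup ι → K → Prop}

lemma Val.single {g : wordGroup ι} {k : K} (h : Lr g k) : Val Lr g k := by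
  have := Val.cons h Val.one (by rw [mul_one]; exact pre_refl g)
  rwa [mul_one, mul_one] at this

lemma IsLoc.one (H : IsLoc Lr) {k : K} (h : Lr 1 k) : k = 1 := by
  obtain ⟨k1, k2, h1, h2, h3⟩ := H.split 1 k 1 h (pre_refl _)
  rw [inv_one, mul_one] at h2
  have e1 := H.func _ _ _ h h1
  have e2 := H.func _ _ _ h h2
  rw [← e1, ← e2] at h3
  exact (left_eq_mul.1 h3)

lemma IsLoc.vsplit (H : IsLoc Lr) {g : wordGroup ι} {k : K} (h : Val Lr g k) :
    ∀ x, Pre x g → ∃ k1 k2, Val Lr x k1 ∧ Val Lr (x⁻¹ * g) k2 ∧ k = k1 * k2 := by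
  induction h with
  | one =>
    intro x hx
    obtain rfl := pre_one_iff hx
    exact ⟨1, 1, Val.one, by simpa using Val.one, by simp⟩
  | @cons b h c k hb hh hp ih =>
    intro x hx
    rcases hx.total hp with h1 | h1
    · obtain ⟨k1, k2, a1, a2, rfl⟩ := H.split _ _ _ hb h1
      refine ⟨k1, k2 * k, Val.single a1, ?_, by rw [mul_assoc]⟩
      rw [← mul_assoc]
      refine Val.cons a2 hh ?_
      rw [mul_assoc]
      exact h1.tail hp
    · have h2 := h1.tail hx
      rw [inv_mul_cancel_left] at h2
      obtain ⟨k1, k2, a1, a2, rfl⟩ := ih _ h2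
      refine ⟨c * k1, k2, ?_, ?_, by rw [mul_assoc]⟩
      · have := Val.cons hb a1 (by rwa [mul_inv_cancel_left])
        rwa [mul_inv_cancel_left] at this
      · convert a2 using 1; group

lemma IsLoc.vloc (H : IsLoc Lr) {g : wordGroup ι} {k : K} (h : Val Lr g k) :
    ∀ c, Lr g c → c = k := by
  induction h with
  | one => intro c hc; exact H.one hc
  | @cons b h c k hb hh hp ih =>
    intro c' hc'
    obtain ⟨k1, k2, a1, a2, rfl⟩ := H.split _ _ _ hc' hp
    rw [inv_mul_cancel_left] at a2
    rw [H.func _ _ _ a1 hb, ih _ a2]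

lemma IsLoc.vfunc (H : IsLoc Lr) {g : wordGroup ι} {k : K} (h : Val Lr g k) :
    ∀ k', Val Lr g k' → k' = k := by
  induction h with
  | one =>
    intro k' hk'
    generalize hg : (1 : wordGroup ι) = g at hk'
    induction hk' with
    | one => rfl
    | @cons b h c k hb hh hp ih =>
      rw [← hg] at hp
      obtain rfl := pre_one_iff hp
      rw [one_mul] at hg
      rw [H.one hb, ih hg, one_mul]
  | @cons b h c k hb hh hp ih =>
    intro k' hk'
    obtain ⟨k1, k2, a1, a2, rfl⟩ := H.vsplit hk' _ hp
    rw [inv_mul_cancel_left] at a2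
    rw [ih _ a2, ← H.vloc a1 _ hb]

lemma Val.append {g h : wordGroup ι} {k k' : K} (hg : Val Lr g k) (hh : Val Lr h k')
    (hp : Pre g (g * h)) : Val Lr (g * h) (k * k') := by
  induction hg with
  | one => simpa using hh
  | @cons b g c k hb hg hpb ih =>
    rw [mul_assoc, mul_assoc]
    have h1 := hpb.trans hp
    have h2 := hpb.tail hp
    rw [mul_assoc, inv_mul_cancel_left, inv_mul_cancel_left] at h2
    refine Val.cons hb (ih h2) ?_
    rwa [mul_assoc] at h1

lemma IsLoc.vinv (H : IsLoc Lr) {g : wordGroup ι} {k : K} (h : Val Lr g k) :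
    Val Lr g⁻¹ k⁻¹ := by
  induction h with
  | one => simpa using Val.one
  | @cons b h c k hb hh hp ih =>
    rw [mul_inv_rev, mul_inv_rev]
    refine ih.append (Val.single (H.inv _ _ hb)) ?_
    have := hp.inv
    rwa [mul_inv_rev, inv_mul_cancel_right] at this

lemma IsLoc.vmul (H : IsLoc Lr) {g h : wordGroup ι} {k k' : K} (hg : Val Lr g k)
    (hh : Val Lr h k') : Val Lr (g * h) (k * k') := by
  obtain ⟨u, h1, h2, h3⟩ := tripod g h
  obtain ⟨k1, k2, a1, a2, a3⟩ := H.vsplit (H.vinv hg) _ h1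
  obtain ⟨l1, l2, b1, b2, b3⟩ := H.vsplit hh _ h2
  have e := H.vfunc a1 _ b1
  have a4 := H.vinv a2
  rw [mul_inv_rev, inv_inv, inv_inv] at a4
  have := a4.append b2 (by rwa [mul_assoc, mul_inv_cancel_left])
  rw [mul_assoc, mul_inv_cancel_left] at this
  convert this using 1
  rw [b3, e, ← inv_inv k, a3]; group

/-- The subgroup generated by a local relation. -/
def IsLoc.sub (H : IsLoc Lr) : Subgroup (wordGroup ι × K) where
  carrier := {p | Val Lr p.1 p.2}
  mul_mem' := fun ha hb => H.vmul ha hb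
  one_mem' := Val.one
  inv_mem' := fun ha => H.vinv ha

lemma IsLoc.sub_le (H : IsLoc Lr) (R : Subgroup (wordGroup ι × K))
    (h : ∀ g k, Lr g k → (g, k) ∈ R) : H.sub ≤ R := by
  rintro ⟨g, k⟩ hg
  have hg : Val Lr g k := hg
  induction hg with
  | one => exact R.one_mem
  | @cons b h' c k hb hh hp ih => exact R.mul_mem (h _ _ hb) (ih hh)

end tree

end GW

end

set_option linter.all false

noncomputable section

namespace GW

open Set GriffithsWords Cardinal

/-- An alphabet with a colouring and two sequences of marker letters. -/
class Sys (ι : Type) extends Inhabited ι where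
  /-- colours -/
  C : Type
  /-- the colouring -/
  col : ι × ℕ → C
  /-- first markers -/
  ma : ℕ → ι × ℕ
  /-- second markers -/
  mb : ℕ → ι × ℕ
  ma_mono : StrictMono (fun i => (ma i).2)
  mb_mono : StrictMono (fun i => (mb i).2)
  col_ne : ∀ i j, col (ma i) ≠ col (mb j)

section sys
variable {ι ι' : Type} [Sys ι] [Sys ι'] {L L' : Type} [LinearOrder L] [LinearOrder L']

/-- colour of a letter -/
def lcol (c : ι × ℕ × Bool) : Sys.C ι := Sys.col (c.1, c.2.1)

/-- single-coloured elements -/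
def Mono (g : wordGroup ι) : Prop :=
  ∃ (f : ℚ → ι × ℕ × Bool) (A : Set ℚ), LF f A ∧ el f A = g ∧ ∃ c, ∀ i ∈ A, lcol (f i) = c

lemma mono_el {f : L → ι × ℕ × Bool} {A : Set L} (h : LF f A) (c : Sys.C ι)
    (hc : ∀ i ∈ A, lcol (f i) = c) : Mono (el f A) := by
  obtain ⟨e, f', he, hf⟩ := exists_rat f A h
  refine ⟨f', e '' A, h.image (fun i hi => by rw [hf i hi]), el_image h he hf, c, ?_⟩
  rintro _ ⟨i, hi, rfl⟩
  rw [hf i hi]; exact hc i hi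

lemma Mono.inv {g : wordGroup ι} (h : Mono g) : Mono g⁻¹ := by
  obtain ⟨f, A, hA, rfl, c, hc⟩ := h
  rw [← el_dual hA]
  exact mono_el hA.dual c (fun i hi => hc _ hi)

lemma Mono.red {g : wordGroup ι} (h : Mono g) :
    ∃ (f : ℚ → ι × ℕ × Bool) (A : Set ℚ), Red f A ∧ el f A = g ∧ ∃ c, ∀ i ∈ A, lcol (f i) = c := by
  obtain ⟨f, A, hA, rfl, c, hc⟩ := h
  obtain ⟨B, hB, h1, h2⟩ := exists_red hA
  exact ⟨f, B, h1, h2, c, fun i hi => hc i (hB hi)⟩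

lemma Mono.pre {g x : wordGroup ι} (h : Mono g) (hx : Pre x g) : Mono x ∧ Mono (x⁻¹ * g) := by
  obtain ⟨f, A, hA, rfl, c, hc⟩ := h.red
  obtain ⟨D, hD, rfl⟩ := hx.rep hA.1 rfl
  refine ⟨mono_el (hA.inter hD.ordConnected).1 c (fun i hi => hc i hi.1), ?_⟩
  rw [el_split hA.1 hD, inv_mul_cancel_left]
  exact mono_el (hA.inter hD.compl.ordConnected).1 c (fun i hi => hc i hi.1)

lemma mono_one : Mono (1 : wordGroup ι) := by
  have := mono_el (LF_empty (fun _ : ℚ => ((default : ι), 0, true))) (Sys.col (default, 0))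
    (by simp)
  rwa [el_empty] at this

lemma mono_of_trivial {y : wordGroup ι} (h : ∀ x, Pre x y → x = 1 ∨ x = y) : Mono y := by
  obtain ⟨f, A, hA, rfl⟩ := exists_redrep y
  by_cases hne : A = ∅
  · rw [hne, el_empty]; exact mono_one
  obtain ⟨i, hi⟩ := nonempty_iff_ne_empty.2 hne
  have h1 : A ∩ Iic i = A ∩ univ := by
    rcases h _ (pre_of_red hA (isLowerSet_Iic i)) with h1 | h1
    · have := hA.2 _ ordConnected_Iic h1
      have h2 : i ∈ A ∩ Iic i := ⟨hi, mem_Iic.2 le_rfl⟩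
      rw [this] at h2; exact absurd h2 (by simp)
    · exact hA.inj (isLowerSet_Iic i) isLowerSet_univ (by rw [h1, inter_univ])
  have h2 : A ∩ Iio i = ∅ := by
    rcases h _ (pre_of_red hA (isLowerSet_Iio i)) with h1 | h1
    · exact hA.2 _ ordConnected_Iio h1
    · have := hA.inj (isLowerSet_Iio i) isLowerSet_univ (by rw [h1, inter_univ])
      have h2 : i ∈ A ∩ univ := ⟨hi, trivial⟩
      rw [← this] at h2; exact absurd h2.2 (by simp)
  refine mono_el hA.1 (lcol (f i)) ?_
  intro j hj
  have h3 : j ∈ A ∩ univ := ⟨hj, trivial⟩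
  rw [← h1] at h3
  rcases lt_or_eq_of_le (mem_Iic.1 h3.2) with h4 | h4
  · have : j ∈ A ∩ Iio i := ⟨hj, h4⟩
    rw [h2] at this; exact absurd this (by simp)
  · rw [h4]

/-- normal closure of the single-coloured elements -/
def NN (ι : Type) [Sys ι] : Subgroup (wordGroup ι) := Subgroup.normalClosure {g | Mono g}

instance : (NN ι).Normal := Subgroup.normalClosure_normal

lemma mono_mem_NN {g : wordGroup ι} (h : Mono g) : g ∈ NN ι := Subgroup.subset_normalClosure h

/-- the quotient -/
abbrev QQ (ι : Type) [Sys ι] : Type := wordGroup ι ⧸ NN ι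

/-- first projection -/
def dm (Γ : Subgroup (wordGroup ι × wordGroup ι')) : Subgroup (wordGroup ι) :=
  Γ.map (MonoidHom.fst _ _)

lemma mem_dm {Γ : Subgroup (wordGroup ι × wordGroup ι')} {g : wordGroup ι} :
    g ∈ dm Γ ↔ ∃ s, (g, s) ∈ Γ := by
  simp [dm, Subgroup.mem_map]

/-- swapped correspondence -/
def sw (Γ : Subgroup (wordGroup ι × wordGroup ι')) : Subgroup (wordGroup ι' × wordGroup ι) :=
  Γ.comap (MulEquiv.prodComm : wordGroup ι' × wordGroup ι ≃* wordGroup ι × wordGroup ι').toMonoidHom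

@[simp] lemma mem_sw {Γ : Subgroup (wordGroup ι × wordGroup ι')} {a : wordGroup ι'}
    {b : wordGroup ι} : (a, b) ∈ sw Γ ↔ (b, a) ∈ Γ := Iff.rfl

lemma sw_sw (Γ : Subgroup (wordGroup ι × wordGroup ι')) : sw (sw Γ) = Γ := rfl

/-- prefix-closed and well defined modulo `NN`. -/
structure Half (Γ : Subgroup (wordGroup ι × wordGroup ι')) : Prop where
  pre : ∀ g x, g ∈ dm Γ → Pre x g → x ∈ dm Γ
  wd : ∀ s, (1, s) ∈ Γ → s ∈ NN ι'

/-- generated by few prefixes -/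
def Small (κ : Cardinal.{0}) (S : Subgroup (wordGroup ι)) : Prop :=
  ∃ A : Set (wordGroup ι), #A ≤ κ ∧ S ≤ Subgroup.closure ({g | Mono g} ∪ {x | ∃ a ∈ A, Pre x a})

/-- stages of the construction -/
structure Stage (κ : Cardinal.{0}) (Γ : Subgroup (wordGroup ι × wordGroup ι')) : Prop where
  h1 : Half Γ
  h2 : Half (sw Γ)
  s1 : Small κ (dm Γ)
  s2 : Small κ (dm (sw Γ))
  m1 : ∀ m, Mono m → (m, 1) ∈ Γ
  m2 : ∀ m, Mono m → (1, m) ∈ Γ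

lemma Stage.swap {κ : Cardinal.{0}} {Γ : Subgroup (wordGroup ι × wordGroup ι')}
    (h : Stage κ Γ) : Stage κ (sw Γ) := ⟨h.h2, h.h1, h.s2, h.s1, h.m2, h.m1⟩

/-- induced relation to the quotient. -/
def ph (Γ : Subgroup (wordGroup ι × wordGroup ι')) (g : wordGroup ι) (k : QQ ι') : Prop :=
  ∃ s, (g, s) ∈ Γ ∧ (s : QQ ι') = k

section ph
variable {Γ : Subgroup (wordGroup ι × wordGroup ι')}

lemma ph_mul {g h : wordGroup ι} {k l : QQ ι'} (h1 : ph Γ g k) (h2 : ph Γ h l) :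
    ph Γ (g * h) (k * l) := by
  obtain ⟨s, hs, rfl⟩ := h1
  obtain ⟨t, ht, rfl⟩ := h2
  exact ⟨s * t, Γ.mul_mem hs ht, rfl⟩

lemma ph_inv {g : wordGroup ι} {k : QQ ι'} (h1 : ph Γ g k) : ph Γ g⁻¹ k⁻¹ := by
  obtain ⟨s, hs, rfl⟩ := h1
  exact ⟨s⁻¹, Γ.inv_mem hs, rfl⟩

lemma ph_one : ph Γ 1 1 := ⟨1, Γ.one_mem, rfl⟩

lemma ph_dm {g : wordGroup ι} {k : QQ ι'} (h1 : ph Γ g k) : g ∈ dm Γ := by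
  obtain ⟨s, hs, rfl⟩ := h1
  exact mem_dm.2 ⟨s, hs⟩

lemma dm_ph {g : wordGroup ι} (h1 : g ∈ dm Γ) : ∃ k, ph Γ g k := by
  obtain ⟨s, hs⟩ := mem_dm.1 h1
  exact ⟨_, s, hs, rfl⟩

lemma Half.func (H : Half Γ) {g : wordGroup ι} {k l : QQ ι'} (h1 : ph Γ g k) (h2 : ph Γ g l) :
    k = l := by
  obtain ⟨s, hs, rfl⟩ := h1
  obtain ⟨t, ht, rfl⟩ := h2
  apply QuotientGroup.eq.2
  apply H.wd
  have := Γ.mul_mem (Γ.inv_mem hs) ht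
  simpa using this

lemma Half.splitph (H : Half Γ) {g x : wordGroup ι} {k : QQ ι'} (h1 : ph Γ g k) (hx : Pre x g) :
    ∃ k1 k2, ph Γ x k1 ∧ ph Γ (x⁻¹ * g) k2 ∧ k = k1 * k2 := by
  obtain ⟨k1, hk1⟩ := dm_ph (H.pre _ _ (ph_dm h1) hx)
  refine ⟨k1, k1⁻¹ * k, hk1, ph_mul (ph_inv hk1) h1, by group⟩

/-- criterion for an extension to be well defined. -/
lemma half_ext {Γ₁ : Subgroup (wordGroup ι × wordGroup ι')} {Lr : wordGroup ι → QQ ι' → Prop}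
    (H : IsLoc Lr) (h1 : ∀ g s, (g, s) ∈ Γ₁ → Val Lr g (s : QQ ι'))
    (h2 : ∀ g k, Lr g k → g ∈ dm Γ₁) : Half Γ₁ := by
  have key : ∀ g k, Val Lr g k → g ∈ dm Γ₁ := by
    intro g k h
    induction h with
    | one => exact (dm Γ₁).one_mem
    | cons hb hh hp ih => exact (dm Γ₁).mul_mem (h2 _ _ hb) ih
  constructor
  · intro g x hg hx
    obtain ⟨s, hs⟩ := mem_dm.1 hg
    obtain ⟨k1, k2, a1, a2, a3⟩ := H.vsplit (h1 _ _ hs) _ hx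
    exact key _ _ a1
  · intro s hs
    have := H.vfunc Val.one _ (h1 _ _ hs)
    exact (QuotientGroup.eq_one_iff s).1 this

/-- generated version -/
lemma half_ext' {T : Set (wordGroup ι × wordGroup ι')} {Lr : wordGroup ι → QQ ι' → Prop}
    (H : IsLoc Lr) (h0 : ∀ g k, ph Γ g k → Lr g k)
    (h1 : ∀ g s, (g, s) ∈ T → Val Lr g (s : QQ ι'))
    (h2 : ∀ g k, Lr g k → g ∈ dm (Γ ⊔ Subgroup.closure T)) : Half (Γ ⊔ Subgroup.closure T) := by
  refine half_ext H ?_ h2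
  have : Γ ⊔ Subgroup.closure T ≤ H.sub.comap
      (MonoidHom.prodMap (MonoidHom.id _) (QuotientGroup.mk' (NN ι'))) := by
    rw [sup_le_iff, Subgroup.closure_le]
    constructor
    · rintro ⟨g, s⟩ hs
      exact Val.single (h0 _ _ ⟨s, hs, rfl⟩)
    · rintro ⟨g, s⟩ hs
      exact h1 _ _ hs
  intro g s hs
  exact this hs

end ph

/-- Symmetrised relations. -/
def symr {K : Type} [Group K] (L0 : wordGroup ι → K → Prop) (g : wordGroup ι) (k : K) : Prop :=
  L0 g k ∨ L0 g⁻¹ k⁻¹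

lemma isLoc_symr {K : Type} [Group K] {L0 : wordGroup ι → K → Prop}
    (f1 : ∀ g k k', L0 g k → L0 g k' → k = k')
    (f2 : ∀ g k k', L0 g k → L0 g⁻¹ k' → k⁻¹ = k')
    (sp : ∀ g k x, L0 g k → Pre x g →
      ∃ k1 k2, symr L0 x k1 ∧ symr L0 (x⁻¹ * g) k2 ∧ k = k1 * k2) : IsLoc (symr L0) := by
  have inv : ∀ g k, symr L0 g k → symr L0 g⁻¹ k⁻¹ := by
    intro g k h
    rcases h with h | h
    · right; simpa using h
    · left; exact h
  refine ⟨?_, inv, ?_⟩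
  · rintro g k k' (h | h) (h' | h')
    · exact f1 _ _ _ h h'
    · exact inv_injective (f2 _ _ _ h h')
    · exact inv_injective (f2 _ _ _ h' h).symm
    · exact inv_injective (f1 _ _ _ h h')
  · rintro g k x (h | h) hx
    · exact sp g k x h hx
    · obtain ⟨k1, k2, a1, a2, a3⟩ := sp _ _ _ h hx.inv
      refine ⟨k2⁻¹, k1⁻¹, ?_, ?_, ?_⟩
      · have := inv _ _ a2
        simpa using this
      · have := inv _ _ a1
        simpa using this
      · rw [← inv_inv k, a3]; group

/-- `T` is a limit of elements of `S`, without being in `S`. -/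
def OmegaType (S : Subgroup (wordGroup ι)) (T : wordGroup ι) : Prop :=
  T ∉ S ∧ ∀ x, Pre x T → x ≠ T → x ∈ S

lemma sw_sup_closure (Γ : Subgroup (wordGroup ι × wordGroup ι'))
    (T : Set (wordGroup ι × wordGroup ι')) :
    sw (Γ ⊔ Subgroup.closure T) = sw Γ ⊔ Subgroup.closure (Prod.swap ⁻¹' T) := by
  have key : ∀ {ι ι' : Type} [Sys ι] [Sys ι'] (Γ : Subgroup (wordGroup ι × wordGroup ι'))
    (T : Set (wordGroup ι × wordGroup ι')),
      sw Γ ⊔ Subgroup.closure (Prod.swap ⁻¹' T) ≤ sw (Γ ⊔ Subgroup.closure T) := by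
    intro ι ι' _ _ Γ T
    rw [sup_le_iff, Subgroup.closure_le]
    constructor
    · rintro ⟨a, b⟩ h
      exact (le_sup_left : Γ ≤ Γ ⊔ _) h
    · rintro ⟨a, b⟩ h
      exact (le_sup_right : Subgroup.closure T ≤ Γ ⊔ _) (Subgroup.subset_closure h)
  refine le_antisymm ?_ (key Γ T)
  have h := key (sw Γ) (Prod.swap ⁻¹' T)
  rintro ⟨a, b⟩ hab
  have : (b, a) ∈ sw (sw Γ) ⊔ Subgroup.closure (Prod.swap ⁻¹' (Prod.swap ⁻¹' T)) := hab
  exact h this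

lemma half_omega {Γ : Subgroup (wordGroup ι × wordGroup ι')} (H : Half Γ)
    (hm : ∀ m, Mono m → (m, 1) ∈ Γ) {T : wordGroup ι}
    (hT : OmegaType (dm Γ) T) (T' : wordGroup ι') :
    Half (Γ ⊔ Subgroup.closure {(T, T')}) := by
  set L0 : wordGroup ι → QQ ι' → Prop := fun g k => ph Γ g k ∨
    ∃ z l, Pre z T ∧ z ≠ T ∧ ph Γ z l ∧ g = z⁻¹ * T ∧ k = l⁻¹ * (T' : QQ ι') with hL0
  have notin : ∀ z l, ph Γ z l → z⁻¹ * T ∉ dm Γ := by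
    intro z l h1 h2
    apply hT.1
    have := (dm Γ).mul_mem (ph_dm h1) h2
    simpa using this
  have proper : ∀ z l, Pre z T → ph Γ z l → ∀ x, Pre x (z⁻¹ * T) → x ≠ z⁻¹ * T → x ∈ dm Γ := by
    intro z l hz hl x hx hne
    have h1 := (pre_mul hz hx).1
    have h2 := hT.2 _ h1 (fun e => hne (by rw [← e]; simp))
    have := (dm Γ).mul_mem ((dm Γ).inv_mem (ph_dm hl)) h2
    simpa using this
  have HL : IsLoc (symr L0) := by
    apply isLoc_symr
    · rintro g k k' (h | ⟨z, l, hz, hne, hl, rfl, rfl⟩) (h' | ⟨z', l', hz', hne', hl', e, rfl⟩)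
      · exact H.func h h'
      · rw [e] at h; exact absurd (ph_dm h) (notin _ _ hl')
      · exact absurd (ph_dm h') (notin _ _ hl)
      · rw [mul_left_inj, inv_inj] at e
        subst e
        rw [H.func hl hl']
    · rintro g k k' (h | ⟨z, l, hz, hne, hl, rfl, rfl⟩) (h' | ⟨z', l', hz', hne', hl', e, rfl⟩)
      · exact H.func (ph_inv h) h'
      · have := ph_dm (ph_inv h)
        rw [e] at this; exact absurd this (notin _ _ hl')
      · have := ph_dm (ph_inv h')
        rw [inv_inv] at this; exact absurd this (notin _ _ hl)
      · exfalso
        set y := z⁻¹ * T with hy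
        have hyS : y ∉ dm Γ := notin _ _ hl
        have : ∀ x, Pre x y → x = 1 ∨ x = y := by
          intro x hx
          by_contra hc
          push Not at hc
          have h1 := proper _ _ hz hl x hx hc.2
          have h2 := hx.inv
          rw [e] at h2
          have h3 := proper _ _ hz' hl' _ h2 (by
            rw [← e]; intro h; exact hc.1 (by simpa using h))
          rw [← e] at h3
          apply hyS
          have := (dm Γ).mul_mem h1 ((dm Γ).inv_mem h3)
          simpa using this
        exact hyS (mem_dm.2 ⟨1, hm _ (mono_of_trivial this)⟩)
    · rintro g k x (h | ⟨z, l, hz, hne, hl, rfl, rfl⟩) hx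
      · obtain ⟨k1, k2, a1, a2, a3⟩ := H.splitph h hx
        exact ⟨k1, k2, Or.inl (Or.inl a1), Or.inl (Or.inl a2), a3⟩
      · by_cases hxe : x = z⁻¹ * T
        · subst hxe
          refine ⟨l⁻¹ * T', 1, Or.inl (Or.inr ⟨z, l, hz, hne, hl, rfl, rfl⟩), ?_, by simp⟩
          rw [inv_mul_cancel]; exact Or.inl (Or.inl ph_one)
        · obtain ⟨k1, hk1⟩ := dm_ph (proper z l hz hl x hx hxe)
          refine ⟨k1, (l * k1)⁻¹ * T', Or.inl (Or.inl hk1), ?_, by group⟩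
          refine Or.inl (Or.inr ⟨z * x, l * k1, (pre_mul hz hx).1, ?_, ph_mul hl hk1,
            by group, rfl⟩)
          intro e; apply hxe; rw [← e]; simp
  have hle : Γ ≤ Γ ⊔ Subgroup.closure {(T, T')} := le_sup_left
  have hTm : (T, T') ∈ Γ ⊔ Subgroup.closure {(T, T')} :=
    (le_sup_right : _ ≤ Γ ⊔ Subgroup.closure {(T, T')}) (Subgroup.subset_closure rfl)
  have hL : ∀ g k, L0 g k → g ∈ dm (Γ ⊔ Subgroup.closure {(T, T')}) := by
    rintro g k (h | ⟨z, l, hz, hne, hl, rfl, rfl⟩)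
    · obtain ⟨s, hs⟩ := mem_dm.1 (ph_dm h)
      exact mem_dm.2 ⟨s, hle hs⟩
    · obtain ⟨s, hs⟩ := mem_dm.1 (ph_dm hl)
      refine (dm _).mul_mem ((dm _).inv_mem (mem_dm.2 ⟨s, hle hs⟩)) (mem_dm.2 ⟨T', hTm⟩)
  refine half_ext' HL (fun g k h => Or.inl (Or.inl h)) ?_ ?_
  · rintro g s h
    simp only [mem_singleton_iff, Prod.mk.injEq] at h
    obtain ⟨rfl, rfl⟩ := h
    apply Val.single
    refine Or.inl (Or.inr ⟨1, 1, pre_one _, ?_, ph_one, by simp, by simp⟩)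
    intro e; exact hT.1 (by rw [← e]; exact (dm Γ).one_mem)
  · rintro g k (h | h)
    · exact hL _ _ h
    · have := (dm _).inv_mem (hL _ _ h)
      simpa using this

/-- subdivision of elements of a generated subgroup -/
lemma closure_val {S : Set (wordGroup ι)} (hi : ∀ g ∈ S, g⁻¹ ∈ S)
    (hp : ∀ g ∈ S, ∀ x, Pre x g → x ∈ S ∧ x⁻¹ * g ∈ S) {g : wordGroup ι}
    (hg : g ∈ Subgroup.closure S) : Val (fun g (_ : Multiplicative Unit) => g ∈ S) g 1 := by
  have H : IsLoc (fun g (_ : Multiplicative Unit) => g ∈ S) := by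
    refine ⟨fun _ _ _ _ _ => rfl, fun g _ h => hi g h, ?_⟩
    intro g k x hg hx
    exact ⟨1, 1, (hp g hg x hx).1, (hp g hg x hx).2, rfl⟩
  have : Subgroup.closure S ≤ H.sub.comap (MonoidHom.inl _ _) := by
    rw [Subgroup.closure_le]
    intro x hx
    exact Val.single hx
  exact this hg

lemma closure_pre {S : Set (wordGroup ι)} (hi : ∀ g ∈ S, g⁻¹ ∈ S)
    (hp : ∀ g ∈ S, ∀ x, Pre x g → x ∈ S ∧ x⁻¹ * g ∈ S) {g x : wordGroup ι}
    (hg : g ∈ Subgroup.closure S) (hx : Pre x g) : x ∈ Subgroup.closure S := by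
  have H : IsLoc (fun g (_ : Multiplicative Unit) => g ∈ S) := by
    refine ⟨fun _ _ _ _ _ => rfl, fun g _ h => hi g h, ?_⟩
    intro g k x hg hx
    exact ⟨1, 1, (hp g hg x hx).1, (hp g hg x hx).2, rfl⟩
  obtain ⟨k1, k2, a1, a2, a3⟩ := H.vsplit (closure_val hi hp hg) x hx
  clear a2 a3 hx
  induction a1 with
  | one => exact one_mem _
  | cons hb hh hp' ih => exact mul_mem (Subgroup.subset_closure hb) ih

end sys

end GW

end

set_option linter.all false

noncomputable section

namespace GW

open Set GriffithsWords Cardinal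

section uniq
variable {ι : Type} [Inhabited ι] {L L' : Type} [LinearOrder L] [LinearOrder L']

/-- the element given by one letter -/
def lt1 (c : ι × ℕ × Bool) : wordGroup ι := el (fun _ : Unit => c) univ

lemma LF_fin {f : L → ι × ℕ × Bool} {A : Set L} (h : A.Finite) : LF f A :=
  fun N => h.subset (fun _ hi => hi.1)

lemma gen_inj {c d : ι × ℕ × Bool} (h : gen c = gen d) : c = d := by
  classical
  have := congrArg FreeGroup.toWord h
  simp only [gen, FreeGroup.toWord_mk] at this
  simp [FreeGroup.reduce] at this
  rcases c with ⟨a, b, c⟩; rcases d with ⟨a', b', c'⟩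
  simp at this ⊢; tauto

lemma lt1_apply (c : ι × ℕ × Bool) : (lt1 c).1 c.2.1 = gen c := by
  rw [lt1, coe_el (LF_fin finite_univ), ev]
  have : lev (fun _ : Unit => c) univ c.2.1 = {()} := by
    ext i; simp [lev]
  rw [this, oprod_singleton]

lemma lt1_apply' (c : ι × ℕ × Bool) (N : ℕ) : (lt1 c).1 N = if c.2.1 ≤ N then gen c else 1 := by
  rw [lt1, coe_el (LF_fin finite_univ), ev]
  split_ifs with h
  · have : lev (fun _ : Unit => c) univ N = {()} := by
      ext i; simp [lev, h]
    rw [this, oprod_singleton]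
  · have : lev (fun _ : Unit => c) univ N = ∅ := by
      ext i; simp [lev]; omega
    rw [this, oprod_empty]

lemma gen_ne_one (c : ι × ℕ × Bool) : gen c ≠ 1 := mk_single_ne_one _

lemma lt1_ne_one (c : ι × ℕ × Bool) : lt1 c ≠ 1 := by
  intro h
  have := lt1_apply c
  rw [h] at this
  exact gen_ne_one c this.symm

lemma lt1_inj {c d : ι × ℕ × Bool} (h : lt1 c = lt1 d) : c = d := by
  have h1 := lt1_apply c
  have h2 := lt1_apply d
  rw [h, lt1_apply'] at h1
  split_ifs at h1 with h3
  · exact (gen_inj h1).symm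
  · exact absurd h1.symm (gen_ne_one c)

lemma el_single (f : L → ι × ℕ × Bool) (i : L) : el f {i} = lt1 (f i) := by
  have := el_image (f := fun _ : Unit => f i) (f' := f) (A := univ) (LF_fin finite_univ)
    (e := fun _ => i) (by intro x _ y _ h; exact absurd h (by simp)) (by simp)
  rw [← lt1] at this
  rw [← this]; congr 1; ext; simp [eq_comm]

lemma lt1_linv (c : ι × ℕ × Bool) : lt1 (linv c) = (lt1 c)⁻¹ := by
  rw [lt1, lt1]
  have := el_image_anti (f := fun _ : Unit => c) (f' := fun _ : Unit => linv c) (A := univ)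
    (LF_fin finite_univ) (e := id) (by intro x _ y _ h; exact absurd h (by simp)) (by simp)
  simpa using this

lemma pre_lt1 {c : ι × ℕ × Bool} {x : wordGroup ι} (h : Pre x (lt1 c)) : x = 1 ∨ x = lt1 c := by
  obtain ⟨D, hD, rfl⟩ := h.rep (LF_fin finite_univ) rfl
  rcases Set.eq_empty_or_nonempty D with h1 | ⟨u, hu⟩
  · left; rw [h1]; simp
  · right
    have : D = Set.univ := by ext v; simp [Subsingleton.elim v u, hu]
    rw [this, inter_univ, lt1]

lemma red_single {f : L → ι × ℕ × Bool} {A : Set L} (hA : Red f A) {c : ι × ℕ × Bool}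
    (h : el f A = lt1 c) : ∃ i, A = {i} ∧ f i = c := by
  have hne : A ≠ ∅ := by
    rintro rfl
    rw [el_empty] at h; exact lt1_ne_one c h.symm
  obtain ⟨i, hi⟩ := nonempty_iff_ne_empty.2 hne
  have h1 : A ∩ Iic i = A ∩ univ := by
    rcases pre_lt1 (h ▸ pre_of_red hA (isLowerSet_Iic i)) with h1 | h1
    · have := hA.2 _ ordConnected_Iic h1
      have h2 : i ∈ A ∩ Iic i := ⟨hi, mem_Iic.2 le_rfl⟩
      rw [this] at h2; exact absurd h2 (by simp)
    · exact hA.inj (isLowerSet_Iic i) isLowerSet_univ (by rw [h1, inter_univ, h])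
  have h2 : A ∩ Iio i = ∅ := by
    rcases pre_lt1 (h ▸ pre_of_red hA (isLowerSet_Iio i)) with h1 | h1
    · exact hA.2 _ ordConnected_Iio h1
    · have := hA.inj (isLowerSet_Iio i) isLowerSet_univ (by rw [h1, inter_univ, h])
      have h2 : i ∈ A ∩ univ := ⟨hi, trivial⟩
      rw [← this] at h2; exact absurd h2.2 (by simp)
  have h3 : A = {i} := by
    ext j; constructor
    · intro hj
      have h3 : j ∈ A ∩ univ := ⟨hj, trivial⟩
      rw [← h1] at h3
      rcases lt_or_eq_of_le (mem_Iic.1 h3.2) with h4 | h4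
      · have : j ∈ A ∩ Iio i := ⟨hj, h4⟩
        rw [h2] at this; exact absurd this (by simp)
      · exact h4
    · rintro rfl; exact hi
  refine ⟨i, h3, ?_⟩
  rw [h3, el_single] at h
  exact lt1_inj h

lemma Red.pre_low {f : L → ι × ℕ × Bool} {A : Set L} (h : Red f A) {D D' : Set L}
    (hD : IsLowerSet D) (hD' : IsLowerSet D') (hs : D ⊆ D') :
    Pre (el f (A ∩ D)) (el f (A ∩ D')) := by
  have := pre_of_red (h.inter hD'.ordConnected) hD
  rwa [inter_assoc, inter_eq_self_of_subset_right hs] at this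

lemma Iic_split (f : L → ι × ℕ × Bool) {A : Set L} (hA : LF f A) {i : L} (hi : i ∈ A) :
    el f (A ∩ Iic i) = el f (A ∩ Iio i) * lt1 (f i) := by
  rw [← el_single, ← el_union]
  · congr 1
    ext j; simp only [mem_inter_iff, mem_Iic, mem_union, mem_Iio, mem_singleton_iff]
    constructor
    · rintro ⟨h1, h2⟩
      rcases lt_or_eq_of_le h2 with h | h
      · exact Or.inl ⟨h1, h⟩
      · exact Or.inr h
    · rintro (h | rfl)
      · exact ⟨h.1, h.2.le⟩
      · exact ⟨hi, le_rfl⟩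
  · exact hA.mono inter_subset_left
  · exact LF_fin (finite_singleton _)
  · rintro x hx y rfl; exact hx.2

lemma unique_aux {f : L → ι × ℕ × Bool} {A : Set L} (hA : Red f A)
    {f' : L' → ι × ℕ × Bool} {A' : Set L'} (hA' : Red f' A') (hg : el f A = el f' A')
    {i : L} (hi : i ∈ A) : ∃ i' ∈ A', el f' (A' ∩ Iio i') = el f (A ∩ Iio i) ∧
      el f' (A' ∩ Iic i') = el f (A ∩ Iic i) ∧ f' i' = f i := by
  have p1 := pre_of_red hA (isLowerSet_Iio i)
  have p2 := pre_of_red hA (isLowerSet_Iic i)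
  have p3 := hA.pre_low (isLowerSet_Iio i) (isLowerSet_Iic i) (fun _ h => le_of_lt h)
  rw [hg] at p1 p2
  obtain ⟨D, hD, e1⟩ := p1.rep hA'.1 rfl
  obtain ⟨D', hD', e2⟩ := p2.rep hA'.1 rfl
  have hs : D ⊆ D' := by
    rcases hD.total hD' with h | h
    · exact h
    · have := hA'.pre_low hD' hD h
      rw [e1, e2] at this
      have := hA.inj (isLowerSet_Iio i) (isLowerSet_Iic i) (p3.antisymm this)
      have h2 : i ∈ A ∩ Iic i := ⟨hi, mem_Iic.2 le_rfl⟩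
      rw [← this] at h2
      exact absurd h2.2 (by simp)
  have hr := hA'.inter (hD'.ordConnected.inter hD.compl.ordConnected)
  have e3 := el_split (hA'.1.mono (inter_subset_left (t := D'))) hD
  rw [inter_assoc, inter_assoc, inter_eq_self_of_subset_right hs, e1, e2, Iic_split f hA.1 hi,
    mul_right_inj] at e3
  obtain ⟨i', h1, h2⟩ := red_single hr e3.symm
  have m : i' ∈ A' ∩ (D' ∩ Dᶜ) := by rw [h1]; rfl
  have hh : A' ∩ Iio i' = A' ∩ D := by
    ext j; constructor
    · rintro ⟨a, b⟩
      refine ⟨a, ?_⟩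
      by_contra hc
      have : j ∈ A' ∩ (D' ∩ Dᶜ) := ⟨a, hD' (le_of_lt b) m.2.1, hc⟩
      rw [h1] at this
      exact absurd b (by rw [mem_singleton_iff.1 this]; simp)
    · rintro ⟨a, b⟩
      refine ⟨a, ?_⟩
      by_contra hc
      exact m.2.2 (hD (not_lt.1 hc) b)
  refine ⟨i', m.1, ?_, ?_, h2⟩
  · rw [hh, e1]
  · rw [Iic_split f' hA'.1 m.1, Iic_split f hA.1 hi, hh, e1, h2]

lemma Red.Iic_inj {f : L → ι × ℕ × Bool} {A : Set L} (hA : Red f A) {i j : L} (hi : i ∈ A)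
    (hj : j ∈ A) (h : el f (A ∩ Iic i) = el f (A ∩ Iic j)) : i = j := by
  have := hA.inj (isLowerSet_Iic i) (isLowerSet_Iic j) h
  have h1 : i ∈ A ∩ Iic j := by rw [← this]; exact ⟨hi, mem_Iic.2 le_rfl⟩
  have h2 : j ∈ A ∩ Iic i := by rw [this]; exact ⟨hj, mem_Iic.2 le_rfl⟩
  exact le_antisymm h1.2 h2.2

/-- Uniqueness of reduced words. -/
lemma red_unique [Nonempty L'] {f : L → ι × ℕ × Bool} {A : Set L} (hA : Red f A)
    {f' : L' → ι × ℕ × Bool} {A' : Set L'} (hA' : Red f' A') (hg : el f A = el f' A') :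
    ∃ e : L → L', StrictMonoOn e A ∧ e '' A = A' ∧ ∀ i ∈ A, f' (e i) = f i := by
  have H : ∀ i, ∃ i', i ∈ A → (i' ∈ A' ∧ el f' (A' ∩ Iio i') = el f (A ∩ Iio i) ∧
      el f' (A' ∩ Iic i') = el f (A ∩ Iic i) ∧ f' i' = f i) := by
    intro i
    by_cases hi : i ∈ A
    · obtain ⟨i', h1, h2⟩ := unique_aux hA hA' hg hi
      exact ⟨i', fun _ => ⟨h1, h2⟩⟩
    · exact ⟨Classical.arbitrary _, fun h => absurd h hi⟩
  choose e he using H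
  refine ⟨e, ?_, ?_, fun i hi => (he i hi).2.2.2⟩
  · intro i hi j hj hij
    by_contra hc
    push Not at hc
    have p1 := hA.pre_low (isLowerSet_Iic i) (isLowerSet_Iio j) (fun x hx => lt_of_le_of_lt hx hij)
    have p2 := hA'.pre_low (isLowerSet_Iio (e j)) (isLowerSet_Iic (e i))
      (fun x hx => (lt_of_lt_of_le hx hc).le)
    rw [(he i hi).2.2.1, (he j hj).2.1] at p2
    have := p1.antisymm p2
    rw [← (he i hi).2.2.1, ← (he j hj).2.1] at this
    have := hA'.inj (isLowerSet_Iic _) (isLowerSet_Iio _) this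
    have h1 : e i ∈ A' ∩ Iic (e i) := ⟨(he i hi).1, mem_Iic.2 le_rfl⟩
    rw [this] at h1
    exact absurd h1.2 (by simpa using hc)
  · ext i'; constructor
    · rintro ⟨i, hi, rfl⟩; exact (he i hi).1
    · intro hi'
      obtain ⟨i, hi, h1, h2, h3⟩ := unique_aux hA' hA hg.symm hi'
      refine ⟨i, hi, ?_⟩
      apply hA'.Iic_inj (he i hi).1 hi'
      rw [(he i hi).2.2.1, h2]

end uniq

section blocks
variable {ι : Type} [Inhabited ι] {L L' M M' : Type} [LinearOrder L] [LinearOrder L']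
  [LinearOrder M] [LinearOrder M']

lemma ev_blocks {f : L → ι × ℕ × Bool} {A : Set L} (hA : LF f A) {b : L → M}
    (hb : MonotoneOn b A) {N : ℕ} {T : Set M} (hT : T.Finite) (h : b '' (lev f A N) ⊆ T) :
    ev f A N = oprod T (fun l => ev f (A ∩ b ⁻¹' {l}) N) := by
  rw [ev, oprod_fiber (hA N) hT (b := b) (fun x hx y hy => hb hx.1 hy.1)
    (fun x hx => h ⟨x, hx, rfl⟩)]
  apply oprod_congr
  intro l _
  rw [ev, lev_inter]

/-- isomorphic block words have the same value -/
lemma el_blocks_iso {f : L → ι × ℕ × Bool} {A : Set L} (hA : LF f A) {b : L → M}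
    (hb : MonotoneOn b A) {f' : L' → ι × ℕ × Bool} {A' : Set L'} (hA' : LF f' A') {b' : L' → M'}
    (hb' : MonotoneOn b' A') {e : M → M'} (he : StrictMonoOn e (b '' A))
    (hi : e '' (b '' A) = b' '' A')
    (hv : ∀ l ∈ b '' A, el f' (A' ∩ b' ⁻¹' {e l}) = el f (A ∩ b ⁻¹' {l})) :
    el f A = el f' A' := by
  rw [el_eq_iff hA hA']
  funext N
  set T1 := b '' (lev f A N)
  set T2 := b' '' (lev f' A' N)
  set T : Set M := T1 ∪ {l ∈ b '' A | e l ∈ T2} with hT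
  have hTA : T ⊆ b '' A := by
    rintro l (⟨i, hi, rfl⟩ | h)
    · exact ⟨i, hi.1, rfl⟩
    · exact h.1
  have hTf : T.Finite := by
    refine ((hA N).image b).union ?_
    have : {l ∈ b '' A | e l ∈ T2} ⊆ b '' A := fun l h => h.1
    refine Set.Finite.of_finite_image (f := e) (((hA' N).image b').subset ?_)
      (he.injOn.mono this)
    rintro _ ⟨l, hl, rfl⟩; exact hl.2
  rw [ev_blocks hA hb hTf subset_union_left]
  have h2 : T2 ⊆ e '' T := by
    rintro _ ⟨i, hi', rfl⟩
    have : b' i ∈ e '' (b '' A) := by rw [hi]; exact ⟨i, hi'.1, rfl⟩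
    obtain ⟨l, hl, h⟩ := this
    exact ⟨l, Or.inr ⟨hl, by rw [h]; exact ⟨i, hi', rfl⟩⟩, h⟩
  rw [ev_blocks hA' hb' (hTf.image e) h2, oprod_image hTf (he.mono hTA)]
  apply oprod_congr
  intro l hl
  have := hv l (hTA hl)
  rw [el_eq_iff (hA'.mono inter_subset_left) (hA.mono inter_subset_left)] at this
  exact (congrFun this N).symm

end blocks

end GW

end

set_option linter.all false

noncomputable section

namespace GW

open Set GriffithsWords

section fp

/-- a cancelling pair of special letters -/
def GoodL {α : Type} (Z : α → Prop) (l : List (α × Bool)) : Prop :=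
  ∃ l1 l2 m, ∃ c : α × Bool, l = l1 ++ c :: (m ++ (c.1, !c.2) :: l2) ∧ Z c.1 ∧
    (∀ d ∈ m, ¬ Z d.1) ∧ FreeGroup.mk m = 1

lemma mk_insert {α : Type} (a b : List (α × Bool)) (x : α) (t : Bool) :
    FreeGroup.mk (a ++ (x, t) :: (x, !t) :: b) = FreeGroup.mk (a ++ b) := by
  apply Quot.sound
  exact FreeGroup.Red.Step.not

lemma goodL_insert {α : Type} {Z : α → Prop} {a b : List (α × Bool)} {x : α} {t : Bool}
    (hx : ¬ Z x) (h : GoodL Z (a ++ b)) : GoodL Z (a ++ (x, t) :: (x, !t) :: b) := by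
  obtain ⟨l1, l2, m, c, e, hc, hm, h1⟩ := h
  rcases List.append_eq_append_iff.1 e with ⟨w, e1, e2⟩ | ⟨w, e1, e2⟩
  · -- l1 = a ++ w
    refine ⟨a ++ (x, t) :: (x, !t) :: w, l2, m, c, ?_, hc, hm, h1⟩
    rw [e2]; simp
  · -- a = l1 ++ w
    rcases w with _ | ⟨d, w⟩
    · simp only [List.nil_append] at e2
      refine ⟨l1 ++ (x, t) :: (x, !t) :: [], l2, m, c, ?_, hc, hm, h1⟩
      rw [e1, ← e2]; simp
    · simp only [List.cons_append, List.cons.injEq] at e2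
      obtain ⟨rfl, e2⟩ := e2
      rcases List.append_eq_append_iff.1 e2.symm with ⟨w', e3, e4⟩ | ⟨w', e3, e4⟩
      · -- m = w ++ w'
        subst e3
        refine ⟨l1, l2, w ++ (x, t) :: (x, !t) :: w', c, ?_, hc, ?_, ?_⟩
        · rw [e1, e4]; simp
        · intro d hd
          simp only [List.mem_append, List.mem_cons] at hd
          rcases hd with hd | rfl | rfl | hd
          · exact hm d (by simp [hd])
          · exact hx
          · exact hx
          · exact hm d (by simp [hd])
        · rw [mk_insert]; exact h1
      · -- w = m ++ w'
        rcases w' with _ | ⟨d', w'⟩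
        · simp only [List.nil_append, List.append_nil] at e4 e3
          refine ⟨l1, l2, m ++ (x, t) :: (x, !t) :: [], c, ?_, hc, ?_, ?_⟩
          · rw [e1, e3, ← e4]; simp
          · intro d hd
            simp only [List.mem_append, List.mem_cons] at hd
            rcases hd with hd | rfl | rfl | hd
            · exact hm d hd
            · exact hx
            · exact hx
            · simp at hd
          · rw [mk_insert]; simpa using h1
        · simp only [List.cons_append, List.cons.injEq] at e4
          obtain ⟨rfl, e4⟩ := e4
          refine ⟨l1, w' ++ (x, t) :: (x, !t) :: b, m, c, ?_, hc, hm, h1⟩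
          rw [e1, e3]; simp

lemma goodL_of {α : Type} (Z : α → Prop) {l : List (α × Bool)} (h : FreeGroup.mk l = 1)
    (hz : ∃ d ∈ l, Z d.1) : GoodL Z l := by
  have h' : FreeGroup.Red l [] := by
    rw [FreeGroup.one_eq_mk] at h
    obtain ⟨w, h1, h2⟩ := FreeGroup.Red.exact.1 h
    rwa [FreeGroup.Red.nil_iff.1 h2] at h1
  clear h
  revert hz
  refine Relation.ReflTransGen.head_induction_on
    (motive := fun l _ => (∃ d ∈ l, Z d.1) → GoodL Z l) h' (by simp) ?_
  rintro l l' hs _ ih ⟨d, hd, hz⟩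
  cases hs with
  | @not a b x t =>
    by_cases hx : Z x
    · exact ⟨a, b, [], (x, t), by simp, hx, by simp, by rw [FreeGroup.one_eq_mk]⟩
    · apply goodL_insert hx (ih ⟨d, ?_, hz⟩)
      simp only [List.mem_append, List.mem_cons] at hd ⊢
      rcases hd with h | rfl | rfl | h
      · exact Or.inl h
      · exact absurd hz hx
      · exact absurd hz hx
      · exact Or.inr h

variable {ι : Type} {L : Type} [LinearOrder L]

lemma fp_fin (Z : ι × ℕ → Prop) (f : L → ι × ℕ × Bool) {s : Set L} (hs : s.Finite)
    (h : oprod s (fun i => gen (f i)) = 1) (hz : ∃ i ∈ s, Z ((f i).1, (f i).2.1)) :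
    ∃ p ∈ s, ∃ q ∈ s, p < q ∧ Z ((f p).1, (f p).2.1) ∧ f q = linv (f p) ∧
      (∀ i ∈ s, p < i → i < q → ¬ Z ((f i).1, (f i).2.1)) ∧
      oprod (s ∩ Ioo p q) (fun i => gen (f i)) = 1 := by
  classical
  set l := hs.toFinset.sort (· ≤ ·) with hl
  have hmem : ∀ i, i ∈ l ↔ i ∈ s := by intro i; simp [hl]
  have hsort : l.Pairwise (· < ·) := by
    have := Finset.sortedLT_sort hs.toFinset
    exact this.pairwise
  rw [oprod_def _ hs, ← hl, ← Function.comp_def, ← List.map_map, prod_gen, List.map_map] at h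
  obtain ⟨l1, l2, m, c, e, hc, hm, h1⟩ := goodL_of Z h (by
    obtain ⟨i, hi, hzi⟩ := hz
    exact ⟨_, List.mem_map.2 ⟨i, (hmem i).2 hi, rfl⟩, hzi⟩)
  obtain ⟨k1, k2, e1, e2, e3⟩ := List.map_eq_append_iff.1 e
  obtain ⟨p, k3, e4, e5, e6⟩ := List.map_eq_cons_iff.1 e3
  obtain ⟨k4, k5, e7, e8, e9⟩ := List.map_eq_append_iff.1 e6
  obtain ⟨q, k6, e10, e11, e12⟩ := List.map_eq_cons_iff.1 e9
  have el : l = k1 ++ p :: (k4 ++ q :: k6) := by rw [e1, e4, e7, e10]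
  simp only [Function.comp_apply] at e5 e11
  rw [el] at hsort
  simp only [List.pairwise_append, List.pairwise_cons, List.mem_append, List.mem_cons] at hsort
  obtain ⟨s1, ⟨s2, s3, ⟨s4, s5⟩, s6⟩, s7⟩ := hsort
  have hk4 : ∀ i, i ∈ k4 ↔ i ∈ s ∩ Ioo p q := by
    intro i
    constructor
    · intro hi
      refine ⟨(hmem i).1 (by rw [el]; simp [hi]), s2 i (Or.inl hi), s6 i hi q (Or.inl rfl)⟩
    · rintro ⟨h1, h2, h3⟩
      have := (hmem i).2 h1
      rw [el] at this
      simp only [List.mem_append, List.mem_cons] at this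
      rcases this with h | rfl | h | rfl | h
      · exact absurd (s7 i h p (Or.inl rfl)) (not_lt_of_gt h2)
      · exact absurd h2 (lt_irrefl _)
      · exact h
      · exact absurd h3 (lt_irrefl _)
      · exact absurd (s4 i h) (not_lt_of_gt h3)
  refine ⟨p, (hmem p).1 (by rw [el]; simp), q, (hmem q).1 (by rw [el]; simp),
    s2 q (Or.inr (Or.inl rfl)), ?_, ?_, ?_, ?_⟩
  · rw [← e5] at hc; exact hc
  · rw [← e5] at e11
    simp only [Prod.mk.injEq] at e11
    simp only [linv]
    rcases hfq : f q with ⟨a, b, c⟩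
    rw [hfq] at e11
    simp at e11 ⊢; tauto
  · intro i hi h2 h3
    have := (hk4 i).2 ⟨hi, h2, h3⟩
    have := hm _ (e8 ▸ List.mem_map.2 ⟨i, this, rfl⟩)
    exact this
  · have hf : (s ∩ Ioo p q).Finite := hs.inter_of_left _
    have hk : hf.toFinset.sort (· ≤ ·) = k4 := by
      have : hf.toFinset = k4.toFinset := by ext i; rw [List.mem_toFinset, hk4]; simp
      rw [this]
      exact (List.toFinset_sort (r := (· ≤ ·)) (s3.imp (fun h => ne_of_lt h))).2
        (s3.imp (fun h => le_of_lt h))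
    rw [oprod_def _ hf, hk, ← Function.comp_def, ← List.map_map, prod_gen, List.map_map]
    exact (congrArg FreeGroup.mk e8).trans h1

lemma fp_el [Inhabited ι] (Z : ι × ℕ → Prop) {K : ℕ} (hK : ∀ x, Z x → x.2 ≤ K)
    {f : L → ι × ℕ × Bool}
    {A : Set L} (hA : LF f A) (h : el f A = 1) (hz : ∃ i ∈ A, Z ((f i).1, (f i).2.1)) :
    ∃ p ∈ A, ∃ q ∈ A, p < q ∧ Z ((f p).1, (f p).2.1) ∧ f q = linv (f p) ∧
      (∀ i ∈ A, p < i → i < q → ¬ Z ((f i).1, (f i).2.1)) ∧ el f (A ∩ Ioo p q) = 1 := by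
  have hev : ∀ N, ev f A N = 1 := by
    intro N; rw [← coe_el hA, h]; rfl
  have H : ∀ N : ℕ, ∃ x : L × L, x ∈ lev f A K ×ˢ lev f A K ∧ x.1 < x.2 ∧
      Z ((f x.1).1, (f x.1).2.1) ∧ f x.2 = linv (f x.1) ∧
      (∀ i ∈ A, x.1 < i → i < x.2 → ¬ Z ((f i).1, (f i).2.1)) ∧
      ev f (A ∩ Ioo x.1 x.2) N = 1 := by
    intro N
    obtain ⟨i, hi, hzi⟩ := hz
    obtain ⟨p, hp, q, hq, h1, h2, h3, h4, h5⟩ := fp_fin Z f (hA (max N K)) (hev _)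
      ⟨i, ⟨hi, (hK _ hzi).trans (le_max_right _ _)⟩, hzi⟩
    refine ⟨(p, q), ⟨⟨hp.1, hK _ h2⟩, hq.1, ?_⟩, h1, h2, h3, ?_, ?_⟩
    · rw [h3]; exact hK _ h2
    · intro i hi h6 h7 h8
      exact h4 i ⟨hi, (hK _ h8).trans (le_max_right _ _)⟩ h6 h7 h8
    · have : ev f (A ∩ Ioo p q) (max N K) = 1 := by rw [ev, lev_inter]; exact h5
      rw [← kill_ev (hA.mono inter_subset_left) (le_max_left N K), this, map_one]
  choose x hx using H
  obtain ⟨y, hy⟩ : ∃ y : L × L, ∀ N, ∃ M, N ≤ M ∧ x M = y := by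
    have hfin := (hA K).prod (hA K)
    have : ∃ y ∈ lev f A K ×ˢ lev f A K, (x ⁻¹' {y}).Infinite := by
      by_contra hc
      push Not at hc
      have h1 : (⋃ y ∈ lev f A K ×ˢ lev f A K, x ⁻¹' {y}).Finite :=
        hfin.biUnion (fun y hy => not_infinite.1 (fun h => by
          have := hc y hy; exact h this))
      have h2 : (⋃ y ∈ lev f A K ×ˢ lev f A K, x ⁻¹' {y}) = Set.univ := by
        ext N; simp only [mem_iUnion, mem_univ, iff_true]
        exact ⟨x N, (hx N).1, rfl⟩
      rw [h2] at h1
      exact infinite_univ h1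
    obtain ⟨y, _, hy⟩ := this
    refine ⟨y, fun N => ?_⟩
    obtain ⟨M, hM, hNM⟩ := hy.exists_gt N
    exact ⟨M, hNM.le, hM⟩
  obtain ⟨M0, _, hM0⟩ := hy 0
  obtain ⟨⟨a1, a2⟩, a3, a4, a5, a6, -⟩ := hx M0
  rw [hM0] at a1 a2 a3 a4 a5 a6
  refine ⟨y.1, a1.1, y.2, a2.1, a3, a4, a5, a6, ?_⟩
  apply Subtype.ext
  rw [coe_el (hA.mono inter_subset_left)]
  funext N
  obtain ⟨M, hNM, hM⟩ := hy N
  have := (hx M).2.2.2.2.2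
  rw [hM] at this
  rw [← kill_ev (hA.mono inter_subset_left) hNM, this, map_one]
  rfl

end fp

end GW

end

set_option linter.all false

noncomputable section

namespace GW

open Set GriffithsWords

/-- coding of binary sequences -/
def cc (r : ℕ → Bool) : ℕ → ℕ
  | 0 => 1
  | j + 1 => 2 * cc r j + (if r j then 1 else 0)

lemma cc_bd (r : ℕ → Bool) (j : ℕ) : 2 ^ j ≤ cc r j ∧ cc r j < 2 ^ (j + 1) := by
  induction j with
  | zero => simp [cc]
  | succ j ih =>
    simp only [cc]
    rw [pow_succ, pow_succ 2 (j + 1)]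
    split_ifs <;> omega

lemma cc_mono (r : ℕ → Bool) : StrictMono (cc r) := by
  apply strictMono_nat_of_lt_succ
  intro j
  have := cc_bd r j
  have := cc_bd r (j + 1)
  omega

lemma cc_idx {r r' : ℕ → Bool} {j k : ℕ} (h : cc r j = cc r' k) : j = k := by
  have h1 := cc_bd r j
  have h2 := cc_bd r' k
  rw [h] at h1
  have a1 : j < k + 1 := (Nat.pow_lt_pow_iff_right (by norm_num)).1 (h1.1.trans_lt h2.2)
  have a2 : k < j + 1 := (Nat.pow_lt_pow_iff_right (by norm_num)).1 (h2.1.trans_lt h1.2)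
  omega

lemma cc_down {r r' : ℕ → Bool} {j : ℕ} (h : cc r j = cc r' j) : ∀ i < j, r i = r' i := by
  induction j with
  | zero => intro i hi; omega
  | succ j ih =>
    simp only [cc] at h
    have h1 : cc r j = cc r' j ∧ r j = r' j := by
      cases hr : r j <;> cases hr' : r' j <;> simp [hr, hr'] at h ⊢ <;> omega
    intro i hi
    rcases Nat.lt_succ_iff_lt_or_eq.1 hi with h2 | rfl
    · exact ih h1.1 i h2
    · exact h1.2

/-- index of a letter -/
def ix {ι : Type} (c : ι × ℕ × Bool) : ι × ℕ := (c.1, c.2.1)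

@[simp] lemma ix_linv {ι : Type} (c : ι × ℕ × Bool) : ix (linv c) = ix c := rfl

/-- positive letter -/
def pl {ι : Type} (p : ι × ℕ) : ι × ℕ × Bool := (p.1, p.2, true)

@[simp] lemma ix_pl {ι : Type} (p : ι × ℕ) : ix (pl p) = p := rfl

lemma gen_eq {ι : Type} (c : ι × ℕ × Bool) :
    gen c = if c.2.2 then FreeGroup.of (ix c) else (FreeGroup.of (ix c))⁻¹ := by
  rcases c with ⟨a, n, b⟩
  cases b <;> simp [gen, ix, FreeGroup.of, FreeGroup.inv_mk, FreeGroup.invRev]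

lemma hom_gen {ι : Type} {G : Type} [Group G] {θ θ' : FreeGroup (ι × ℕ) →* G} {c : ι × ℕ × Bool}
    (h : θ (FreeGroup.of (ix c)) = θ' (FreeGroup.of (ix c))) : θ (gen c) = θ' (gen c) := by
  rw [gen_eq]; split_ifs <;> simp [h]

lemma hom_gen_one {ι : Type} {G : Type} [Group G] {θ : FreeGroup (ι × ℕ) →* G} {c : ι × ℕ × Bool}
    (h : θ (FreeGroup.of (ix c)) = 1) : θ (gen c) = 1 := by
  rw [gen_eq]; split_ifs <;> simp [h]

section
variable {ι : Type} [Sys ι]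

lemma ma_inj {i j : ℕ} (h : (Sys.ma i : ι × ℕ) = Sys.ma j) : i = j :=
  (Sys.ma_mono (ι := ι)).injective (by simp [h])

lemma mb_inj {i j : ℕ} (h : (Sys.mb i : ι × ℕ) = Sys.mb j) : i = j :=
  (Sys.mb_mono (ι := ι)).injective (by simp [h])

lemma ma_ne_mb {i j : ℕ} : (Sys.ma i : ι × ℕ) ≠ Sys.mb j := fun h =>
  Sys.col_ne (ι := ι) i j (by rw [h])

lemma ma_le {i j : ℕ} (h : i ≤ j) : (Sys.ma i : ι × ℕ).2 ≤ (Sys.ma j : ι × ℕ).2 :=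
  (Sys.ma_mono (ι := ι)).monotone h

lemma mb_le {i j : ℕ} (h : i ≤ j) : (Sys.mb i : ι × ℕ).2 ≤ (Sys.mb j : ι × ℕ).2 :=
  (Sys.mb_mono (ι := ι)).monotone h

end

/-- inner pieces -/
structure Pcs (ι : Type) [Sys ι] where
  /-- letters -/
  s : ℕ → ℚ → ι × ℕ × Bool
  /-- domains -/
  B : ℕ → Set ℚ
  sub : ∀ j, B j ⊆ Ioo (-1) 1
  red : ∀ j, Red (s j) (B j)
  hlev : ∀ j, ∀ t ∈ B j, (Sys.ma (2 ^ (j + 1)) : ι × ℕ).2 < (s j t).2.1 ∧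
    (Sys.mb j : ι × ℕ).2 < (s j t).2.1

namespace Pcs

variable {ι : Type} [Sys ι] (Q : Pcs ι) (r : ℕ → Bool)

/-- full pieces -/
def P (j : ℕ) (t : ℚ) : ι × ℕ × Bool :=
  if t = -1 then pl (Sys.ma (cc r j)) else if t = 1 then pl (Sys.mb j) else Q.s j t

/-- domain -/
def PB (j : ℕ) : Set ℚ := insert (-1) (insert 1 (Q.B j))

/-- signed pieces -/
def F (c : Unit × ℕ × Bool) (t : ℚ) : ι × ℕ × Bool :=
  if c.2.2 then Q.P r c.2.1 t else linv (Q.P r c.2.1 (-t))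

/-- domain of signed pieces -/
def QB (c : Unit × ℕ × Bool) : Set ℚ := if c.2.2 then Q.PB c.2.1 else {t | -t ∈ Q.PB c.2.1}

/-- the substituted word -/
def U (X : ℚ → Unit × ℕ × Bool) (z : ℚ ×ₗ ℚ) : ι × ℕ × Bool :=
  Q.F r (X (ofLex z).1) (ofLex z).2

/-- its domain -/
def UA (X : ℚ → Unit × ℕ × Bool) (D : Set ℚ) : Set (ℚ ×ₗ ℚ) :=
  {z | (ofLex z).1 ∈ D ∧ (ofLex z).2 ∈ Q.QB (X (ofLex z).1)}

/-- value of a piece -/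
def u (c : Unit × ℕ × Bool) : wordGroup ι := el (Q.F r c) (Q.QB c)

end Pcs

/-- block of a position -/
def bb (z : ℚ ×ₗ ℚ) : ℚ := (ofLex z).1

/-- the coordinate inside the block -/
def tt (z : ℚ ×ₗ ℚ) : ℚ := (ofLex z).2

/-- a position -/
def mkz (l t : ℚ) : ℚ ×ₗ ℚ := toLex (l, t)

@[simp] lemma bb_mkz (l t : ℚ) : bb (mkz l t) = l := rfl
@[simp] lemma tt_mkz (l t : ℚ) : tt (mkz l t) = t := rfl
lemma mkz_eta (z : ℚ ×ₗ ℚ) : mkz (bb z) (tt z) = z := rfl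

lemma lex_le {z w : ℚ ×ₗ ℚ} : z ≤ w ↔ bb z < bb w ∨ bb z = bb w ∧ tt z ≤ tt w :=
  Prod.Lex.le_iff

lemma lex_lt {z w : ℚ ×ₗ ℚ} : z < w ↔ bb z < bb w ∨ bb z = bb w ∧ tt z < tt w :=
  Prod.Lex.lt_iff

lemma bb_mono : Monotone bb := by
  intro z w h
  rcases lex_le.1 h with h | h
  · exact h.le
  · exact h.1.le

namespace Pcs

variable {ι : Type} [Sys ι] (Q : Pcs ι) (r : ℕ → Bool)

lemma B_ne {j : ℕ} {t : ℚ} (h : t ∈ Q.B j) : t ≠ -1 ∧ t ≠ 1 := by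
  have := Q.sub j h
  exact ⟨ne_of_gt this.1, ne_of_lt this.2⟩

@[simp] lemma P_neg (j : ℕ) : Q.P r j (-1) = pl (Sys.ma (cc r j)) := by simp [P]

@[simp] lemma P_pos (j : ℕ) : Q.P r j 1 = pl (Sys.mb j) := by
  have : (1 : ℚ) ≠ -1 := by norm_num
  simp [P, this]

lemma P_mid {j : ℕ} {t : ℚ} (h : t ∈ Q.B j) : Q.P r j t = Q.s j t := by
  have := Q.B_ne h
  simp [P, this.1, this.2]

lemma PB_bd {j : ℕ} {t : ℚ} (h : t ∈ Q.PB j) : -1 ≤ t ∧ t ≤ 1 := by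
  rcases h with rfl | rfl | h
  · norm_num
  · norm_num
  · have := Q.sub j h; exact ⟨this.1.le, this.2.le⟩

lemma QB_bd {c : Unit × ℕ × Bool} {t : ℚ} (h : t ∈ Q.QB c) : -1 ≤ t ∧ t ≤ 1 := by
  unfold QB at h
  split_ifs at h
  · exact Q.PB_bd h
  · have := Q.PB_bd h; constructor <;> linarith [this.1, this.2]

lemma neg_QB (c : Unit × ℕ × Bool) : (-1) ∈ Q.QB c := by
  unfold QB; split_ifs <;> simp [PB]

lemma pos_QB (c : Unit × ℕ × Bool) : 1 ∈ Q.QB c := by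
  unfold QB; split_ifs <;> simp [PB]

lemma lvl_ma (r : ℕ → Bool) (j : ℕ) : j ≤ (Sys.ma (cc r j) : ι × ℕ).2 :=
  ((cc_mono r).le_apply).trans ((Sys.ma_mono (ι := ι)).le_apply)

lemma P_lev {j : ℕ} {t : ℚ} (h : t ∈ Q.PB j) : j ≤ (Q.P r j t).2.1 := by
  rcases h with rfl | rfl | h
  · rw [P_neg]; exact lvl_ma r j
  · rw [P_pos]; exact (Sys.mb_mono (ι := ι)).le_apply
  · rw [P_mid Q r h]
    exact ((Sys.mb_mono (ι := ι)).le_apply).trans (Q.hlev j t h).2.le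

lemma F_lev {c : Unit × ℕ × Bool} {t : ℚ} (h : t ∈ Q.QB c) : c.2.1 ≤ (Q.F r c t).2.1 := by
  unfold QB at h
  unfold F
  split_ifs at h ⊢
  · exact Q.P_lev r h
  · rw [linv_level]; exact Q.P_lev r h

lemma P_LF (j : ℕ) : LF (Q.P r j) (Q.PB j) := by
  have h1 : LF (Q.P r j) (Q.B j) := by
    intro N
    refine ((Q.red j).1 N).subset ?_
    rintro t ⟨h, h'⟩
    rw [P_mid Q r h] at h'
    exact ⟨h, h'⟩
  have : Q.PB j = {-1} ∪ ({1} ∪ Q.B j) := by ext t; simp [PB]; tauto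
  rw [this]
  exact (LF_fin (finite_singleton _)).union ((LF_fin (finite_singleton _)).union h1)

lemma F_neg_image {c : Unit × ℕ × Bool} (hc : c.2.2 = false) (C : Set ℚ) :
    Q.QB c ∩ C = (fun t => -t) '' (Q.PB c.2.1 ∩ {t | -t ∈ C}) := by
  ext t; simp only [QB, hc]
  constructor
  · rintro ⟨h1, h2⟩
    exact ⟨-t, ⟨by simpa using h1, by simpa using h2⟩, by simp⟩
  · rintro ⟨t', ⟨h1, h2⟩, rfl⟩
    exact ⟨by simpa using h1, h2⟩

lemma F_LF (c : Unit × ℕ × Bool) : LF (Q.F r c) (Q.QB c) := by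
  cases hc : c.2.2
  · have := Q.F_neg_image hc Set.univ
    rw [inter_univ] at this
    rw [this]
    refine ((Q.P_LF r c.2.1).mono inter_subset_left).image ?_
    intro t _
    simp [F, hc]
  · have h1 : Q.F r c = Q.P r c.2.1 := by funext t; simp [F, hc]
    have h2 : Q.QB c = Q.PB c.2.1 := by simp [QB, hc]
    rw [h1, h2]; exact Q.P_LF r _

lemma el_F_neg {c : Unit × ℕ × Bool} (hc : c.2.2 = false) (C : Set ℚ) :
    el (Q.F r c) (Q.QB c ∩ C) = (el (Q.P r c.2.1) (Q.PB c.2.1 ∩ {t | -t ∈ C}))⁻¹ := by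
  rw [Q.F_neg_image hc]
  apply el_image_anti ((Q.P_LF r c.2.1).mono inter_subset_left)
  · intro x _ y _ h; exact neg_lt_neg h
  · intro t _; simp [F, hc]

lemma u_true (j : ℕ) (a : Unit) : Q.u r (a, j, true) =
    lt1 (pl (Sys.ma (cc r j))) * el (Q.s j) (Q.B j) * lt1 (pl (Sys.mb j)) := by
  have h1 : Q.F r (a, j, true) = Q.P r j := by funext t; simp [F]
  have h2 : Q.QB (a, j, true) = ({-1} ∪ Q.B j) ∪ {1} := by
    ext t; simp [QB, PB]; tauto
  have hB : LF (Q.P r j) (Q.B j) := (Q.P_LF r j).mono (fun t h => Or.inr (Or.inr h))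
  have h3 : el (Q.P r j) (Q.B j) = el (Q.s j) (Q.B j) := by
    rw [el_eq_iff hB (Q.red j).1]
    exact ev_congr (fun t ht => Q.P_mid r ht)
  rw [u, h1, h2, el_union ((LF_fin (finite_singleton _)).union hB) (LF_fin (finite_singleton _)),
    el_union (LF_fin (finite_singleton _)) hB, el_single, el_single, h3]
  · simp
  · rintro x rfl y hy; exact (Q.sub j hy).1
  · rintro x (rfl | hx) y rfl
    · norm_num
    · exact (Q.sub j hx).2

lemma u_linv (c : Unit × ℕ × Bool) : Q.u r (linv c) = (Q.u r c)⁻¹ := by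
  have key : ∀ c : Unit × ℕ × Bool, c.2.2 = false → Q.u r c = (Q.u r (linv c))⁻¹ := by
    intro c hc
    have := Q.el_F_neg r hc Set.univ
    rw [inter_univ] at this
    rw [u, this, u]
    have h1 : Q.F r (linv c) = Q.P r c.2.1 := by funext t; simp [F, linv, hc]
    have h2 : Q.QB (linv c) = Q.PB c.2.1 := by simp [QB, linv, hc]
    rw [h1, h2]; simp
  cases hc : c.2.2
  · rw [key c hc, inv_inv]
  · have := key (linv c) (by simp [linv, hc])
    rw [linv_linv] at this; exact this

variable {X : ℚ → Unit × ℕ × Bool} {D : Set ℚ}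

lemma U_LF (hX : LF X D) : LF (Q.U r X) (Q.UA X D) := by
  intro N
  have : GW.lev (Q.U r X) (Q.UA X D) N ⊆ ⋃ l ∈ GW.lev X D N,
      (mkz l) '' (GW.lev (Q.F r (X l)) (Q.QB (X l)) N) := by
    rintro z ⟨hz, h2⟩
    simp only [mem_iUnion]
    refine ⟨bb z, ⟨hz.1, (Q.F_lev r hz.2).trans h2⟩, tt z, ⟨hz.2, h2⟩, rfl⟩
  exact ((hX N).biUnion (fun l _ => (Q.F_LF r (X l) N).image _)).subset this

lemma U_block_image {l : ℚ} (hl : l ∈ D) (C : Set (ℚ ×ₗ ℚ)) :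
    (Q.UA X D ∩ bb ⁻¹' {l}) ∩ C = mkz l '' (Q.QB (X l) ∩ {t | mkz l t ∈ C}) := by
  ext z; constructor
  · rintro ⟨⟨h1, h2⟩, h3⟩
    have e : bb z = l := h2
    refine ⟨tt z, ⟨?_, ?_⟩, ?_⟩
    · rw [← e]; exact h1.2
    · rw [← e]; exact h3
    · rw [← e]; rfl
  · rintro ⟨t, ⟨h1, h2⟩, rfl⟩
    exact ⟨⟨⟨hl, h1⟩, rfl⟩, h2⟩

lemma U_block' {l : ℚ} (hl : l ∈ D) (C : Set (ℚ ×ₗ ℚ)) :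
    el (Q.U r X) ((Q.UA X D ∩ bb ⁻¹' {l}) ∩ C) =
      el (Q.F r (X l)) (Q.QB (X l) ∩ {t | mkz l t ∈ C}) := by
  rw [U_block_image Q hl]
  apply el_image ((Q.F_LF r _).mono inter_subset_left)
  · intro x _ y _ h; exact lex_lt.2 (Or.inr ⟨rfl, h⟩)
  · intro t _; rfl

lemma U_block {l : ℚ} (hl : l ∈ D) :
    el (Q.U r X) (Q.UA X D ∩ bb ⁻¹' {l}) = Q.u r (X l) := by
  have := Q.U_block' r (X := X) hl Set.univ
  simpa [u] using this

lemma UA_img : bb '' (Q.UA X D) = D := by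
  ext l; constructor
  · rintro ⟨z, hz, rfl⟩; exact hz.1
  · intro hl; exact ⟨mkz l 1, ⟨hl, Q.pos_QB _⟩, rfl⟩

lemma tri_aux (n N : ℕ) (hN : (Sys.ma (2 ^ (n + 1)) : ι × ℕ).2 ≤ N) (d : ℕ) (hd : d ≤ n + 1) :
    ∃ θ : FreeGroup (ι × ℕ) →* FreeGroup (Unit × ℕ),
      (∀ p, (∀ k, n + 1 - d ≤ k → k ≤ n → p ≠ Sys.ma (cc r k)) → θ (FreeGroup.of p) = 1) ∧
      ∀ k, n + 1 - d ≤ k → k ≤ n → θ ((Q.u r ((), k, true)).1 N) = FreeGroup.of ((), k) := by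
  classical
  have cclt : ∀ {k m}, k ≤ m → cc r k ≤ 2 ^ (m + 1) := fun {k m} h =>
    (cc_bd r k).2.le.trans (Nat.pow_le_pow_right (by norm_num) (by omega))
  induction d with
  | zero =>
    refine ⟨1, by simp, ?_⟩
    intro k h1 h2; omega
  | succ d ih =>
    obtain ⟨θ, t1, t2⟩ := ih (by omega)
    set m := n - d with hm
    set x : ι × ℕ := Sys.ma (cc r m) with hx
    set w := ev (Q.s m) (Q.B m) N with hw
    let θ' : FreeGroup (ι × ℕ) →* FreeGroup (Unit × ℕ) := FreeGroup.lift
      (fun p => if p = x then FreeGroup.of ((), m) * (θ w)⁻¹ else θ (FreeGroup.of p))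
    have a1 : ∀ p, p ≠ x → θ' (FreeGroup.of p) = θ (FreeGroup.of p) := by
      intro p hp; simp [θ', hp]
    have a2 : θ' (FreeGroup.of x) = FreeGroup.of ((), m) * (θ w)⁻¹ := by simp [θ']
    have a3 : ∀ k, m ≤ k → θ' (ev (Q.s k) (Q.B k) N) = θ (ev (Q.s k) (Q.B k) N) := by
      intro k hk
      rw [ev, oprod_map, oprod_map]
      apply oprod_congr
      intro t ht
      apply hom_gen
      apply a1
      intro h
      have h1 := (Q.hlev k t ht.1).1
      have h2 : (Q.s k t).2.1 = x.2 := by rw [← h]; rfl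
      have h3 := ma_le (ι := ι) (cclt hk)
      rw [← hx] at h3
      omega
    have a4 : ∀ k, θ' ((lt1 (pl (Sys.mb k))).1 N) = θ ((lt1 (pl (Sys.mb k : ι × ℕ))).1 N) := by
      intro k
      rw [lt1_apply']
      split_ifs
      · apply hom_gen; apply a1; exact fun h => ma_ne_mb h.symm
      · simp
    have um : ∀ k, (Q.u r ((), k, true)).1 N = (lt1 (pl (Sys.ma (cc r k)))).1 N *
        ev (Q.s k) (Q.B k) N * (lt1 (pl (Sys.mb k))).1 N := by
      intro k; rw [u_true, ← coe_el (Q.red k).1]; rfl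
    refine ⟨θ', ?_, ?_⟩
    · intro p hp
      rw [a1 p (hp m (by omega) (by omega))]
      exact t1 p (fun k h1 h2 => hp k (by omega) h2)
    · intro k h1 h2
      rw [um]
      by_cases hkm : k = m
      · rw [hkm]
        rw [map_mul, map_mul, a3 m le_rfl, a4, lt1_apply', lt1_apply', if_pos]
        · have e1 : gen (pl x) = FreeGroup.of x := rfl
          rw [e1, a2]
          have : θ (if (pl (Sys.mb m : ι × ℕ)).2.1 ≤ N then gen (pl (Sys.mb m : ι × ℕ)) else 1) = 1 := by
            split_ifs
            · exact t1 _ (fun _ _ _ h => ma_ne_mb h.symm)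
            · simp
          rw [this]; simp [hw]
        · refine le_trans ?_ hN
          exact ma_le (cclt (by omega))
      · rw [map_mul, map_mul, a3 k (by omega), a4, ← t2 k (by omega) h2, um, map_mul, map_mul]
        congr 2
        rw [lt1_apply']
        split_ifs
        · apply hom_gen; apply a1
          intro h
          exact hkm (cc_idx (ma_inj h))
        · simp

lemma tri (n N : ℕ) (hN : (Sys.ma (2 ^ (n + 1)) : ι × ℕ).2 ≤ N) :
    ∃ θ : FreeGroup (ι × ℕ) →* FreeGroup (Unit × ℕ),
      ∀ c, θ ((Q.u r c).1 N) = if c.2.1 ≤ n then gen c else 1 := by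
  have cclt : ∀ {k m}, k ≤ m → cc r k ≤ 2 ^ (m + 1) := fun {k m} h =>
    (cc_bd r k).2.le.trans (Nat.pow_le_pow_right (by norm_num) (by omega))
  obtain ⟨θ, t1, t2⟩ := Q.tri_aux r n N hN (n + 1) le_rfl
  have um : ∀ k, (Q.u r ((), k, true)).1 N = (lt1 (pl (Sys.ma (cc r k)))).1 N *
      ev (Q.s k) (Q.B k) N * (lt1 (pl (Sys.mb k))).1 N := by
    intro k; rw [u_true, ← coe_el (Q.red k).1]; rfl
  have key : ∀ k, θ ((Q.u r ((), k, true)).1 N) = if k ≤ n then FreeGroup.of ((), k) else 1 := by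
    intro k
    split_ifs with h
    · exact t2 k (by omega) h
    · rw [um, map_mul, map_mul]
      have e1 : θ ((lt1 (pl (Sys.ma (cc r k)))).1 N) = 1 := by
        rw [lt1_apply']; split_ifs
        · apply t1
          intro k' _ h1 h2
          have := cc_idx (ma_inj h2); omega
        · simp
      have e2 : θ ((lt1 (pl (Sys.mb k))).1 N) = 1 := by
        rw [lt1_apply']; split_ifs
        · apply t1
          intro k' _ h1 h2
          exact ma_ne_mb h2.symm
        · simp
      have e3 : θ (ev (Q.s k) (Q.B k) N) = 1 := by
        rw [ev, oprod_map]
        apply oprod_one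
        intro t ht
        apply hom_gen_one
        apply t1
        intro k' _ h1 h2
        have h3 := (Q.hlev k t ht.1).1
        have h4 : (Q.s k t).2.1 = (Sys.ma (cc r k') : ι × ℕ).2 := by rw [← h2]; rfl
        have h5 := ma_le (ι := ι) (cclt (show k' ≤ k by omega))
        omega
      rw [e1, e2, e3]; simp
  refine ⟨θ, ?_⟩
  rintro ⟨⟨⟩, k, b⟩
  cases b
  · have := Q.u_linv r ((), k, true)
    have h2 : linv (((), k, true) : Unit × ℕ × Bool) = ((), k, false) := rfl
    rw [h2] at this
    rw [this]
    have h3 : ((Q.u r ((), k, true))⁻¹).1 N = ((Q.u r ((), k, true)).1 N)⁻¹ := rfl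
    rw [h3, map_inv, key, ← h2, gen_linv]
    simp only [linv]
    split_ifs <;> simp [gen_eq, ix] <;> omega
  · rw [key]; simp [gen_eq, ix]

lemma sub_inj (hX : LF X D) {C : Set ℚ} (h : el (Q.U r X) (Q.UA X D ∩ bb ⁻¹' C) = 1) :
    el X (D ∩ C) = 1 := by
  have hU := (Q.U_LF r hX).mono (inter_subset_left (t := bb ⁻¹' C))
  have hXC := hX.mono (inter_subset_left (t := C))
  apply Subtype.ext
  rw [coe_el hXC]
  funext n
  set N := max n (Sys.ma (2 ^ (n + 1)) : ι × ℕ).2 with hN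
  obtain ⟨θ, hθ⟩ := Q.tri r n N (le_max_right _ _)
  have h1 : ev (Q.U r X) (Q.UA X D ∩ bb ⁻¹' C) N = 1 := by
    rw [← coe_el hU, h]; rfl
  rw [ev_blocks hU (bb_mono.monotoneOn _) (hXC N)] at h1
  · have h2 := congrArg θ h1
    rw [oprod_map, map_one] at h2
    show ev X (D ∩ C) n = 1
    have h3 : ∀ l ∈ GW.lev X (D ∩ C) N,
        θ (ev (Q.U r X) (Q.UA X D ∩ bb ⁻¹' C ∩ bb ⁻¹' {l}) N) = if (X l).2.1 ≤ n then gen (X l) else 1 := by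
      intro l hl
      have e : Q.UA X D ∩ bb ⁻¹' C ∩ bb ⁻¹' {l} = Q.UA X D ∩ bb ⁻¹' {l} := by
        ext z; constructor
        · rintro ⟨⟨a, b⟩, c⟩; exact ⟨a, c⟩
        · rintro ⟨a, c⟩
          have c' : bb z = l := c
          exact ⟨⟨a, by rw [mem_preimage, c']; exact hl.1.2⟩, c⟩
      rw [e, ← coe_el ((Q.U_LF r hX).mono inter_subset_left), Q.U_block r hl.1.1, hθ]
    rw [oprod_congr h3] at h2
    rw [← h2, ev, ← oprod_subset (hXC N) (t := GW.lev X (D ∩ C) n)]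
    · apply oprod_congr
      intro l hl
      rw [if_pos hl.2]
    · intro l hl; exact ⟨hl.1, hl.2.trans (le_max_left _ _)⟩
    · intro l hl hl'
      rw [if_neg]
      exact fun h => hl' ⟨hl.1, h⟩
  · rintro _ ⟨z, ⟨⟨hz, hz'⟩, h2⟩, rfl⟩
    exact ⟨⟨hz.1, hz'⟩, (Q.F_lev r hz.2).trans h2⟩

end Pcs

end GW

end

set_option linter.all false

noncomputable section

namespace GW

open Set GriffithsWords

lemma el_Icc {ι : Type} [Inhabited ι] {L : Type} [LinearOrder L] {X : L → ι × ℕ × Bool} {D : Set L} (hX : LF X D)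
    {l m : L} (hl : l ∈ D) (hm : m ∈ D) (h : l < m) :
    el X (D ∩ Icc l m) = lt1 (X l) * el X (D ∩ Ioo l m) * lt1 (X m) := by
  have : D ∩ Icc l m = ({l} ∪ (D ∩ Ioo l m)) ∪ {m} := by
    ext x; constructor
    · rintro ⟨h1, h2⟩
      rcases eq_or_lt_of_le h2.1 with h3 | h3
      · exact Or.inl (Or.inl h3.symm)
      rcases eq_or_lt_of_le h2.2 with h4 | h4
      · exact Or.inr h4
      · exact Or.inl (Or.inr ⟨h1, h3, h4⟩)
    · rintro ((h1 | h1) | h1)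
      · rw [mem_singleton_iff] at h1; rw [h1]; exact ⟨hl, le_rfl, h.le⟩
      · exact ⟨h1.1, h1.2.1.le, h1.2.2.le⟩
      · rw [mem_singleton_iff] at h1; rw [h1]; exact ⟨hm, h.le, le_rfl⟩
  have h0 := hX.mono (inter_subset_left (t := Ioo l m))
  rw [this, el_union ((LF_fin (finite_singleton _)).union h0) (LF_fin (finite_singleton _)),
    el_union (LF_fin (finite_singleton _)) h0, el_single, el_single]
  · rintro x hx y hy
    rw [mem_singleton_iff] at hx; rw [hx]; exact hy.2.1
  · rintro x (hx | hx) y hy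
    · rw [mem_singleton_iff] at hx hy; rw [hx, hy]; exact h
    · rw [mem_singleton_iff] at hy; rw [hy]; exact hx.2.2

namespace Pcs

variable {ι : Type} [Sys ι] (Q : Pcs ι) (r : ℕ → Bool)

lemma ix_F (c : Unit × ℕ × Bool) (t : ℚ) :
    ix (Q.F r c t) = if c.2.2 then ix (Q.P r c.2.1 t) else ix (Q.P r c.2.1 (-t)) := by
  unfold F; split_ifs <;> simp

/-- the two marker indices -/
def Sp (a : ℕ) (x : ι × ℕ) : Prop := x = Sys.ma (cc r a) ∨ x = Sys.mb a

lemma P_special {j a : ℕ} (h : a ≤ j) {t : ℚ} (ht : t ∈ Q.PB j) (hs : Sp r a (ix (Q.P r j t))) :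
    j = a ∧ (t = -1 ∨ t = 1) := by
  have cclt : ∀ {k m}, k ≤ m → cc r k ≤ 2 ^ (m + 1) := fun {k m} h =>
    (cc_bd r k).2.le.trans (Nat.pow_le_pow_right (by norm_num) (by omega))
  rcases ht with rfl | rfl | ht
  · rw [P_neg, ix_pl] at hs
    rcases hs with hs | hs
    · exact ⟨cc_idx (ma_inj hs), Or.inl rfl⟩
    · exact absurd hs ma_ne_mb
  · rw [P_pos, ix_pl] at hs
    rcases hs with hs | hs
    · exact absurd hs.symm ma_ne_mb
    · exact ⟨mb_inj hs, Or.inr rfl⟩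
  · rw [P_mid Q r ht] at hs
    have h1 := Q.hlev j t ht
    exfalso
    rcases hs with hs | hs
    · have h2 : (Q.s j t).2.1 = _ := congrArg Prod.snd hs
      have h3 := ma_le (ι := ι) (cclt h)
      omega
    · have h2 : (Q.s j t).2.1 = _ := congrArg Prod.snd hs
      have h3 := mb_le (ι := ι) h
      omega

lemma F_special {a : ℕ} {c : Unit × ℕ × Bool} (h : a ≤ c.2.1) {t : ℚ} (ht : t ∈ Q.QB c)
    (hs : Sp r a (ix (Q.F r c t))) : c.2.1 = a ∧ (t = -1 ∨ t = 1) := by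
  rw [ix_F] at hs
  unfold QB at ht
  split_ifs at ht hs
  · exact Q.P_special r h ht hs
  · obtain ⟨h1, h2 | h2⟩ := Q.P_special r h ht hs
    · exact ⟨h1, Or.inr (by linarith)⟩
    · exact ⟨h1, Or.inl (by linarith)⟩

lemma special_F (c : Unit × ℕ × Bool) : Sp r c.2.1 (ix (Q.F r c (-1))) ∧
    Sp r c.2.1 (ix (Q.F r c 1)) := by
  rw [ix_F, ix_F]
  split_ifs
  · simp [Sp]
  · simp [Sp]

lemma ends_ne (c : Unit × ℕ × Bool) : lcol (Q.F r c (-1)) ≠ lcol (Q.F r c 1) := by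
  have e : ∀ d : ι × ℕ × Bool, lcol d = Sys.col (ix d) := fun _ => rfl
  rw [e, e, ix_F, ix_F]
  split_ifs
  · simpa using Sys.col_ne _ _
  · simpa using (Sys.col_ne _ _).symm

lemma ends_linv {c d : Unit × ℕ × Bool} (h : Q.F r d (-1) = linv (Q.F r c 1)) (hcd : c.2.1 = d.2.1) :
    d = linv c := by
  have h1 := congrArg (fun x => x.2.2) h
  rcases c with ⟨⟨⟩, j, b⟩
  rcases d with ⟨⟨⟩, k, b'⟩
  simp only at hcd
  subst hcd
  cases b <;> cases b' <;> simp [F, linv, pl] at h1 ⊢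

lemma red_mid (c : Unit × ℕ × Bool) {C : Set ℚ} (hC : C.OrdConnected) (hC1 : C ⊆ Ioo (-1) 1)
    (h : el (Q.F r c) (Q.QB c ∩ C) = 1) : Q.QB c ∩ C = ∅ := by
  have key : ∀ (j : ℕ) (C : Set ℚ), C.OrdConnected → C ⊆ Ioo (-1) 1 →
      el (Q.P r j) (Q.PB j ∩ C) = 1 → Q.PB j ∩ C = ∅ := by
    intro j C hC hC1 h
    have e : Q.PB j ∩ C = Q.B j ∩ C := by
      ext t; constructor
      · rintro ⟨rfl | rfl | h1, h2⟩
        · exact absurd (hC1 h2).1 (by norm_num)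
        · exact absurd (hC1 h2).2 (by norm_num)
        · exact ⟨h1, h2⟩
      · rintro ⟨h1, h2⟩; exact ⟨Or.inr (Or.inr h1), h2⟩
    have hB : LF (Q.P r j) (Q.B j ∩ C) := (Q.P_LF r j).mono (fun t h => Or.inr (Or.inr h.1))
    rw [e] at h ⊢
    apply (Q.red j).2 C hC
    rw [← h, el_eq_iff ((Q.red j).1.mono inter_subset_left) hB]
    exact ev_congr (fun t ht => (Q.P_mid r ht.1).symm)
  cases hc : c.2.2
  · rw [Q.el_F_neg r hc, inv_eq_one] at h
    rw [Q.F_neg_image hc, key _ _ _ _ h, image_empty]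
    · constructor
      intro x hx y hy z hz
      exact hC.out hy hx ⟨neg_le_neg hz.2, neg_le_neg hz.1⟩
    · intro t ht
      have := hC1 ht
      exact ⟨by linarith [this.2], by linarith [this.1]⟩
  · have h1 : Q.F r c = Q.P r c.2.1 := by funext t; simp [F, hc]
    have h2 : Q.QB c = Q.PB c.2.1 := by simp [QB, hc]
    rw [h1, h2] at h
    rw [h2]; exact key _ _ hC hC1 h

variable {X : ℚ → Unit × ℕ × Bool} {D : Set ℚ}

lemma tt_bd {z : ℚ ×ₗ ℚ} (hz : z ∈ Q.UA X D) : -1 ≤ tt z ∧ tt z ≤ 1 := Q.QB_bd hz.2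

theorem U_red (hX : Red X D) : Red (Q.U r X) (Q.UA X D) := by
  refine ⟨Q.U_LF r hX.1, ?_⟩
  intro C hC h1
  by_contra hne
  have hne : (Q.UA X D ∩ C).Nonempty := nonempty_iff_ne_empty.2 hne
  obtain ⟨z0, hz0, hmin⟩ : ∃ z0 ∈ Q.UA X D ∩ C, ∀ z ∈ Q.UA X D ∩ C,
      (X (bb z0)).2.1 ≤ (X (bb z)).2.1 := by
    obtain ⟨z0, h, h'⟩ := (wellFounded_lt (α := ℕ)).has_min ((fun z => (X (bb z)).2.1) '' _)
      (hne.image _)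
    obtain ⟨z1, hz1, rfl⟩ := h
    exact ⟨z1, hz1, fun z hz => not_lt.1 (h' _ ⟨z, hz, rfl⟩)⟩
  set a := (X (bb z0)).2.1 with ha
  have hU := (Q.U_LF r hX.1).mono (inter_subset_left (t := C))
  have hin : ∀ {z w v}, z ∈ Q.UA X D ∩ C → w ∈ Q.UA X D ∩ C → z ≤ v → v ≤ w → v ∈ Q.UA X D →
      v ∈ Q.UA X D ∩ C := fun {z w v} hz hw h1 h2 h3 => ⟨h3, hC.out hz.2 hw.2 ⟨h1, h2⟩⟩
  have lend : ∀ {z}, z ∈ Q.UA X D → mkz (bb z) (-1) ∈ Q.UA X D ∧ mkz (bb z) 1 ∈ Q.UA X D :=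
    fun {z} hz => ⟨⟨hz.1, Q.neg_QB _⟩, ⟨hz.1, Q.pos_QB _⟩⟩
  have lle : ∀ {z}, z ∈ Q.UA X D → mkz (bb z) (-1) ≤ z ∧ z ≤ mkz (bb z) 1 :=
    fun {z} hz => ⟨lex_le.2 (Or.inr ⟨rfl, (Q.tt_bd hz).1⟩), lex_le.2 (Or.inr ⟨rfl, (Q.tt_bd hz).2⟩)⟩
  by_cases hsp : ∃ i ∈ Q.UA X D ∩ C, Sp r a (ix (Q.U r X i))
  · obtain ⟨p, hp, q, hq, hpq, zp, hinv, hno, hone⟩ := fp_el (Sp r a)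
      (K := max (Sys.ma (cc r a) : ι × ℕ).2 (Sys.mb a : ι × ℕ).2)
      (by rintro x (rfl | rfl); exacts [le_max_left _ _, le_max_right _ _]) hU h1 hsp
    have zp : Sp r a (ix (Q.U r X p)) := zp
    have zq : Sp r a (ix (Q.U r X q)) := by rw [hinv, ix_linv]; exact zp
    obtain ⟨jp, tp⟩ := Q.F_special r (hmin p hp) hp.1.2 zp
    obtain ⟨jq, tq⟩ := Q.F_special r (hmin q hq) hq.1.2 zq
    have tp : tt p = -1 ∨ tt p = 1 := tp
    have tq : tt q = -1 ∨ tt q = 1 := tq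
    have hpF : Q.U r X p = Q.F r (X (bb p)) (tt p) := rfl
    have hqF : Q.U r X q = Q.F r (X (bb q)) (tt q) := rfl
    have hlt : bb p < bb q := by
      rcases lex_lt.1 hpq with h | ⟨h, h'⟩
      · exact h
      · exfalso
        have t1 : tt p = -1 := by
          rcases tp with h | h
          · exact h
          · rcases tq with h2 | h2 <;> rw [h, h2] at h' <;> norm_num at h'
        have t2 : tt q = 1 := by
          rcases tq with h2 | h2
          · rw [t1, h2] at h'; norm_num at h'
          · exact h2
        have := congrArg lcol hinv
        rw [hpF, hqF, t1, t2, ← h] at this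
        exact (Q.ends_ne r (X (bb p))).symm this
    have t1 : tt p = 1 := by
      rcases tp with h | h
      · exfalso
        refine hno (mkz (bb p) 1) (hin hp hq (lle hp.1).2 (lex_le.2 (Or.inl hlt)) (lend hp.1).2)
          (lex_lt.2 (Or.inr ⟨rfl, by rw [h]; norm_num⟩)) (lex_lt.2 (Or.inl hlt)) ?_
        have := (Q.special_F r (X (bb p))).2
        rw [show (X (bb p)).2.1 = a from jp] at this
        exact this
      · exact h
    have t2 : tt q = -1 := by
      rcases tq with h | h
      · exact h
      · exfalso
        refine hno (mkz (bb q) (-1)) (hin hp hq (lex_le.2 (Or.inl hlt)) (lle hq.1).1 (lend hq.1).1)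
          (lex_lt.2 (Or.inl hlt)) (lex_lt.2 (Or.inr ⟨rfl, by rw [h]; norm_num⟩)) ?_
        have := (Q.special_F r (X (bb q))).1
        rw [show (X (bb q)).2.1 = a from jq] at this
        exact this
    have hset : Q.UA X D ∩ C ∩ Ioo p q = Q.UA X D ∩ bb ⁻¹' (Ioo (bb p) (bb q)) := by
      ext z; constructor
      · rintro ⟨⟨h1, h2⟩, h3, h4⟩
        refine ⟨h1, ?_, ?_⟩
        · rcases lex_lt.1 h3 with h | ⟨_, h⟩
          · exact h
          · rw [t1] at h; exact absurd (Q.tt_bd h1).2 (not_le.2 h)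
        · rcases lex_lt.1 h4 with h | ⟨_, h⟩
          · exact h
          · rw [t2] at h; exact absurd (Q.tt_bd h1).1 (not_le.2 h)
      · rintro ⟨h1, h2, h3⟩
        have b1 : p < z := lex_lt.2 (Or.inl h2)
        have b2 : z < q := lex_lt.2 (Or.inl h3)
        exact ⟨hin hp hq b1.le b2.le h1, b1, b2⟩
    rw [hset] at hone
    have hX1 := Q.sub_inj r hX.1 hone
    have hXl : X (bb q) = linv (X (bb p)) := by
      apply Q.ends_linv r _ (jp.trans jq.symm)
      rw [hqF, hpF, t1, t2] at hinv; exact hinv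
    have := hX.2 (Icc (bb p) (bb q)) ordConnected_Icc
      (by rw [el_Icc hX.1 (show bb p ∈ D from hp.1.1) (show bb q ∈ D from hq.1.1) hlt, hX1, hXl, lt1_linv]; simp)
    have hmem : bb p ∈ D ∩ Icc (bb p) (bb q) := ⟨hp.1.1, le_rfl, hlt.le⟩
    rw [this] at hmem; exact hmem
  · have hns : ∀ i ∈ Q.UA X D ∩ C, ¬ Sp r a (ix (Q.U r X i)) := fun i hi h => hsp ⟨i, hi, h⟩
    have sp1 : Sp r a (ix (Q.U r X (mkz (bb z0) 1))) := (Q.special_F r (X (bb z0))).2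
    have sp2 : Sp r a (ix (Q.U r X (mkz (bb z0) (-1)))) := (Q.special_F r (X (bb z0))).1
    have hblk : ∀ z ∈ Q.UA X D ∩ C, bb z = bb z0 := by
      intro z hz
      rcases lt_trichotomy (bb z) (bb z0) with h | h | h
      · exact absurd sp2 (hns _ (hin hz hz0 (lex_le.2 (Or.inl h)) (lle hz0.1).1 (lend hz0.1).1))
      · exact h
      · exact absurd sp1 (hns _ (hin hz0 hz (lle hz0.1).2 (lex_le.2 (Or.inl h)) (lend hz0.1).2))
    set C' : Set ℚ := {t | mkz (bb z0) t ∈ C} ∩ Ioo (-1) 1 with hC'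
    have hs : Q.UA X D ∩ C = Q.UA X D ∩ bb ⁻¹' {bb z0} ∩ C := by
      ext z; constructor
      · intro h; exact ⟨⟨h.1, hblk z h⟩, h.2⟩
      · intro h; exact ⟨h.1.1, h.2⟩
    have hs2 : Q.QB (X (bb z0)) ∩ {t | mkz (bb z0) t ∈ C} = Q.QB (X (bb z0)) ∩ C' := by
      ext t; constructor
      · rintro ⟨h1, h2⟩
        refine ⟨h1, h2, lt_of_le_of_ne (Q.QB_bd h1).1 ?_, lt_of_le_of_ne (Q.QB_bd h1).2 ?_⟩
        · rintro rfl; exact hns (mkz (bb z0) (-1)) ⟨⟨hz0.1.1, h1⟩, h2⟩ sp2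
        · rintro rfl; exact hns (mkz (bb z0) 1) ⟨⟨hz0.1.1, h1⟩, h2⟩ sp1
      · rintro ⟨h1, h2, _⟩; exact ⟨h1, h2⟩
    rw [hs, Q.U_block' r (show bb z0 ∈ D from hz0.1.1), hs2] at h1
    have := Q.red_mid r _ (C := C') ?_ inter_subset_right h1
    · rw [← hs2] at this
      have hm : tt z0 ∈ Q.QB (X (bb z0)) ∩ {t | mkz (bb z0) t ∈ C} := ⟨hz0.1.2, hz0.2⟩
      rw [this] at hm; exact hm
    · refine OrdConnected.inter ⟨?_⟩ ordConnected_Ioo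
      intro x hx y hy z hz
      exact hC.out hx hy ⟨lex_le.2 (Or.inr ⟨rfl, hz.1⟩), lex_le.2 (Or.inr ⟨rfl, hz.2⟩)⟩

lemma u_inj {c d : Unit × ℕ × Bool} (h : Q.u r c = Q.u r d) : c = d := by
  obtain ⟨θ, hθ⟩ := Q.tri r (max c.2.1 d.2.1) _ le_rfl
  have h1 := hθ c
  rw [h, hθ d, if_pos (le_max_right _ _), if_pos (le_max_left _ _)] at h1
  exact (gen_inj h1).symm

end Pcs

end GW

end

set_option linter.all false

noncomputable section

namespace GW

open Set GriffithsWords Cardinal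

section fac
variable {ι : Type} [Sys ι]

/-- chosen reduced word -/
def rw_f (a : wordGroup ι) : ℚ → ι × ℕ × Bool := (exists_redrep a).choose
/-- chosen reduced word, domain -/
def rw_A (a : wordGroup ι) : Set ℚ := (exists_redrep a).choose_spec.choose

lemma rw_red (a : wordGroup ι) : Red (rw_f a) (rw_A a) := (exists_redrep a).choose_spec.choose_spec.1
lemma rw_el (a : wordGroup ι) : el (rw_f a) (rw_A a) = a := (exists_redrep a).choose_spec.choose_spec.2

/-- single-coloured elements and factors of the elements of a set -/
def Fac (S : Set (wordGroup ι)) : Set (wordGroup ι) :=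
  {x | Mono x ∨ ∃ a ∈ S, ∃ C : Set ℚ, C.OrdConnected ∧
    (x = el (rw_f a) (rw_A a ∩ C) ∨ x⁻¹ = el (rw_f a) (rw_A a ∩ C))}

lemma Fac_inv {S : Set (wordGroup ι)} (g : wordGroup ι) (h : g ∈ Fac S) : g⁻¹ ∈ Fac S := by
  rcases h with h | ⟨a, ha, C, hC, h⟩
  · exact Or.inl h.inv
  · exact Or.inr ⟨a, ha, C, hC, by rw [inv_inv]; exact h.symm⟩

lemma Fac_pre' {S : Set (wordGroup ι)} (g : wordGroup ι) (h : g ∈ Fac S) (x : wordGroup ι)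
    (hx : Pre x g) : x ∈ Fac S := by
  rcases h with h | ⟨a, ha, C, hC, h | h⟩
  · exact Or.inl (h.pre hx).1
  · have hr := (rw_red a).inter hC
    obtain ⟨D, hD, h2⟩ := hx.rep hr.1 h.symm
    exact Or.inr ⟨a, ha, C ∩ D, hC.inter hD.ordConnected, Or.inl (by rw [← inter_assoc]; exact h2.symm)⟩
  · have hr := (rw_red a).inter hC
    obtain ⟨D, hD, h2⟩ := hx.inv.rep hr.1 h.symm
    refine Or.inr ⟨a, ha, C ∩ Dᶜ, hC.inter hD.compl.ordConnected, Or.inr ?_⟩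
    have h3 := el_split hr.1 hD
    rw [h2, ← h, inter_assoc] at h3
    rw [mul_assoc, left_eq_mul] at h3
    rw [eq_comm, ← mul_eq_one_iff_eq_inv', h3]

lemma Fac_pre {S : Set (wordGroup ι)} (g : wordGroup ι) (h : g ∈ Fac S) (x : wordGroup ι)
    (hx : Pre x g) : x ∈ Fac S ∧ x⁻¹ * g ∈ Fac S := by
  refine ⟨Fac_pre' g h x hx, ?_⟩
  have := Fac_inv _ (Fac_pre' _ (Fac_inv g h) _ hx.inv)
  rwa [mul_inv_rev, inv_inv] at this

lemma small_le_Fac {S : Set (wordGroup ι)} :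
    Subgroup.closure ({g | Mono g} ∪ {x | ∃ a ∈ S, Pre x a}) ≤ Subgroup.closure (Fac S) := by
  rw [Subgroup.closure_le]
  rintro x (hx | ⟨a, ha, hx⟩)
  · exact Subgroup.subset_closure (Or.inl hx)
  · apply Subgroup.subset_closure
    obtain ⟨D, hD, h⟩ := hx.rep (rw_red a).1 (rw_el a)
    exact Or.inr ⟨a, ha, D, hD.ordConnected, Or.inl h.symm⟩

end fac

namespace Pcs

variable {ι : Type} [Sys ι] (Q : Pcs ι) (r : ℕ → Bool)

/-- block word -/
def bl (X : ℚ → Unit × ℕ × Bool) (D C : Set ℚ) : wordGroup ι :=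
  el (Q.U r X) (Q.UA X D ∩ bb ⁻¹' C)

variable {X : ℚ → Unit × ℕ × Bool} {D : Set ℚ}

lemma bb_ord {C : Set ℚ} (hC : C.OrdConnected) : (bb ⁻¹' C).OrdConnected :=
  hC.preimage_mono bb_mono

lemma bl_red (hX : Red X D) {C : Set ℚ} (hC : C.OrdConnected) :
    Red (Q.U r X) (Q.UA X D ∩ bb ⁻¹' C) := (Q.U_red r hX).inter (bb_ord hC)

lemma bl_ne {C : Set ℚ} (hX : Red X D) (hC : C.OrdConnected) (h : (D ∩ C).Nonempty) :
    Q.bl r X D C ≠ 1 := by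
  intro h1
  have := (Q.U_red r hX).2 _ (bb_ord hC) h1
  obtain ⟨l, hl⟩ := h
  have hm : mkz l 1 ∈ Q.UA X D ∩ bb ⁻¹' C := ⟨⟨hl.1, Q.pos_QB _⟩, hl.2⟩
  rw [this] at hm; exact hm

lemma bl_split (hX : LF X D) {C : Set ℚ} {E : Set ℚ} (hE : IsLowerSet E) :
    Q.bl r X D C = Q.bl r X D (C ∩ E) * Q.bl r X D (C ∩ Eᶜ) := by
  have := el_split ((Q.U_LF r hX).mono (inter_subset_left (t := bb ⁻¹' C)))
    (hE.preimage bb_mono)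
  rwa [inter_assoc, inter_assoc] at this

lemma not_mono (hX : Red X D) {C : Set ℚ} (hC : C.OrdConnected) (h : (D ∩ C).Nonempty) :
    ¬ Mono (Q.bl r X D C) := by
  intro hm
  obtain ⟨f, A, hA, h1, c, hc⟩ := hm.red
  obtain ⟨e, he, hi, hf⟩ := red_unique (Q.bl_red r hX hC) hA h1.symm
  obtain ⟨l, hl⟩ := h
  have m1 : mkz l 1 ∈ Q.UA X D ∩ bb ⁻¹' C := ⟨⟨hl.1, Q.pos_QB _⟩, hl.2⟩
  have m2 : mkz l (-1) ∈ Q.UA X D ∩ bb ⁻¹' C := ⟨⟨hl.1, Q.neg_QB _⟩, hl.2⟩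
  apply Q.ends_ne r (X l)
  have e1 := hc _ (by rw [← hi]; exact ⟨_, m1, rfl⟩)
  have e2 := hc _ (by rw [← hi]; exact ⟨_, m2, rfl⟩)
  rw [hf _ m1] at e1
  rw [hf _ m2] at e2
  exact e2.trans e1.symm

lemma bl_fac (hX : Red X D) {S : Set (wordGroup ι)} {h : wordGroup ι} {k : Multiplicative Unit}
    (hv : Val (fun g (_ : Multiplicative Unit) => g ∈ Fac S) h k) :
    ∀ (C : Set ℚ) (z : wordGroup ι), C.OrdConnected → (D ∩ C).Infinite → Pre z h →
      h = z * Q.bl r X D C →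
      ∃ C' : Set ℚ, C'.OrdConnected ∧ (D ∩ C').Infinite ∧ Q.bl r X D C' ∈ Fac S := by
  induction hv with
  | one =>
    intro C z hC hinf hz h
    rw [pre_one_iff hz, one_mul] at h
    exact absurd h.symm (Q.bl_ne r hX hC hinf.nonempty)
  | @cons b h' c k hb hh hp ih =>
    intro C z hC hinf hz h
    rcases hp.total hz with hbz | hzb
    · refine ih C (b⁻¹ * z) hC hinf ?_ ?_
      · have := hbz.tail hz
        rwa [inv_mul_cancel_left] at this
      · rw [mul_assoc, ← h, inv_mul_cancel_left]
    · have h1 := hzb.tail hp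
      have hr := Q.bl_red r hX hC
      rw [h, inv_mul_cancel_left] at h1
      obtain ⟨D0, hD0, h2⟩ := h1.rep hr.1 rfl
      set C1 : Set ℚ := {l | mkz l 1 ∈ D0} with hC1
      set C2 : Set ℚ := {l | mkz l (-1) ∉ D0} with hC2
      have hmono : ∀ t : ℚ, Monotone (fun l => mkz l t) := by
        intro t l m hlm
        rcases eq_or_lt_of_le hlm with h | h
        · rw [h]
        · exact lex_le.2 (Or.inl h)
      have l1 : IsLowerSet C1 := hD0.preimage (hmono 1)
      have u2 : IsUpperSet C2 := hD0.compl.preimage (hmono (-1))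
      have lend : ∀ {z}, z ∈ Q.UA X D → mkz (bb z) (-1) ≤ z ∧ z ≤ mkz (bb z) 1 :=
        fun {z} hz => ⟨lex_le.2 (Or.inr ⟨rfl, (Q.tt_bd hz).1⟩), lex_le.2 (Or.inr ⟨rfl, (Q.tt_bd hz).2⟩)⟩
      have i1 : ∀ z ∈ Q.UA X D, bb z ∈ C1 → z ∈ D0 := fun z hz h => hD0 (lend hz).2 h
      have i2 : ∀ z ∈ Q.UA X D, bb z ∈ C2 → z ∉ D0 := fun z hz h h' => h (hD0 (lend hz).1 h')
      have hcov : (D ∩ (C ∩ C1)).Infinite ∨ (D ∩ (C ∩ C2)).Infinite := by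
        by_contra hcon
        rw [not_or, not_infinite, not_infinite] at hcon
        have hsub : (C1 ∪ C2)ᶜ.Subsingleton := by
          intro l hl m hm
          by_contra hne
          have key : ∀ {l m : ℚ}, l ∈ (C1 ∪ C2)ᶜ → m ∈ (C1 ∪ C2)ᶜ → l < m → False := by
            intro l m hl hm hlm
            apply hl
            left
            have : mkz m (-1) ∈ D0 := by
              by_contra h; exact hm (Or.inr h)
            have hle : mkz l 1 ≤ mkz m (-1) := lex_le.2 (Or.inl hlm)
            exact hD0 hle this
          rcases lt_or_gt_of_ne hne with h | h
          · exact key hl hm h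
          · exact key hm hl h
        refine hinf (((hcon.1.union hcon.2).union hsub.finite).subset ?_)
        rintro l ⟨h1, h2⟩
        by_cases h3 : l ∈ C1
        · exact Or.inl (Or.inl ⟨h1, h2, h3⟩)
        by_cases h4 : l ∈ C2
        · exact Or.inl (Or.inr ⟨h1, h2, h4⟩)
        · exact Or.inr (fun h => h.elim h3 h4)
      rcases hcov with hcov | hcov
      · refine ⟨C ∩ C1, hC.inter l1.ordConnected, hcov, ?_⟩
        apply Fac_pre' _ (Fac_pre b hb z hzb).2
        rw [← h2]
        have := pre_of_red (hr.inter hD0.ordConnected) (l1.preimage bb_mono)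
        have e : Q.UA X D ∩ bb ⁻¹' (C ∩ C1) = Q.UA X D ∩ bb ⁻¹' C ∩ D0 ∩ bb ⁻¹' C1 := by
          ext z; constructor
          · rintro ⟨h1, h3, h4⟩; exact ⟨⟨⟨h1, h3⟩, i1 z h1 h4⟩, h4⟩
          · rintro ⟨⟨⟨h1, h3⟩, _⟩, h4⟩; exact ⟨h1, h3, h4⟩
        rw [bl, e]; exact this
      · have e1 : h' = el (Q.U r X) (Q.UA X D ∩ bb ⁻¹' C ∩ D0ᶜ) := by
          have := el_split hr.1 hD0
          rw [h2] at this
          have e : Q.bl r X D C = z⁻¹ * (b * h') := by rw [h, inv_mul_cancel_left]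
          rw [bl, this, mul_assoc, mul_right_inj, mul_right_inj] at e
          exact e.symm
        have hr2 := hr.inter hD0.compl.ordConnected
        have hl : IsLowerSet (bb ⁻¹' C2ᶜ) := u2.compl.preimage bb_mono
        refine ih (C ∩ C2) (el (Q.U r X) (Q.UA X D ∩ bb ⁻¹' C ∩ D0ᶜ ∩ (bb ⁻¹' C2ᶜ)))
          (hC.inter u2.ordConnected) hcov ?_ ?_
        · rw [e1]; exact pre_of_red hr2 hl
        · rw [e1, el_split hr2.1 hl]
          have e : Q.UA X D ∩ bb ⁻¹' C ∩ D0ᶜ ∩ (bb ⁻¹' C2ᶜ)ᶜ = Q.UA X D ∩ bb ⁻¹' (C ∩ C2) := by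
            ext z; constructor
            · rintro ⟨⟨⟨h1, h3⟩, _⟩, h4⟩; exact ⟨h1, h3, not_not.1 h4⟩
            · rintro ⟨h1, h3, h4⟩; exact ⟨⟨⟨h1, h3⟩, i2 z h1 h4⟩, not_not.2 h4⟩
          rw [e]; rfl

lemma ix_lost {r r' : ℕ → Bool} {j0 : ℕ} (hne : cc r j0 ≠ cc r' j0) {c : Unit × ℕ × Bool} {t : ℚ}
    (ht : t ∈ Q.QB c) (h : ix (Q.F r' c t) = Sys.ma (cc r j0)) :
    ix (Q.F r c t) = Sys.ma (cc r j0) := by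
  have key : ∀ j, ∀ t ∈ Q.PB j, ix (Q.P r' j t) = Sys.ma (cc r j0) →
      ix (Q.P r j t) = Sys.ma (cc r j0) := by
    rintro j t (rfl | rfl | ht) h
    · rw [P_neg, ix_pl] at h
      have h1 := ma_inj h
      have h2 := cc_idx h1
      rw [h2] at h1; exact absurd h1.symm hne
    · rw [P_pos, ix_pl] at h
      exact absurd h.symm ma_ne_mb
    · rw [P_mid Q _ ht] at h ⊢; exact h
  rw [ix_F] at h ⊢
  unfold QB at ht
  split_ifs at ht h ⊢
  · exact key _ _ ht h
  · exact key _ _ ht h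

lemma cnt {r r' : ℕ → Bool} (hr : r ≠ r') (hX : Red X D) {C : Set ℚ} (hC : C.OrdConnected)
    (hinf : (D ∩ C).Infinite) : ¬ Pre (Q.bl r X D C) (Q.bl r' X D C) := by
  intro hp
  obtain ⟨i, hi⟩ := Function.ne_iff.1 hr
  obtain ⟨l, hl, hli⟩ : ∃ l ∈ D ∩ C, i < (X l).2.1 := by
    by_contra hcon
    push Not at hcon
    exact hinf ((hX.1 i).subset (fun l hl => ⟨hl.1, hcon l hl⟩))
  set j0 := (X l).2.1 with hj0
  have hne : cc r j0 ≠ cc r' j0 := fun h => hi (cc_down h i hli)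
  have hR := Q.bl_red r hX hC
  have hR' := Q.bl_red r' hX hC
  obtain ⟨D0, hD0, h2⟩ := hp.rep hR'.1 rfl
  have : Nonempty (ℚ ×ₗ ℚ) := ⟨mkz 0 0⟩
  obtain ⟨e, he, him, hf⟩ := red_unique hR (hR'.inter hD0.ordConnected) h2.symm
  set T : Set (ℚ ×ₗ ℚ) := {z ∈ Q.UA X D ∩ bb ⁻¹' C | ix (Q.U r X z) = Sys.ma (cc r j0)} with hT
  set T' : Set (ℚ ×ₗ ℚ) := {z ∈ Q.UA X D ∩ bb ⁻¹' C | ix (Q.U r' X z) = Sys.ma (cc r j0)} with hT'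
  have hTf : T.Finite := by
    refine (hR.1 (Sys.ma (cc r j0) : ι × ℕ).2).subset ?_
    rintro z ⟨hz, h⟩
    exact ⟨hz, (congrArg Prod.snd h).le⟩
  have hss : T' ⊂ T := by
    refine ⟨fun z hz => ⟨hz.1, Q.ix_lost hne hz.1.1.2 hz.2⟩, ?_⟩
    intro hsub
    obtain ⟨t, ht, htt⟩ : ∃ t ∈ Q.QB (X l), ix (Q.F r (X l) t) = Sys.ma (cc r j0) ∧
        ix (Q.F r' (X l) t) = Sys.ma (cc r' j0) := by
      cases hb : (X l).2.2
      · refine ⟨1, Q.pos_QB _, ?_, ?_⟩ <;> rw [ix_F] <;> simp [hb]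
        · rfl
        · rfl
      · refine ⟨-1, Q.neg_QB _, ?_, ?_⟩ <;> rw [ix_F] <;> simp [hb]
        · rfl
        · rfl
    have hm : mkz l t ∈ T := ⟨⟨⟨hl.1, ht⟩, hl.2⟩, htt.1⟩
    have hm' : ix (Q.F r' (X l) t) = Sys.ma (cc r j0) := (hsub hm).2
    rw [htt.2] at hm'
    exact hne (ma_inj hm').symm
  have hin : e '' T ⊆ T' := by
    rintro _ ⟨z, hz, rfl⟩
    have : e z ∈ Q.UA X D ∩ bb ⁻¹' C ∩ D0 := by rw [← him]; exact ⟨z, hz.1, rfl⟩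
    refine ⟨this.1, ?_⟩
    rw [hf z hz.1]; exact hz.2
  have h3 : (e '' T).ncard = T.ncard := ncard_image_of_injOn (he.injOn.mono (fun z hz => hz.1))
  have h4 := ncard_lt_ncard hss hTf
  have h5 := ncard_le_ncard hin (hTf.subset hss.1)
  omega

lemma cmp {L : Type} [LinearOrder L] [Nonempty L] {f : L → ι × ℕ × Bool} {A : Set L} (hA : Red f A)
    (hX : Red X D) {C' : Set ℚ} (hC' : C'.OrdConnected) {C : Set L} (hC : C.OrdConnected)
    (h : Q.bl r X D C' = el f (A ∩ C)) {q : ℚ} (hq : q ∈ D ∩ C') :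
    ∃ p, Pre (Q.bl r X D (C' ∩ Ioi q)) (el f (A ∩ Ioi p)) := by
  obtain ⟨e, he, him, hf⟩ := red_unique (Q.bl_red r hX hC') (hA.inter hC) h
  set z := mkz q 1 with hz
  have hzm : z ∈ Q.UA X D ∩ bb ⁻¹' C' := ⟨⟨hq.1, Q.pos_QB _⟩, hq.2⟩
  have hez : e z ∈ A ∩ C := by rw [← him]; exact ⟨z, hzm, rfl⟩
  refine ⟨e z, ?_⟩
  have hsub : Q.UA X D ∩ bb ⁻¹' (C' ∩ Ioi q) ⊆ Q.UA X D ∩ bb ⁻¹' C' := fun w hw => ⟨hw.1, hw.2.1⟩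
  have hset : A ∩ Ioi (e z) ∩ {i | ∃ j ∈ C, i ≤ j} = e '' (Q.UA X D ∩ bb ⁻¹' (C' ∩ Ioi q)) := by
    ext i; constructor
    · rintro ⟨⟨h1, h2⟩, j, h3, h4⟩
      have : i ∈ A ∩ C := ⟨h1, hC.out hez.2 h3 ⟨le_of_lt h2, h4⟩⟩
      rw [← him] at this
      obtain ⟨w, hw, rfl⟩ := this
      refine ⟨w, ⟨hw.1, hw.2, ?_⟩, rfl⟩
      have hlt : z < w := (he.lt_iff_lt hzm hw).1 h2
      rcases lex_lt.1 hlt with h | ⟨_, h⟩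
      · exact h
      · exact absurd (Q.tt_bd hw.1).2 (not_le.2 h)
    · rintro ⟨w, hw, rfl⟩
      have : e w ∈ A ∩ C := by rw [← him]; exact ⟨w, hsub hw, rfl⟩
      exact ⟨⟨this.1, (he.lt_iff_lt hzm (hsub hw)).2 (lex_lt.2 (Or.inl hw.2.2))⟩, _, this.2, le_rfl⟩
  have hlow : IsLowerSet {i | ∃ j ∈ C, i ≤ j} := by
    rintro i j hij ⟨k, hk, h⟩; exact ⟨k, hk, hij.trans h⟩
  have := pre_of_red (hA.inter (ordConnected_Ioi (a := e z))) hlow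
  rw [hset, el_image ((Q.U_LF r hX.1).mono inter_subset_left) (he.mono hsub)
    (fun w hw => hf w (hsub hw))] at this
  exact this

/-- tails of the words in the set -/
def tl (a : wordGroup ι) (s : Bool) (p : ℚ) : wordGroup ι :=
  if s then el (rw_f a) (rw_A a ∩ Ioi p) else el (dl (rw_f a)) (dS (rw_A a) ∩ Ioi (OrderDual.toDual p))

theorem generic (hX : Red X D)
    (hH : ∀ C : Set ℚ, C.OrdConnected → (D ∩ C).Infinite → ∃ q ∈ D ∩ C, (D ∩ (C ∩ Ioi q)).Infinite)
    {κ : Cardinal.{0}} (hκ : κ < 𝔠) {S : Subgroup (wordGroup ι)} (hS : Small κ S) :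
    ∃ r : ℕ → Bool, ∀ C : Set ℚ, C.OrdConnected → (D ∩ C).Infinite → Q.bl r X D C ∉ S := by
  obtain ⟨A, hA, hle⟩ := hS
  by_contra hcon
  push Not at hcon
  have key : ∀ r : ℕ → Bool, ∃ d : A × Bool × ℚ × ℚ, ∃ C : Set ℚ, C.OrdConnected ∧
      d.2.2.1 ∈ D ∩ C ∧ (D ∩ (C ∩ Ioi d.2.2.1)).Infinite ∧
      Pre (Q.bl r X D (C ∩ Ioi d.2.2.1)) (tl d.1.1 d.2.1 d.2.2.2) := by
    intro r
    obtain ⟨C, hC, hinf, hmem⟩ := hcon r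
    obtain ⟨C', hC', hinf', hf⟩ := Q.bl_fac r hX
      (closure_val Fac_inv Fac_pre (small_le_Fac (hle hmem))) C 1 hC hinf (pre_one _) (by simp)
    obtain ⟨q, hq, hqi⟩ := hH C' hC' hinf'
    rcases hf with hf | ⟨a, ha, E, hE, hf | hf⟩
    · exact absurd hf (Q.not_mono r hX hC' hinf'.nonempty)
    · obtain ⟨p, hp⟩ := Q.cmp r (rw_red a) hX hC' hE hf hq
      exact ⟨(⟨a, ha⟩, true, q, p), C', hC', hq, hqi, by simpa [tl] using hp⟩
    · rw [inv_eq_iff_eq_inv, ← el_dual ((rw_red a).1.mono inter_subset_left)] at hf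
      have e : dS (rw_A a ∩ E) = dS (rw_A a) ∩ dS E := rfl
      rw [e] at hf
      obtain ⟨p, hp⟩ := Q.cmp r (rw_red a).dual hX hC' (by exact hE.dual) hf hq
      exact ⟨(⟨a, ha⟩, false, q, OrderDual.ofDual p), C', hC', hq, hqi, by simpa [tl] using hp⟩
  choose β C hC hq hinf hp using key
  have hinj : Function.Injective β := by
    intro r r' h
    by_contra hne
    have hq' := hq r'
    have hinf' := hinf r'
    have hp' := hp r'
    rw [← h] at hq' hinf' hp'
    have hq1 := hq r
    have hinf1 := hinf r
    have hp1 := hp r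
    set q := (β r).2.2.1
    have main : ∀ (r r' : ℕ → Bool) (C C' : Set ℚ) (g : wordGroup ι), r ≠ r' → C.OrdConnected → C'.OrdConnected →
        q ∈ C → q ∈ C' → (D ∩ (C ∩ Ioi q)).Infinite → C ∩ Ioi q ⊆ C' →
        Pre (Q.bl r X D (C ∩ Ioi q)) g → Pre (Q.bl r' X D (C' ∩ Ioi q)) g → False := by
      intro r r' C C' g hne hC hC' hq hq' hinf hsub h1 h2
      have hlow : IsLowerSet {i | ∃ j ∈ C, i ≤ j} := by
        rintro i j hij ⟨k, hk, h⟩; exact ⟨k, hk, hij.trans h⟩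
      have h3 := pre_of_red (Q.bl_red r' hX (hC'.inter (ordConnected_Ioi (a := q)))) (hlow.preimage bb_mono)
      have e : Q.UA X D ∩ bb ⁻¹' (C' ∩ Ioi q) ∩ bb ⁻¹' {i | ∃ j ∈ C, i ≤ j} =
          Q.UA X D ∩ bb ⁻¹' (C ∩ Ioi q) := by
        ext z; constructor
        · rintro ⟨⟨a, b, c⟩, j, d, e⟩
          exact ⟨a, hC.out hq d ⟨le_of_lt c, e⟩, c⟩
        · rintro ⟨a, b, c⟩
          exact ⟨⟨a, hsub ⟨b, c⟩, c⟩, _, b, le_rfl⟩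
      rw [e] at h3
      have h4 : Pre (Q.bl r' X D (C ∩ Ioi q)) g := Pre.trans h3 h2
      rcases h1.total h4 with h5 | h5
      · exact Q.cnt hne hX (hC.inter ordConnected_Ioi) hinf h5
      · exact Q.cnt hne.symm hX (hC.inter ordConnected_Ioi) hinf h5
    by_cases hsub : C r ∩ Ioi q ⊆ C r'
    · exact main r r' _ _ _ hne (hC r) (hC r') hq1.2 hq'.2 hinf1 hsub hp1 hp'
    · refine main r' r _ _ _ (Ne.symm hne) (hC r') (hC r) hq'.2 hq1.2 hinf' ?_ hp' hp1
      obtain ⟨x, hx, hx'⟩ := not_subset.1 hsub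
      intro y hy
      by_cases hyx : y ≤ x
      · exact (hC r).out hq1.2 hx.1 ⟨le_of_lt hy.2, hyx⟩
      · exact absurd ((hC r').out hq'.2 hy.1 ⟨le_of_lt hx.2, (not_le.1 hyx).le⟩) hx'
  have h1 := Cardinal.mk_le_of_injective hinj
  have h2 : #(ℕ → Bool) = 𝔠 := by simp
  have h3 : #(A × Bool × ℚ × ℚ) ≤ max κ ℵ₀ := by
    have h4 : #(Bool × ℚ × ℚ) ≤ ℵ₀ := Cardinal.mk_le_aleph0
    calc #(A × Bool × ℚ × ℚ) = #A * #(Bool × ℚ × ℚ) := by simp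
      _ ≤ max κ ℵ₀ * max κ ℵ₀ := mul_le_mul' (hA.trans (le_max_left _ _)) (h4.trans (le_max_right _ _))
      _ = max κ ℵ₀ := Cardinal.mul_eq_self (le_max_right _ _)
  rw [h2] at h1
  exact absurd (h1.trans h3) (not_le.2 (max_lt hκ Cardinal.aleph0_lt_continuum))

end Pcs

end GW

end

set_option linter.all false

noncomputable section

namespace GW

open Set GriffithsWords Cardinal

section omega
variable {ι ι' : Type} [Sys ι] [Sys ι']

lemma small_sup {κ : Cardinal.{0}} (hκ : ℵ₀ ≤ κ) {Γ : Subgroup (wordGroup ι × wordGroup ι')}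
    (hS : Small κ (dm Γ)) {P : Set (wordGroup ι × wordGroup ι')} (a0 : wordGroup ι)
    (hP : ∀ p ∈ P, p.1 ∈ Subgroup.closure ({g | Mono g} ∪ {x | Pre x a0})) :
    Small κ (dm (Γ ⊔ Subgroup.closure P)) := by
  obtain ⟨A, hA, hle⟩ := hS
  refine ⟨insert a0 A, (mk_insert_le).trans (add_le_of_le hκ hA (one_le_aleph0.trans hκ)), ?_⟩
  set K := Subgroup.closure ({g : wordGroup ι | Mono g} ∪ {x | ∃ a ∈ insert a0 A, Pre x a})
  have h1 : Γ ⊔ Subgroup.closure P ≤ K.comap (MonoidHom.fst _ _) := by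
    rw [sup_le_iff, Subgroup.closure_le]
    constructor
    · rintro ⟨g, s⟩ h
      have := hle (mem_dm.2 ⟨s, h⟩)
      refine Subgroup.closure_mono ?_ this
      rintro x (hx | ⟨a, ha, hx⟩)
      · exact Or.inl hx
      · exact Or.inr ⟨a, Or.inr ha, hx⟩
    · intro p hp
      refine Subgroup.closure_mono ?_ (hP p hp)
      rintro x (hx | hx)
      · exact Or.inl hx
      · exact Or.inr ⟨a0, Or.inl rfl, hx⟩
  intro g hg
  obtain ⟨s, hs⟩ := mem_dm.1 hg
  exact h1 hs

lemma mono_lt1 (c : ι × ℕ × Bool) : Mono (lt1 c) :=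
  mono_el (LF_fin finite_univ) (lcol c) (fun _ _ => rfl)

lemma el_finite_mem {L : Type} [LinearOrder L] {S : Subgroup (wordGroup ι)}
    (hm : ∀ m, Mono m → m ∈ S) (f : L → ι × ℕ × Bool) {A : Set L} (hA : A.Finite) :
    el f A ∈ S := by
  refine finset_ind (p := fun A => el f A ∈ S) hA ?_ ?_
  · show el f ∅ ∈ S
    rw [el_empty]; exact S.one_mem
  · intro a s hs hlt ih
    show el f (insert a s) ∈ S
    have : insert a s = s ∪ {a} := by ext; simp [or_comm]
    rw [this, el_union (LF_fin hs) (LF_fin (finite_singleton a))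
      (fun x hx y hy => by rw [mem_singleton_iff.1 hy]; exact hlt x hx), el_single]
    exact S.mul_mem ih (hm _ (mono_lt1 _))

/-- empty pieces -/
def Pcs0 (ι : Type) [Sys ι] : Pcs ι where
  s := fun _ _ => (default, 0, true)
  B := fun _ => ∅
  sub := fun j => empty_subset _
  red := fun j => ⟨LF_empty _, fun C _ _ => by simp⟩
  hlev := fun j t h => absurd h (by simp)

/-- the natural word -/
def X0 (q : ℚ) : Unit × ℕ × Bool := ((), ⌊q⌋.toNat, true)

/-- its domain -/
def D0 : Set ℚ := range (fun n : ℕ => (n : ℚ))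

lemma X0_nat (n : ℕ) : X0 (n : ℚ) = ((), n, true) := by
  simp [X0]

lemma D0_fin (q : ℚ) : (D0 ∩ Iic q).Finite := by
  refine ((finite_Iic (⌊q⌋.toNat)).image (fun n : ℕ => (n : ℚ))).subset ?_
  rintro _ ⟨⟨n, rfl⟩, h⟩
  refine ⟨n, ?_, rfl⟩
  have h1 : (n : ℚ) ≤ q := h
  have : (n : ℤ) ≤ ⌊q⌋ := Int.le_floor.2 (by exact_mod_cast h1)
  simp only [mem_Iic]; omega

lemma X0_red : Red X0 D0 := by
  have hLF : LF X0 D0 := by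
    intro N
    refine (D0_fin N).subset ?_
    rintro _ ⟨⟨n, rfl⟩, h⟩
    refine ⟨⟨n, rfl⟩, ?_⟩
    simp only [X0_nat] at h
    simp only [mem_Iic]
    exact_mod_cast h
  refine ⟨hLF, ?_⟩
  intro C hC h
  by_contra hne
  obtain ⟨i, hi⟩ := nonempty_iff_ne_empty.2 hne
  obtain ⟨p, hp, q, hq, hpq, h1, h2, h3⟩ := fp_el (fun x => x = ((X0 i).1, (X0 i).2.1))
    (K := (X0 i).2.1) (fun x hx => by rw [hx]) (hLF.mono inter_subset_left) h ⟨i, hi, rfl⟩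
  have := congrArg (fun c => c.2.2) h2
  simp [X0, linv] at this

lemma exists_omega {κ : Cardinal.{0}} (hκ : κ < 𝔠) {S : Subgroup (wordGroup ι)}
    (hS : Small κ S) (hm : ∀ m, Mono m → m ∈ S) : ∃ T, OmegaType S T := by
  obtain ⟨r, hr⟩ := (Pcs0 ι).generic X0_red (by
    intro C hC hinf
    obtain ⟨q, hq⟩ := hinf.nonempty
    refine ⟨q, hq, ?_⟩
    intro hfin
    apply hinf
    refine (hfin.union (D0_fin q)).subset ?_
    rintro x ⟨hx1, hx2⟩
    by_cases h : x ≤ q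
    · exact Or.inr ⟨hx1, h⟩
    · exact Or.inl ⟨hx1, hx2, not_le.1 h⟩) hκ hS
  refine ⟨(Pcs0 ι).bl r X0 D0 Set.univ, hr _ ordConnected_univ ?_, ?_⟩
  · rw [inter_univ]
    exact infinite_range_of_injective Nat.cast_injective
  · intro x hx hne
    have hred := (Pcs0 ι).U_red r X0_red
    obtain ⟨E, hE, rfl⟩ := hx.rep hred.1 (by simp [Pcs.bl])
    by_cases hsub : (Pcs0 ι).UA X0 D0 ⊆ E
    · exact absurd (by rw [inter_eq_left.2 hsub]; simp [Pcs.bl]) hne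
    · obtain ⟨z, hz, hzE⟩ := not_subset.1 hsub
      apply el_finite_mem hm
      have hfin : (⋃ l ∈ D0 ∩ Iic (bb z), mkz l '' ({-1, 1} : Set ℚ)).Finite :=
        (D0_fin _).biUnion (fun l _ => ((finite_singleton _).insert _).image _)
      refine hfin.subset ?_
      rintro w ⟨hw, hwE⟩
      simp only [mem_iUnion]
      refine ⟨bb w, ⟨hw.1, ?_⟩, tt w, ?_, rfl⟩
      · have : w ≤ z := by
          by_contra hc
          exact hzE (hE (not_le.1 hc).le hwE)
        exact bb_mono this
      · have := hw.2
        simpa [Pcs.QB, Pcs.PB, Pcs0, X0, tt] using this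

theorem omega_step {κ : Cardinal.{0}} (h0 : ℵ₀ ≤ κ) (hκ : κ < 𝔠)
    {Γ : Subgroup (wordGroup ι × wordGroup ι')} (hΓ : Stage κ Γ) {T : wordGroup ι}
    (hT : OmegaType (dm Γ) T) :
    ∃ Γ₁, Γ ≤ Γ₁ ∧ Stage κ Γ₁ ∧ T ∈ dm Γ₁ := by
  obtain ⟨T', hT'⟩ := exists_omega hκ hΓ.s2 (fun m hm => mem_dm.2 ⟨1, hΓ.m2 m hm⟩)
  have e : (Prod.swap ⁻¹' {(T, T')} : Set (wordGroup ι' × wordGroup ι)) = {(T', T)} := by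
    ext ⟨a, b⟩; simp [and_comm]
  refine ⟨Γ ⊔ Subgroup.closure {(T, T')}, le_sup_left, ⟨half_omega hΓ.h1 hΓ.m1 hT T', ?_,
    ?_, ?_, fun m hm => ?_, fun m hm => ?_⟩, ?_⟩
  · rw [sw_sup_closure, e]
    exact half_omega hΓ.h2 hΓ.m2 hT' T
  · refine small_sup h0 hΓ.s1 T ?_
    rintro p rfl
    exact Subgroup.subset_closure (Or.inr (pre_refl T))
  · rw [sw_sup_closure, e]
    refine small_sup h0 hΓ.s2 T' ?_
    rintro p rfl
    exact Subgroup.subset_closure (Or.inr (pre_refl T'))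
  · exact (le_sup_left : Γ ≤ _) (hΓ.m1 m hm)
  · exact (le_sup_left : Γ ≤ _) (hΓ.m2 m hm)
  · exact mem_dm.2 ⟨T', (le_sup_right : _ ≤ Γ ⊔ _) (Subgroup.subset_closure rfl)⟩

end omega

end GW

end

set_option linter.all false

noncomputable section

namespace GW

open Set GriffithsWords Cardinal

section dense
variable {ι ι' : Type} [Sys ι] [Sys ι']
variable {L M L1 L2 M1 M2 L1' L2' : Type} [LinearOrder L] [LinearOrder M] [LinearOrder L1]
  [LinearOrder L2] [LinearOrder M1] [LinearOrder M2] [LinearOrder L1'] [LinearOrder L2']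

/-- prefix-closed subgroup -/
def PCl (S : Subgroup (wordGroup ι)) : Prop := ∀ g x, g ∈ S → Pre x g → x ∈ S

lemma PCl.tail {S : Subgroup (wordGroup ι)} (hS : PCl S) {g x : wordGroup ι} (hg : g ∈ S)
    (hx : Pre x g) : x⁻¹ * g ∈ S := S.mul_mem (S.inv_mem (hS g x hg hx)) hg

lemma fac_mem {S : Subgroup (wordGroup ι)} (hS : PCl S) {f : L → ι × ℕ × Bool} {A : Set L}
    (hA : Red f A) (h : el f A ∈ S) {C : Set L} (hC : C.OrdConnected) : el f (A ∩ C) ∈ S := by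
  set D1 : Set L := {x | ∃ c ∈ C, x ≤ c}
  set D2 : Set L := {x | ∀ c ∈ C, x < c}
  have h1 : IsLowerSet D1 := by rintro x y hxy ⟨c, hc, h⟩; exact ⟨c, hc, hxy.trans h⟩
  have h2 : IsLowerSet D2 := by intro x y hxy h c hc; exact hxy.trans_lt (h c hc)
  have a1 : el f (A ∩ D1) ∈ S := hS _ _ h (pre_of_red hA h1)
  have hr := hA.inter h1.ordConnected
  have a2 : el f (A ∩ D1 ∩ D2ᶜ) ∈ S := by
    have := hS.tail a1 (pre_of_red hr h2)
    rwa [el_split hr.1 h2, inv_mul_cancel_left] at this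
  have e : A ∩ D1 ∩ D2ᶜ = A ∩ C := by
    ext x; constructor
    · rintro ⟨⟨h1, c, hc, hxc⟩, h3⟩
      simp only [D2, mem_compl_iff, mem_setOf_eq, not_forall, not_lt] at h3
      obtain ⟨d, hd, hdx⟩ := h3
      exact ⟨h1, hC.out hd hc ⟨hdx, hxc⟩⟩
    · rintro ⟨h1, h2⟩
      exact ⟨⟨h1, x, h2, le_rfl⟩, fun h => absurd (h x h2) (lt_irrefl x)⟩
  rwa [e] at a2

/-- open elements -/
structure Opn (S : Subgroup (wordGroup ι)) (o : wordGroup ι) : Prop where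
  ne : o ≠ 1
  pr : ∀ x, Pre x o → x ∈ S → x = 1
  su : ∀ x, Pre x o → x⁻¹ * o ∈ S → x = o

lemma Opn.not_mem {S : Subgroup (wordGroup ι)} {o : wordGroup ι} (h : Opn S o) : o ∉ S :=
  fun ho => h.ne (h.pr o (pre_refl o) ho)

lemma Opn.inv {S : Subgroup (wordGroup ι)} {o : wordGroup ι} (h : Opn S o) : Opn S o⁻¹ := by
  refine ⟨fun e => h.ne (by simpa using e), ?_, ?_⟩
  · intro x hx hxS
    have h1 := hx.inv
    rw [inv_inv] at h1
    have := h.su _ h1 (by simpa using S.inv_mem hxS)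
    simpa using this
  · intro x hx hxS
    have h1 := hx.inv
    rw [inv_inv] at h1
    have := h.pr _ h1 (by simpa using S.inv_mem hxS)
    exact eq_inv_of_mul_eq_one_right this

lemma opn_not_mem {S : Subgroup (wordGroup ι)} (hS : PCl S) {p o p' : wordGroup ι} (ho : Opn S o)
    (h1 : Pre p (p * (o * p'))) (h2 : Pre o (o * p')) : p * (o * p') ∉ S := by
  intro h
  have := hS.tail h h1
  rw [inv_mul_cancel_left] at this
  exact ho.not_mem (hS _ _ this h2)

lemma opn_uniq {S : Subgroup (wordGroup ι)} (hS : PCl S) {p o p' q o2 q' : wordGroup ι}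
    (ho : Opn S o) (ho2 : Opn S o2) (hp : p ∈ S) (hp' : p' ∈ S) (hq : q ∈ S) (hq' : q' ∈ S)
    (h1 : Pre p (p * (o * p'))) (h2 : Pre o (o * p')) (h3 : Pre q (q * (o2 * q')))
    (h4 : Pre o2 (o2 * q')) (e : p * (o * p') = q * (o2 * q')) : p = q ∧ o = o2 ∧ p' = q' := by
  have key : ∀ {p o p' q o2 q' : wordGroup ι}, Opn S o → q ∈ S → Pre p (p * (o * p')) →
      Pre o (o * p') → Pre q (q * (o2 * q')) → p * (o * p') = q * (o2 * q') → Pre p q → p = q := by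
    intro p o p' q o2 q' ho hq h1 h2 h3 e hpq
    have a1 := hpq.tail h3
    rw [← e, inv_mul_cancel_left] at a1
    have a2 := hS.tail hq hpq
    rcases a1.total h2 with h | h
    · have := ho.pr _ h a2
      exact inv_mul_eq_one.1 this
    · exact absurd (hS _ _ a2 h) ho.not_mem
  have hpq : p = q := by
    rw [← e] at h3
    rcases h1.total h3 with h | h
    · rw [e] at h3
      exact key ho hq h1 h2 h3 e h
    · rw [e] at h3
      exact (key ho2 hp h3 h4 h1 e.symm h).symm
  subst hpq
  have e' := mul_left_cancel e
  have key2 : ∀ {o p' o2 q' : wordGroup ι}, Opn S o2 → p' ∈ S →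
      Pre o (o * p') → Pre o2 (o2 * q') → o * p' = o2 * q' → Pre o o2 → o = o2 := by
    intro o p' o2 q' ho2 hp' h2 h4 e h
    have a1 := h.tail h4
    rw [← e, inv_mul_cancel_left] at a1
    exact ho2.su _ h (hS _ _ hp' a1)
  have hoo : o = o2 := by
    rw [← e'] at h4
    rcases h2.total h4 with h | h
    · rw [e'] at h4
      exact key2 ho2 hp' h2 h4 e' h
    · rw [e'] at h4
      exact (key2 ho hq' h4 h2 e'.symm h).symm
  subst hoo
  exact ⟨rfl, rfl, mul_left_cancel e'⟩

/-- block words -/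
structure BW (S : Subgroup (wordGroup ι)) (f : L → ι × ℕ × Bool) (A : Set L) (b : L → M) : Prop where
  red : Red f A
  mono : Monotone b
  ce : ∀ p ∈ A, ∀ q ∈ A, p ≤ q → (el f (A ∩ Icc p q) ∈ S ↔ b p = b q)

lemma BW.restrict {S : Subgroup (wordGroup ι)} {f : L → ι × ℕ × Bool} {A : Set L} {b : L → M}
    (h : BW S f A b) {C : Set M} (hC : C.OrdConnected) : BW S f (A ∩ b ⁻¹' C) b := by
  have hC' := hC.preimage_mono h.mono
  refine ⟨h.red.inter hC', h.mono, ?_⟩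
  rintro p hp q hq hpq
  have : A ∩ b ⁻¹' C ∩ Icc p q = A ∩ Icc p q := by
    ext x; constructor
    · rintro ⟨⟨h1, _⟩, h2⟩; exact ⟨h1, h2⟩
    · rintro ⟨h1, h2⟩; exact ⟨⟨h1, hC'.out hp.2 hq.2 h2⟩, h2⟩
  rw [this]
  exact h.ce p hp.1 q hq.1 hpq

/-- dual block map -/
def db (b : L → M) : Lᵒᵈ → Mᵒᵈ := fun x => OrderDual.toDual (b (OrderDual.ofDual x))

lemma BW.dual {S : Subgroup (wordGroup ι)} {f : L → ι × ℕ × Bool} {A : Set L} {b : L → M}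
    (h : BW S f A b) : BW S (dl f) (dS A) (db b) := by
  refine ⟨h.red.dual, fun x y hxy => h.mono hxy, ?_⟩
  intro p hp q hq hpq
  have : dS A ∩ Icc p q = dS (A ∩ Icc (OrderDual.ofDual q) (OrderDual.ofDual p)) := by
    ext x; constructor
    · rintro ⟨h1, h2, h3⟩; exact ⟨h1, h3, h2⟩
    · rintro ⟨h1, h2, h3⟩; exact ⟨h1, h3, h2⟩
  rw [this, el_dual (h.red.1.mono inter_subset_left), S.inv_mem_iff]
  rw [h.ce (OrderDual.ofDual q) hq (OrderDual.ofDual p) hp hpq]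
  exact ⟨fun h => h.symm, fun h => h.symm⟩

lemma iso_blocks [Nonempty L2] {S : Subgroup (wordGroup ι)} {f1 : L1 → ι × ℕ × Bool} {A1 : Set L1}
    {b1 : L1 → M1}
    {f2 : L2 → ι × ℕ × Bool} {A2 : Set L2} {b2 : L2 → M2} (h1 : BW S f1 A1 b1) (h2 : BW S f2 A2 b2)
    (he : el f1 A1 = el f2 A2)
    {g1 : L1' → ι' × ℕ × Bool} {B1 : Set L1'} {c1 : L1' → M1} (k1 : LF g1 B1) (m1 : Monotone c1)
    (i1 : c1 '' B1 = b1 '' A1)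
    {g2 : L2' → ι' × ℕ × Bool} {B2 : Set L2'} {c2 : L2' → M2} (k2 : LF g2 B2) (m2 : Monotone c2)
    (i2 : c2 '' B2 = b2 '' A2)
    (hv : ∀ l1 ∈ b1 '' A1, ∀ l2 ∈ b2 '' A2, el f1 (A1 ∩ b1 ⁻¹' {l1}) = el f2 (A2 ∩ b2 ⁻¹' {l2}) →
      el g1 (B1 ∩ c1 ⁻¹' {l1}) = el g2 (B2 ∩ c2 ⁻¹' {l2})) : el g1 B1 = el g2 B2 := by
  classical
  by_cases hne : A1.Nonempty
  swap
  · have e1 : A1 = ∅ := not_nonempty_iff_eq_empty.1 hne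
    have e2 : A2 = ∅ := by
      have := h2.red.2 Set.univ ordConnected_univ (by rw [inter_univ, ← he, e1, el_empty])
      simpa using this
    rw [e1, image_empty, image_eq_empty] at i1
    rw [e2, image_empty, image_eq_empty] at i2
    rw [i1, i2, el_empty, el_empty]
  obtain ⟨e, hm, hi, hf⟩ := red_unique h1.red h2.red he
  have hmem : ∀ p ∈ A1, e p ∈ A2 := fun p hp => hi ▸ mem_image_of_mem e hp
  have hIcc : ∀ p ∈ A1, ∀ q ∈ A1, el f2 (A2 ∩ Icc (e p) (e q)) = el f1 (A1 ∩ Icc p q) := by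
    intro p hp q hq
    have : A2 ∩ Icc (e p) (e q) = e '' (A1 ∩ Icc p q) := by
      rw [← hi]
      ext x; constructor
      · rintro ⟨⟨y, hy, rfl⟩, h3, h4⟩
        exact ⟨y, ⟨hy, (hm.le_iff_le hp hy).1 h3, (hm.le_iff_le hy hq).1 h4⟩, rfl⟩
      · rintro ⟨y, ⟨hy, h3, h4⟩, rfl⟩
        exact ⟨⟨y, hy, rfl⟩, (hm.le_iff_le hp hy).2 h3, (hm.le_iff_le hy hq).2 h4⟩
    rw [this]
    exact el_image (h1.red.1.mono inter_subset_left) (hm.mono inter_subset_left)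
      (fun i hi => hf i hi.1)
  have hbb : ∀ p ∈ A1, ∀ q ∈ A1, b1 p = b1 q ↔ b2 (e p) = b2 (e q) := by
    have aux : ∀ p ∈ A1, ∀ q ∈ A1, p ≤ q → (b1 p = b1 q ↔ b2 (e p) = b2 (e q)) := by
      intro p hp q hq hpq
      rw [← h1.ce p hp q hq hpq, ← h2.ce _ (hmem p hp) _ (hmem q hq) ((hm.le_iff_le hp hq).2 hpq),
        hIcc p hp q hq]
    intro p hp q hq
    rcases le_total p q with h | h
    · exact aux p hp q hq h
    · rw [eq_comm, aux q hq p hp h, eq_comm]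
  obtain ⟨p0, hp0⟩ := hne
  have hex : ∀ l, ∃ p, l ∈ b1 '' A1 → p ∈ A1 ∧ b1 p = l := by
    intro l
    by_cases h : l ∈ b1 '' A1
    · obtain ⟨p, hp, h⟩ := h; exact ⟨p, fun _ => ⟨hp, h⟩⟩
    · exact ⟨p0, fun h' => absurd h' h⟩
  choose c hc using hex
  set ε : M1 → M2 := fun l => b2 (e (c l)) with hε
  have hεb : ∀ p ∈ A1, ε (b1 p) = b2 (e p) := by
    intro p hp
    obtain ⟨a1, a2⟩ := hc (b1 p) ⟨p, hp, rfl⟩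
    exact (hbb _ a1 _ hp).1 a2
  have hmono : StrictMonoOn ε (b1 '' A1) := by
    rintro _ ⟨p, hp, rfl⟩ _ ⟨q, hq, rfl⟩ hlt
    rw [hεb p hp, hεb q hq]
    have hpq : p < q := by
      by_contra hcon
      exact absurd (h1.mono (not_lt.1 hcon)) (not_le.2 hlt)
    refine lt_of_le_of_ne (h2.mono (hm hp hq hpq).le) ?_
    intro h
    exact hlt.ne ((hbb p hp q hq).2 h)
  have him : ε '' (b1 '' A1) = b2 '' A2 := by
    ext l; constructor
    · rintro ⟨_, ⟨p, hp, rfl⟩, rfl⟩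
      rw [hεb p hp]; exact ⟨_, hmem p hp, rfl⟩
    · rintro ⟨y, hy, rfl⟩
      rw [← hi] at hy
      obtain ⟨p, hp, rfl⟩ := hy
      exact ⟨_, ⟨p, hp, rfl⟩, hεb p hp⟩
  refine el_blocks_iso k1 (m1.monotoneOn _) k2 (m2.monotoneOn _) (e := ε) (by rw [i1]; exact hmono)
    (by rw [i1, him, i2]) ?_
  rw [i1]
  rintro _ ⟨p, hp, rfl⟩
  refine (hv _ ⟨p, hp, rfl⟩ _ ?_ ?_).symm
  · rw [hεb p hp]; exact ⟨_, hmem p hp, rfl⟩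
  · have : A2 ∩ b2 ⁻¹' {ε (b1 p)} = e '' (A1 ∩ b1 ⁻¹' {b1 p}) := by
      rw [← hi, hεb p hp]
      ext x; constructor
      · rintro ⟨⟨y, hy, rfl⟩, h3⟩
        exact ⟨y, ⟨hy, (hbb y hy p hp).2 h3⟩, rfl⟩
      · rintro ⟨y, ⟨hy, h3⟩, rfl⟩
        exact ⟨⟨y, hy, rfl⟩, (hbb y hy p hp).1 h3⟩
    rw [this]
    exact (el_image (h1.red.1.mono inter_subset_left) (hm.mono inter_subset_left)
      (fun i hi => hf i hi.1)).symm

end dense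

end GW

end

set_option linter.all false

noncomputable section

namespace GW

open Set GriffithsWords Cardinal

section dense
variable {ι ι' : Type} [Sys ι] [Sys ι']
variable {L L' : Type} [LinearOrder L] [LinearOrder L']

/-- open convex sets of blocks -/
structure Ops (D C : Set ℚ) : Prop where
  oc : C.OrdConnected
  ne : (D ∩ C).Nonempty
  nomin : ∀ l ∈ D ∩ C, ∃ m ∈ D ∩ C, m < l
  nomax : ∀ l ∈ D ∩ C, ∃ m ∈ D ∩ C, l < m

/-- product over a set of blocks -/
def blk (f : L → ι × ℕ × Bool) (A : Set L) (b : L → ℚ) (C : Set ℚ) : wordGroup ι :=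
  el f (A ∩ b ⁻¹' C)

lemma blk_split {f : L → ι × ℕ × Bool} {A : Set L} {b : L → ℚ} (hA : LF f A) (hb : Monotone b)
    (C : Set ℚ) {E : Set ℚ} (hE : IsLowerSet E) :
    blk f A b C = blk f A b (C ∩ E) * blk f A b (C ∩ Eᶜ) := by
  have := el_split (hA.mono (inter_subset_left (t := b ⁻¹' C))) (hE.preimage hb)
  rwa [inter_assoc, inter_assoc] at this

lemma blk_three {f : L → ι × ℕ × Bool} {A : Set L} {b : L → ℚ} (hA : LF f A) (hb : Monotone b)
    (C : Set ℚ) {l : ℚ} (hl : l ∈ C) :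
    blk f A b C = blk f A b (C ∩ Iio l) * blk f A b {l} * blk f A b (C ∩ Ioi l) := by
  rw [blk_split hA hb C (isLowerSet_Iio l), blk_split hA hb (C ∩ (Iio l)ᶜ) (isLowerSet_Iic l),
    ← mul_assoc]
  have e1 : C ∩ (Iio l)ᶜ ∩ Iic l = {l} := by
    ext x
    simp only [mem_inter_iff, mem_compl_iff, mem_Iio, mem_Iic, mem_singleton_iff, not_lt]
    constructor
    · rintro ⟨⟨_, h1⟩, h2⟩
      exact le_antisymm h2 h1
    · rintro rfl; exact ⟨⟨hl, le_rfl⟩, le_rfl⟩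
  have e2 : C ∩ (Iio l)ᶜ ∩ (Iic l)ᶜ = C ∩ Ioi l := by
    ext x
    simp only [mem_inter_iff, mem_compl_iff, mem_Iio, mem_Iic, mem_Ioi, not_lt, not_le]
    constructor
    · rintro ⟨⟨h, h1⟩, h2⟩
      exact ⟨h, h2⟩
    · rintro ⟨h, h1⟩; exact ⟨⟨h, le_of_lt h1⟩, h1⟩
  rw [e1, e2]

lemma blk_congr {f : L → ι × ℕ × Bool} {A : Set L} {b : L → ℚ} {C C' : Set ℚ}
    (h : b '' A ∩ C = b '' A ∩ C') : blk f A b C = blk f A b C' := by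
  have : A ∩ b ⁻¹' C = A ∩ b ⁻¹' C' := by
    ext x; constructor
    · rintro ⟨h1, h2⟩
      have : b x ∈ b '' A ∩ C := ⟨⟨x, h1, rfl⟩, h2⟩
      rw [h] at this; exact ⟨h1, this.2⟩
    · rintro ⟨h1, h2⟩
      have : b x ∈ b '' A ∩ C' := ⟨⟨x, h1, rfl⟩, h2⟩
      rw [← h] at this; exact ⟨h1, this.2⟩
  rw [blk, blk, this]

lemma blk_empty {f : L → ι × ℕ × Bool} {A : Set L} {b : L → ℚ} {C : Set ℚ}
    (h : b '' A ∩ C = ∅) : blk f A b C = 1 := by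
  have := blk_congr (f := f) (C := C) (C' := ∅) (by rw [h, inter_empty])
  rw [this, blk, preimage_empty, inter_empty, el_empty]

lemma BW.opn {S : Subgroup (wordGroup ι)} (hS : PCl S) {f : L → ι × ℕ × Bool} {A : Set L}
    {b : L → ℚ} (h : BW S f A b) {C : Set ℚ} (hC : Ops (b '' A) C) : Opn S (blk f A b C) := by
  have hr : Red f (A ∩ b ⁻¹' C) := h.red.inter (hC.oc.preimage_mono h.mono)
  have key : ∀ E : Set L, E.OrdConnected → el f (A ∩ b ⁻¹' C ∩ E) ∈ S →
      ∀ p ∈ A ∩ b ⁻¹' C ∩ E, ∀ q ∈ A ∩ b ⁻¹' C ∩ E, p ≤ q → b p = b q := by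
    intro E hE hEs p hp q hq hpq
    refine (h.ce p hp.1.1 q hq.1.1 hpq).1 ?_
    have := fac_mem hS (hr.inter hE) hEs (ordConnected_Icc (a := p) (b := q))
    have e : A ∩ b ⁻¹' C ∩ E ∩ Icc p q = A ∩ Icc p q := by
      ext x; constructor
      · rintro ⟨⟨⟨h1, _⟩, _⟩, h2⟩; exact ⟨h1, h2⟩
      · rintro ⟨h1, h2⟩
        exact ⟨⟨⟨h1, (hC.oc.preimage_mono h.mono).out hp.1.2 hq.1.2 h2⟩, hE.out hp.2 hq.2 h2⟩, h2⟩
    rwa [e] at this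
  refine ⟨?_, ?_, ?_⟩
  · intro h1
    have := h.red.2 _ (hC.oc.preimage_mono h.mono) h1
    obtain ⟨_, ⟨p, hp, rfl⟩, h2⟩ := hC.ne
    have h3 : p ∈ A ∩ b ⁻¹' C := ⟨hp, h2⟩
    rw [this] at h3; exact h3
  · intro x hx hxS
    obtain ⟨E, hE, rfl⟩ := hx.rep hr.1 rfl
    by_contra hne
    have hne' : (A ∩ b ⁻¹' C ∩ E).Nonempty := by
      rw [nonempty_iff_ne_empty]; intro h0; rw [h0, el_empty] at hne; exact hne rfl
    obtain ⟨p, hp⟩ := hne'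
    obtain ⟨_, ⟨⟨q, hq, rfl⟩, hqC⟩, hlt⟩ := hC.nomin (b p) ⟨⟨p, hp.1.1, rfl⟩, hp.1.2⟩
    have hqp : q < p := by
      by_contra hcon
      exact absurd (h.mono (not_lt.1 hcon)) (not_le.2 hlt)
    exact hlt.ne (key E hE.ordConnected hxS q ⟨⟨hq, hqC⟩, hE hqp.le hp.2⟩ p hp hqp.le)
  · intro x hx hxS
    obtain ⟨E, hE, rfl⟩ := hx.rep hr.1 rfl
    have e := el_split hr.1 hE
    by_contra hne
    have e' : (el f (A ∩ b ⁻¹' C ∩ E))⁻¹ * blk f A b C = el f (A ∩ b ⁻¹' C ∩ Eᶜ) := by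
      rw [blk, e, inv_mul_cancel_left]
    rw [e'] at hxS
    have hne' : (A ∩ b ⁻¹' C ∩ Eᶜ).Nonempty := by
      rw [nonempty_iff_ne_empty]; intro h0
      rw [h0, el_empty, mul_one] at e; exact hne e.symm
    obtain ⟨p, hp⟩ := hne'
    obtain ⟨_, ⟨⟨q, hq, rfl⟩, hqC⟩, hlt⟩ := hC.nomax (b p) ⟨⟨p, hp.1.1, rfl⟩, hp.1.2⟩
    have hqp : p < q := by
      by_contra hcon
      exact absurd (h.mono (not_lt.1 hcon)) (not_le.2 hlt)
    exact hlt.ne (key Eᶜ hE.compl.ordConnected hxS p hp q ⟨⟨hq, hqC⟩, hE.compl hqp.le hp.2⟩ hqp.le)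

/-- two block words related by a correspondence -/
structure Rel (Γ : Subgroup (wordGroup ι × wordGroup ι')) (f : L → ι × ℕ × Bool) (A : Set L)
    (b : L → ℚ) (f' : L' → ι' × ℕ × Bool) (A' : Set L') (b' : L' → ℚ) : Prop where
  bw : BW (dm Γ) f A b
  lf : LF f' A'
  mono : Monotone b'
  img : b' '' A' = b '' A
  mem : ∀ l ∈ b '' A, (blk f A b {l}, blk f' A' b' {l}) ∈ Γ
  feq : ∀ l ∈ b '' A, ∀ m ∈ b '' A, blk f A b {l} = blk f A b {m} → blk f' A' b' {l} = blk f' A' b' {m}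
  finv : ∀ l ∈ b '' A, ∀ m ∈ b '' A, blk f A b {l} = (blk f A b {m})⁻¹ →
    blk f' A' b' {l} = (blk f' A' b' {m})⁻¹
  den : ∀ l ∈ b '' A, ∀ m ∈ b '' A, l < m → ∃ n ∈ b '' A, l < n ∧ n < m

section rel
variable {Γ : Subgroup (wordGroup ι × wordGroup ι')} {f : L → ι × ℕ × Bool} {A : Set L}
    {b : L → ℚ} {f' : L' → ι' × ℕ × Bool} {A' : Set L'} {b' : L' → ℚ}

lemma restrict_img {C : Set ℚ} (R : Rel Γ f A b f' A' b') :
    b' '' (A' ∩ b' ⁻¹' C) = b '' (A ∩ b ⁻¹' C) := by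
  rw [image_inter_preimage, image_inter_preimage, R.img]

lemma restrict_blk {f : L → ι × ℕ × Bool} {A : Set L}
    {b : L → ℚ} {C : Set ℚ} {l : ℚ} (hl : l ∈ C) :
    A ∩ b ⁻¹' C ∩ b ⁻¹' {l} = A ∩ b ⁻¹' {l} := by
  ext x; constructor
  · rintro ⟨⟨h1, _⟩, h2⟩; exact ⟨h1, h2⟩
  · rintro ⟨h1, h2⟩
    refine ⟨⟨h1, ?_⟩, h2⟩
    have : b x = l := h2
    rw [mem_preimage, this]; exact hl

lemma Rel.eq (R : Rel Γ f A b f' A' b') {C1 C2 : Set ℚ} (h1 : C1.OrdConnected)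
    (h2 : C2.OrdConnected) (hne : (b '' A ∩ C2).Nonempty)
    (he : blk f A b C1 = blk f A b C2) : blk f' A' b' C1 = blk f' A' b' C2 := by
  haveI : Nonempty L := by obtain ⟨_, ⟨p, _, _⟩, _⟩ := hne; exact ⟨p⟩
  refine iso_blocks (R.bw.restrict h1) (R.bw.restrict h2) he (R.lf.mono inter_subset_left) R.mono
    (restrict_img R) (R.lf.mono inter_subset_left) R.mono (restrict_img R) ?_
  rintro l1 hl1 l2 hl2 h
  rw [image_inter_preimage] at hl1 hl2
  rw [restrict_blk (f := f) hl1.2, restrict_blk (f := f) hl2.2] at h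
  rw [restrict_blk (f := f') hl1.2, restrict_blk (f := f') hl2.2]
  exact R.feq _ hl1.1 _ hl2.1 h

lemma Rel.inv (R : Rel Γ f A b f' A' b') {C1 C2 : Set ℚ} (h1 : C1.OrdConnected)
    (h2 : C2.OrdConnected) (hne : (b '' A ∩ C2).Nonempty)
    (he : blk f A b C1 = (blk f A b C2)⁻¹) : blk f' A' b' C1 = (blk f' A' b' C2)⁻¹ := by
  haveI : Nonempty Lᵒᵈ := by obtain ⟨_, ⟨p, _, _⟩, _⟩ := hne; exact ⟨OrderDual.toDual p⟩
  have hl := (R.bw.restrict h2).red.1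
  have hl' : LF f' (A' ∩ b' ⁻¹' C2) := R.lf.mono inter_subset_left
  set A2 := A ∩ b ⁻¹' C2
  set A2' := A' ∩ b' ⁻¹' C2
  have key := iso_blocks (L1' := L') (L2' := L'ᵒᵈ) (M1 := ℚ) (M2 := ℚᵒᵈ) (R.bw.restrict h1) (R.bw.restrict h2).dual
    (g1 := f') (B1 := A' ∩ b' ⁻¹' C1) (c1 := b') (g2 := dl f') (B2 := dS A2') (c2 := db b')
    (by rw [el_dual hl]; exact he) (R.lf.mono inter_subset_left) R.mono
    (restrict_img R) hl'.dual (fun x y hxy => R.mono hxy) ?_ ?_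
  · rw [el_dual hl'] at key; exact key
  · have e1 : db b' '' dS A2' = dS (b' '' A2') := by
      rw [dS_eq, dS_eq, image_image, image_image]; rfl
    have e2 : db b '' dS A2 = dS (b '' A2) := by
      rw [dS_eq, dS_eq, image_image, image_image]; rfl
    rw [e1, e2, restrict_img R]
  · rintro l1 hl1 l2 hl2 h
    obtain ⟨p, hp, rfl⟩ := hl2
    set q := OrderDual.ofDual p with hq
    have e1 : dS A2 ∩ db b ⁻¹' {db b p} = dS (A ∩ b ⁻¹' {b q}) := by
      rw [← restrict_blk (f := f) (C := C2) (show b q ∈ C2 from hp.2)]; rfl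
    have e2 : dS A2' ∩ db b' ⁻¹' {db b p} = dS (A' ∩ b' ⁻¹' {b q}) := by
      rw [← restrict_blk (f := f') (C := C2) (show b q ∈ C2 from hp.2)]; rfl
    rw [image_inter_preimage] at hl1
    rw [restrict_blk (f := f) hl1.2, e1, el_dual (R.bw.red.1.mono inter_subset_left)] at h
    rw [restrict_blk (f := f') hl1.2, e2, el_dual (R.lf.mono inter_subset_left)]
    exact R.finv _ hl1.1 (b q) ⟨q, hp.1, rfl⟩ h

end rel

end dense

end GW

end

set_option linter.all false

noncomputable section

namespace GW

open Set GriffithsWords Cardinal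

section rel
variable {ι ι' : Type} [Sys ι] [Sys ι']
variable {L L' : Type} [LinearOrder L] [LinearOrder L']
variable {Γ : Subgroup (wordGroup ι × wordGroup ι')} {f : L → ι × ℕ × Bool} {A : Set L}
    {b : L → ℚ} {f' : L' → ι' × ℕ × Bool} {A' : Set L'} {b' : L' → ℚ}

lemma Half.pcl (H : Half Γ) : PCl (dm Γ) := fun g x hg hx => H.pre g x hg hx

/-- initial parts -/
def Rt (Γ : Subgroup (wordGroup ι × wordGroup ι')) (f : L → ι × ℕ × Bool) (A : Set L)
    (b : L → ℚ) (f' : L' → ι' × ℕ × Bool) (A' : Set L') (b' : L' → ℚ) (y : wordGroup ι)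
    (k : QQ ι') : Prop :=
  ph Γ y k ∨ ∃ C s k1, Ops (b '' A) C ∧ y = blk f A b C * s ∧ Pre (blk f A b C) y ∧ ph Γ s k1 ∧
    k = (blk f' A' b' C : QQ ι') * k1

/-- final parts -/
def Lf (Γ : Subgroup (wordGroup ι × wordGroup ι')) (f : L → ι × ℕ × Bool) (A : Set L)
    (b : L → ℚ) (f' : L' → ι' × ℕ × Bool) (A' : Set L') (b' : L' → ℚ) (y : wordGroup ι)
    (k : QQ ι') : Prop :=
  ph Γ y k ∨ ∃ C s k1, Ops (b '' A) C ∧ y = s * blk f A b C ∧ Pre s y ∧ ph Γ s k1 ∧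
    k = k1 * (blk f' A' b' C : QQ ι')

lemma split_o (H : Half Γ) (R : Rel Γ f A b f' A' b') {C : Set ℚ} (hC : Ops (b '' A) C)
    {y : wordGroup ι} (hy : Pre y (blk f A b C)) :
    ∃ k1 k2, Rt Γ f A b f' A' b' y k1 ∧ Lf Γ f A b f' A' b' (y⁻¹ * blk f A b C) k2 ∧
      (blk f' A' b' C : QQ ι') = k1 * k2 := by
  have hoc := hC.oc.preimage_mono R.bw.mono
  have hr : Red f (A ∩ b ⁻¹' C) := R.bw.red.inter hoc
  obtain ⟨E, hE, rfl⟩ := hy.rep hr.1 rfl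
  have hsp := el_split hr.1 hE
  have hrest : (el f (A ∩ b ⁻¹' C ∩ E))⁻¹ * blk f A b C = el f (A ∩ b ⁻¹' C ∩ Eᶜ) := by
    rw [blk, hsp, inv_mul_cancel_left]
  rw [hrest]
  by_cases hex : ∃ l0 ∈ b '' A ∩ C, (∀ p ∈ A ∩ b ⁻¹' C, b p < l0 → p ∈ E) ∧
      (∀ p ∈ A ∩ b ⁻¹' C, l0 < b p → p ∉ E)
  · obtain ⟨l0, hl0, hlo, hhi⟩ := hex
    have hr0 : Red f (A ∩ b ⁻¹' {l0}) := R.bw.red.inter (ordConnected_singleton.preimage_mono R.bw.mono)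
    have hph : ph Γ (blk f A b {l0}) (blk f' A' b' {l0} : QQ ι') := ⟨_, R.mem l0 hl0.1, rfl⟩
    have hp0 := pre_of_red hr0 hE
    obtain ⟨k1, k2, a1, a2, a3⟩ := H.splitph hph hp0
    have e0 : (el f (A ∩ b ⁻¹' {l0} ∩ E))⁻¹ * blk f A b {l0} = el f (A ∩ b ⁻¹' {l0} ∩ Eᶜ) := by
      rw [blk, el_split hr0.1 hE, inv_mul_cancel_left]
    rw [e0] at a2
    set C1 := C ∩ Iio l0
    set C2 := C ∩ Ioi l0
    have hC1 : Ops (b '' A) C1 := by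
      refine ⟨hC.oc.inter ordConnected_Iio, ?_, ?_, ?_⟩
      · obtain ⟨m, hm, hlt⟩ := hC.nomin l0 hl0
        exact ⟨m, hm.1, hm.2, hlt⟩
      · intro l hl
        obtain ⟨m, hm, hlt⟩ := hC.nomin l ⟨hl.1, hl.2.1⟩
        exact ⟨m, ⟨hm.1, hm.2, hlt.trans hl.2.2⟩, hlt⟩
      · intro l hl
        obtain ⟨n, hn, h1, h2⟩ := R.den l hl.1 l0 hl0.1 hl.2.2
        exact ⟨n, ⟨hn, hC.oc.out hl.2.1 hl0.2 ⟨h1.le, h2.le⟩, h2⟩, h1⟩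
    have hC2 : Ops (b '' A) C2 := by
      refine ⟨hC.oc.inter ordConnected_Ioi, ?_, ?_, ?_⟩
      · obtain ⟨m, hm, hlt⟩ := hC.nomax l0 hl0
        exact ⟨m, hm.1, hm.2, hlt⟩
      · intro l hl
        obtain ⟨n, hn, h1, h2⟩ := R.den l0 hl0.1 l hl.1 hl.2.2
        exact ⟨n, ⟨hn, hC.oc.out hl0.2 hl.2.1 ⟨h1.le, h2.le⟩, h1⟩, h2⟩
      · intro l hl
        obtain ⟨m, hm, hlt⟩ := hC.nomax l ⟨hl.1, hl.2.1⟩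
        exact ⟨m, ⟨hm.1, hm.2, lt_trans hl.2.2 hlt⟩, hlt⟩
    have s1 : A ∩ b ⁻¹' C ∩ E = (A ∩ b ⁻¹' C1) ∪ (A ∩ b ⁻¹' {l0} ∩ E) := by
      ext p; constructor
      · rintro ⟨hp, hpE⟩
        rcases lt_trichotomy (b p) l0 with h | h | h
        · exact Or.inl ⟨hp.1, hp.2, h⟩
        · exact Or.inr ⟨⟨hp.1, h⟩, hpE⟩
        · exact absurd hpE (hhi p hp h)
      · rintro (⟨h1, h2, h3⟩ | ⟨⟨h1, h2⟩, h3⟩)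
        · exact ⟨⟨h1, h2⟩, hlo p ⟨h1, h2⟩ h3⟩
        · refine ⟨⟨h1, ?_⟩, h3⟩
          have : b p = l0 := h2
          rw [mem_preimage, this]; exact hl0.2
    have s2 : A ∩ b ⁻¹' C ∩ Eᶜ = (A ∩ b ⁻¹' {l0} ∩ Eᶜ) ∪ (A ∩ b ⁻¹' C2) := by
      ext p; constructor
      · rintro ⟨hp, hpE⟩
        rcases lt_trichotomy (b p) l0 with h | h | h
        · exact absurd (hlo p hp h) hpE
        · exact Or.inl ⟨⟨hp.1, h⟩, hpE⟩
        · exact Or.inr ⟨hp.1, hp.2, h⟩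
      · rintro (⟨⟨h1, h2⟩, h3⟩ | ⟨h1, h2, h3⟩)
        · refine ⟨⟨h1, ?_⟩, h3⟩
          have : b p = l0 := h2
          rw [mem_preimage, this]; exact hl0.2
        · exact ⟨⟨h1, h2⟩, hhi p ⟨h1, h2⟩ h3⟩
    have lt_of : ∀ p q, b p < b q → p < q := by
      intro p q h
      by_contra hcon
      exact absurd (R.bw.mono (not_lt.1 hcon)) (not_le.2 h)
    have t1 : el f (A ∩ b ⁻¹' C ∩ E) = blk f A b C1 * el f (A ∩ b ⁻¹' {l0} ∩ E) := by
      rw [s1, el_union (R.bw.red.1.mono inter_subset_left) (hr0.1.mono inter_subset_left)]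
      · rfl
      · rintro p ⟨h1, h2, h3⟩ q ⟨⟨h4, h5⟩, h6⟩
        apply lt_of
        have : b q = l0 := h5
        rw [this]; exact h3
    have t2 : el f (A ∩ b ⁻¹' C ∩ Eᶜ) = el f (A ∩ b ⁻¹' {l0} ∩ Eᶜ) * blk f A b C2 := by
      rw [s2, el_union (hr0.1.mono inter_subset_left) (R.bw.red.1.mono inter_subset_left)]
      · rfl
      · rintro q ⟨⟨h4, h5⟩, h6⟩ p ⟨h1, h2, h3⟩
        apply lt_of
        have : b q = l0 := h5
        rw [this]; exact h3
    refine ⟨(blk f' A' b' C1 : QQ ι') * k1, k2 * (blk f' A' b' C2 : QQ ι'), Or.inr ⟨C1, _, k1, hC1, t1, ?_, a1, rfl⟩,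
      Or.inr ⟨C2, _, k2, hC2, t2, ?_, a2, rfl⟩, ?_⟩
    · have := pre_of_red (hr.inter hE.ordConnected) ((isLowerSet_Iio l0).preimage R.bw.mono)
      have e : A ∩ b ⁻¹' C ∩ E ∩ b ⁻¹' Iio l0 = A ∩ b ⁻¹' C1 := by
        ext p; constructor
        · rintro ⟨⟨⟨h1, h2⟩, h3⟩, h4⟩; exact ⟨h1, h2, h4⟩
        · rintro ⟨h1, h2, h3⟩; exact ⟨⟨⟨h1, h2⟩, hlo p ⟨h1, h2⟩ h3⟩, h3⟩
      rw [e] at this; exact this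
    · have := pre_of_red (hr.inter hE.compl.ordConnected) ((isLowerSet_Iic l0).preimage R.bw.mono)
      have e : A ∩ b ⁻¹' C ∩ Eᶜ ∩ b ⁻¹' Iic l0 = A ∩ b ⁻¹' {l0} ∩ Eᶜ := by
        rw [s2]
        ext p; constructor
        · rintro ⟨h | ⟨h1, h2, h3⟩, h4⟩
          · exact h
          · exact absurd (show b p ≤ l0 from h4) (not_le.2 h3)
        · rintro h
          refine ⟨Or.inl h, ?_⟩
          have : b p = l0 := h.1.2
          rw [mem_preimage, this]; exact mem_Iic.2 le_rfl
      rw [e] at this; exact this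
    · rw [blk_three R.lf R.mono C hl0.2, QuotientGroup.mk_mul, QuotientGroup.mk_mul, a3]
      simp only [mul_assoc]; rfl
  · push Not at hex
    set E' : Set ℚ := {c | ∃ p ∈ A ∩ b ⁻¹' C, p ∈ E ∧ c ≤ b p}
    have hE' : IsLowerSet E' := by
      rintro x z hxz ⟨p, hp, h1, h2⟩; exact ⟨p, hp, h1, hxz.trans h2⟩
    have nosplit : ∀ p ∈ A ∩ b ⁻¹' C, ∀ q ∈ A ∩ b ⁻¹' C, b p = b q → p ∈ E → q ∈ E := by
      intro p hp q hq hpq hpE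
      by_contra hqE
      obtain ⟨x, hx, h1, h2⟩ := hex (b p) ⟨⟨p, hp.1, rfl⟩, hp.2⟩ (by
        intro z hz hlt
        refine hE (le_of_lt ?_) hpE
        by_contra hcon
        exact absurd (R.bw.mono (not_lt.1 hcon)) (not_le.2 hlt))
      apply hqE
      refine hE (le_of_lt ?_) h2
      by_contra hcon
      have := R.bw.mono (not_lt.1 hcon)
      rw [← hpq] at this
      exact absurd this (not_le.2 h1)
    have memE' : ∀ p ∈ A ∩ b ⁻¹' C, b p ∈ E' ↔ p ∈ E := by
      intro p hp; constructor
      · rintro ⟨q, hq, h1, h2⟩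
        rcases h2.lt_or_eq with h | h
        · refine hE (le_of_lt ?_) h1
          by_contra hcon
          exact absurd (R.bw.mono (not_lt.1 hcon)) (not_le.2 h)
        · exact nosplit q hq p hp h.symm h1
      · intro h; exact ⟨p, hp, h, le_rfl⟩
    have s1 : A ∩ b ⁻¹' C ∩ E = A ∩ b ⁻¹' (C ∩ E') := by
      ext p; constructor
      · rintro ⟨hp, h⟩; exact ⟨hp.1, hp.2, (memE' p hp).2 h⟩
      · rintro ⟨h1, h2, h3⟩; exact ⟨⟨h1, h2⟩, (memE' p ⟨h1, h2⟩).1 h3⟩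
    have s2 : A ∩ b ⁻¹' C ∩ Eᶜ = A ∩ b ⁻¹' (C ∩ E'ᶜ) := by
      ext p; constructor
      · rintro ⟨hp, h⟩; exact ⟨hp.1, hp.2, fun h' => h ((memE' p hp).1 h')⟩
      · rintro ⟨h1, h2, h3⟩; exact ⟨⟨h1, h2⟩, fun h' => h3 ((memE' p ⟨h1, h2⟩).2 h')⟩
    rw [s1, s2]
    refine ⟨(blk f' A' b' (C ∩ E') : QQ ι'), (blk f' A' b' (C ∩ E'ᶜ) : QQ ι'), ?_, ?_, ?_⟩
    · by_cases hne : (b '' A ∩ (C ∩ E')).Nonempty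
      · refine Or.inr ⟨C ∩ E', 1, 1, ⟨hC.oc.inter hE'.ordConnected, hne, ?_, ?_⟩, by simp [blk], pre_refl _,
          ph_one, by simp⟩
        · intro l hl
          obtain ⟨m, hm, hlt⟩ := hC.nomin l ⟨hl.1, hl.2.1⟩
          exact ⟨m, ⟨hm.1, hm.2, hE' hlt.le hl.2.2⟩, hlt⟩
        · rintro l ⟨⟨p, hp, rfl⟩, hpC, hpE⟩
          rw [memE' p ⟨hp, hpC⟩] at hpE
          obtain ⟨x, hx, h1, h2⟩ := hex (b p) ⟨⟨p, hp, rfl⟩, hpC⟩ (by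
            intro z hz hlt
            refine hE (le_of_lt ?_) hpE
            by_contra hcon
            exact absurd (R.bw.mono (not_lt.1 hcon)) (not_le.2 hlt))
          exact ⟨b x, ⟨⟨x, hx.1, rfl⟩, hx.2, (memE' x hx).2 h2⟩, h1⟩
      · have h0 := not_nonempty_iff_eq_empty.1 hne
        left
        rw [blk_empty (by rw [R.img]; exact h0)]
        have := blk_empty (f := f) h0
        rw [blk] at this
        rw [this]; exact ph_one
    · by_cases hne : (b '' A ∩ (C ∩ E'ᶜ)).Nonempty
      · refine Or.inr ⟨C ∩ E'ᶜ, 1, 1, ⟨hC.oc.inter hE'.compl.ordConnected, hne, ?_, ?_⟩, by simp [blk], pre_one _,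
          ph_one, by simp⟩
        · rintro l ⟨⟨p, hp, rfl⟩, hpC, hpE⟩
          rw [mem_compl_iff, memE' p ⟨hp, hpC⟩] at hpE
          by_contra hcon
          push Not at hcon
          obtain ⟨x, hx, h1, h2⟩ := hex (b p) ⟨⟨p, hp, rfl⟩, hpC⟩ (by
            intro z hz hlt
            by_contra hzE
            exact absurd hlt (not_lt.2 (hcon (b z) ⟨⟨z, hz.1, rfl⟩, hz.2, fun h => hzE ((memE' z hz).1 h)⟩)))
          apply hpE
          refine hE (le_of_lt ?_) h2
          by_contra hcon
          exact absurd (R.bw.mono (not_lt.1 hcon)) (not_le.2 h1)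
        · intro l hl
          obtain ⟨m, hm, hlt⟩ := hC.nomax l ⟨hl.1, hl.2.1⟩
          exact ⟨m, ⟨hm.1, hm.2, hE'.compl hlt.le hl.2.2⟩, hlt⟩
      · have h0 := not_nonempty_iff_eq_empty.1 hne
        left
        rw [blk_empty (by rw [R.img]; exact h0)]
        have := blk_empty (f := f) h0
        rw [blk] at this
        rw [this]; exact ph_one
    · rw [blk_split R.lf R.mono C hE', QuotientGroup.mk_mul]

/-- pairs of blocks -/
def TT (f : L → ι × ℕ × Bool) (A : Set L)
    (b : L → ℚ) (f' : L' → ι' × ℕ × Bool) (A' : Set L') (b' : L' → ℚ) :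
    Set (wordGroup ι × wordGroup ι') :=
  {x | ∃ C, Ops (b '' A) C ∧ x = (blk f A b C, blk f' A' b' C)}

theorem half_dense (H : Half Γ) (R : Rel Γ f A b f' A' b') :
    Half (Γ ⊔ Subgroup.closure (TT f A b f' A' b')) := by
  set L0 : wordGroup ι → QQ ι' → Prop := fun g k => ph Γ g k ∨
    ∃ p p' C k1 k2, Ops (b '' A) C ∧ g = p * (blk f A b C * p') ∧ Pre p g ∧
      Pre (blk f A b C) (blk f A b C * p') ∧ ph Γ p k1 ∧ ph Γ p' k2 ∧
      k = k1 * (blk f' A' b' C : QQ ι') * k2 with hL0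
  have op : ∀ {C}, Ops (b '' A) C → Opn (dm Γ) (blk f A b C) := fun hC => R.bw.opn H.pcl hC
  have HL : IsLoc (symr L0) := by
    apply isLoc_symr
    · rintro g k k' (h | ⟨p, p', C, k1, k2, hC, rfl, h1, h2, h3, h4, rfl⟩)
        (h' | ⟨q, q', C', l1, l2, hC', e, g1, g2, g3, g4, rfl⟩)
      · exact H.func h h'
      · rw [e] at h g1; exact absurd (ph_dm h) (opn_not_mem H.pcl (op hC') g1 g2)
      · exact absurd (ph_dm h') (opn_not_mem H.pcl (op hC) h1 h2)
      · rw [e] at g1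
        obtain ⟨rfl, e2, rfl⟩ := opn_uniq H.pcl (op hC) (op hC') (ph_dm h3) (ph_dm h4) (ph_dm g3)
          (ph_dm g4) h1 h2 g1 g2 e
        rw [H.func h3 g3, H.func h4 g4, R.eq hC.oc hC'.oc hC'.ne e2]
    · rintro g k k' (h | ⟨p, p', C, k1, k2, hC, rfl, h1, h2, h3, h4, rfl⟩)
        (h' | ⟨q, q', C', l1, l2, hC', e, g1, g2, g3, g4, rfl⟩)
      · exact H.func (ph_inv h) h'
      · have := ph_dm (ph_inv h)
        rw [e] at this g1; exact absurd this (opn_not_mem H.pcl (op hC') g1 g2)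
      · have := ph_dm (ph_inv h')
        rw [inv_inv] at this; exact absurd this (opn_not_mem H.pcl (op hC) h1 h2)
      · set o := blk f A b C
        set o' := blk f A b C'
        have e' : p * (o * p') = q'⁻¹ * (o'⁻¹ * q⁻¹) := by
          rw [← inv_inj, e]; group
        rw [e] at g1
        have b1 : Pre (q * o') (q * (o' * q')) :=
          (pre_mul g1 (by rw [inv_mul_cancel_left]; exact g2)).1
        have b0 : Pre q (q * o') :=
          (pre_mul g1 (by rw [inv_mul_cancel_left]; exact g2)).2
        have c1 : Pre q'⁻¹ (q'⁻¹ * (o'⁻¹ * q⁻¹)) := by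
          have := b1.inv
          have e1 : (q * (o' * q'))⁻¹ * (q * o') = q'⁻¹ := by group
          have e2 : (q * (o' * q'))⁻¹ = q'⁻¹ * (o'⁻¹ * q⁻¹) := by group
          rw [e1, e2] at this; exact this
        have c2 : Pre o'⁻¹ (o'⁻¹ * q⁻¹) := by
          have := b0.inv
          have e1 : (q * o')⁻¹ * q = o'⁻¹ := by group
          have e2 : (q * o')⁻¹ = o'⁻¹ * q⁻¹ := by group
          rw [e1, e2] at this; exact this
        obtain ⟨d1, d2, d3⟩ := opn_uniq H.pcl (op hC) (op hC').inv (ph_dm h3) (ph_dm h4)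
          ((dm Γ).inv_mem (ph_dm g4)) ((dm Γ).inv_mem (ph_dm g3)) h1 h2 c1 c2 e'
        rw [R.inv hC.oc hC'.oc hC'.ne d2]
        rw [d1] at h3
        rw [d3] at h4
        rw [H.func h3 (ph_inv g4), H.func h4 (ph_inv g3), QuotientGroup.mk_inv]
        group
    · rintro g k x (h | ⟨p, p', C, k1, k2, hC, rfl, h1, h2, h3, h4, rfl⟩) hx
      · obtain ⟨k1, k2, a1, a2, a3⟩ := H.splitph h hx
        exact ⟨k1, k2, Or.inl (Or.inl a1), Or.inl (Or.inl a2), a3⟩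
      · set o := blk f A b C
        rcases hx.total h1 with hxp | hpx
        · obtain ⟨l1, l2, a1, a2, rfl⟩ := H.splitph h3 hxp
          refine ⟨l1, l2 * (blk f' A' b' C : QQ ι') * k2, Or.inl (Or.inl a1), Or.inl (Or.inr
            ⟨x⁻¹ * p, p', C, l2, k2, hC, by group; rfl, hxp.tail h1, h2, a2, h4, rfl⟩), by group⟩
        · have hy := hpx.tail hx
          rw [inv_mul_cancel_left] at hy
          obtain ⟨y, rfl⟩ : ∃ y, x = p * y := ⟨p⁻¹ * x, by group⟩
          rw [inv_mul_cancel_left] at hy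
          rcases hy.total h2 with hyo | hoy
          · obtain ⟨l1, l2, a1, a2, a3⟩ := split_o H R hC hyo
            have erest : (p * y)⁻¹ * (p * (o * p')) = (y⁻¹ * o) * p' := by group
            rw [erest]
            have tl := hyo.tail h2
            have etl : y⁻¹ * (o * p') = y⁻¹ * o * p' := by group
            rw [etl] at tl
            refine ⟨k1 * l1, l2 * k2, Or.inl ?_, Or.inl ?_, by rw [a3]; group⟩
            · rcases a1 with a1 | ⟨C1, s, m, hC1, rfl, b2, b3, rfl⟩
              · exact Or.inl (ph_mul h3 a1)
              · exact Or.inr ⟨p, s, C1, k1, m, hC1, rfl, hpx, b2, h3, b3, by group⟩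
            · rcases a2 with a2 | ⟨C2, s, m, hC2, b1, b2, b3, rfl⟩
              · exact Or.inl (ph_mul a2 h4)
              · refine Or.inr ⟨s, p', C2, m, k2, hC2, by rw [b1]; group, b2.trans tl, ?_, b3, h4,
                  by group⟩
                have := b2.tail tl
                rw [b1] at this
                have e1 : s⁻¹ * (s * blk f A b C2) = blk f A b C2 := by group
                have e2 : s⁻¹ * (s * blk f A b C2 * p') = blk f A b C2 * p' := by group
                rw [e1, e2] at this
                exact this
          · have tl := hoy.tail hy
            rw [inv_mul_cancel_left] at tl
            obtain ⟨l1, l2, a1, a2, rfl⟩ := H.splitph h4 tl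
            refine ⟨k1 * (blk f' A' b' C : QQ ι') * l1, l2, Or.inl (Or.inr ⟨p, o⁻¹ * y, C, k1, l1, hC,
              by show p * y = p * (o * (o⁻¹ * y)); rw [mul_inv_cancel_left], hpx, ?_, h3, a1, rfl⟩), Or.inl (Or.inl ?_), by group⟩
            · show Pre o (o * (o⁻¹ * y))
              rw [mul_inv_cancel_left]; exact hoy
            · have e : (p * y)⁻¹ * (p * (o * p')) = (o⁻¹ * y)⁻¹ * p' := by group
              rw [e]; exact a2
  have hle : Γ ≤ Γ ⊔ Subgroup.closure (TT f A b f' A' b') := le_sup_left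
  have hdm : ∀ {g k}, ph Γ g k → g ∈ dm (Γ ⊔ Subgroup.closure (TT f A b f' A' b')) := by
    intro g k h
    obtain ⟨s, hs⟩ := mem_dm.1 (ph_dm h)
    exact mem_dm.2 ⟨s, hle hs⟩
  have hL : ∀ g k, L0 g k → g ∈ dm (Γ ⊔ Subgroup.closure (TT f A b f' A' b')) := by
    rintro g k (h | ⟨p, p', C, k1, k2, hC, rfl, h1, h2, h3, h4, rfl⟩)
    · exact hdm h
    · refine (dm _).mul_mem (hdm h3) ((dm _).mul_mem ?_ (hdm h4))
      exact mem_dm.2 ⟨blk f' A' b' C, (le_sup_right : _ ≤ Γ ⊔ _) (Subgroup.subset_closure ⟨C, hC, rfl⟩)⟩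
  refine half_ext' HL (fun g k h => Or.inl (Or.inl h)) ?_ ?_
  · rintro g s ⟨C, hC, e⟩
    rw [Prod.mk.injEq] at e
    obtain ⟨rfl, rfl⟩ := e
    apply Val.single
    refine Or.inl (Or.inr ⟨1, 1, C, 1, 1, hC, by simp, pre_one _, ?_, ph_one, ph_one, by simp⟩)
    rw [mul_one]; exact pre_refl _
  · rintro g k (h | h)
    · exact hL _ _ h
    · have := (dm _).inv_mem (hL _ _ h)
      simpa using this

end rel

end GW

end

set_option linter.all false

noncomputable section

namespace GW

open Set GriffithsWords Cardinal

section dense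
variable {ι ι' : Type} [Sys ι] [Sys ι']

/-- class of a position -/
def cw {L : Type} [LinearOrder L] (S : Subgroup (wordGroup ι)) (f : L → ι × ℕ × Bool) (p : L) : Set L :=
  {q | (el f (Iic p))⁻¹ * el f (Iic q) ∈ S}

/-- words whose classes all lie in the subgroup -/
def DenseType (S : Subgroup (wordGroup ι)) (g : wordGroup ι) : Prop :=
  ∃ (A0 : Set ℚ) (f : A0 → ι × ℕ × Bool), Red f Set.univ ∧ el f Set.univ = g ∧
    ∀ p, el f (cw S f p) ∈ S

lemma ce0 {L : Type} [LinearOrder L] {S : Subgroup (wordGroup ι)} (hm : ∀ m, Mono m → m ∈ S)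
    {f : L → ι × ℕ × Bool} (hf : LF f Set.univ) {p q : L} (hpq : p ≤ q) :
    (el f (Iic p))⁻¹ * el f (Iic q) ∈ S ↔ el f (Icc p q) ∈ S := by
  have e1 : Iic q = Iio p ∪ Icc p q := (Iio_union_Icc_eq_Iic hpq).symm
  have e2 : Iic p = Iio p ∪ {p} := by
    ext x; simp [le_iff_lt_or_eq]
  have a1 : el f (Iio p ∪ Icc p q) = el f (Iio p) * el f (Icc p q) :=
    el_union (hf.mono (subset_univ _)) (hf.mono (subset_univ _)) (fun x hx y hy => lt_of_lt_of_le hx hy.1)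
  have a2 : el f (Iio p ∪ {p}) = el f (Iio p) * el f {p} :=
    el_union (hf.mono (subset_univ _)) (hf.mono (subset_univ _)) (fun x hx y hy => by
      rw [mem_singleton_iff.1 hy]; exact hx)
  rw [e1, e2, a1, a2, el_single, mul_inv_rev, mul_assoc, inv_mul_cancel_left]
  exact Subgroup.mul_mem_cancel_left S (S.inv_mem (hm _ (mono_lt1 _)))

lemma cw_conv {L : Type} [LinearOrder L] {S : Subgroup (wordGroup ι)} (hS : PCl S)
    (hm : ∀ m, Mono m → m ∈ S)
    {f : L → ι × ℕ × Bool} (hf : Red f Set.univ) {p q r : L} (hpq : p ≤ q) (hqr : q ≤ r)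
    (h : (el f (Iic p))⁻¹ * el f (Iic r) ∈ S) : (el f (Iic p))⁻¹ * el f (Iic q) ∈ S := by
  rw [ce0 hm hf.1 (hpq.trans hqr)] at h
  rw [ce0 hm hf.1 hpq]
  have h1 := hf.inter (ordConnected_Icc (a := p) (b := r))
  have h2 := fac_mem hS (A := Set.univ ∩ Icc p r) h1 (by rwa [univ_inter])
    (ordConnected_Icc (a := p) (b := q))
  rwa [univ_inter, inter_eq_right.2 (Icc_subset_Icc_right hqr)] at h2

lemma dense_bw {A0 : Set ℚ} {S : Subgroup (wordGroup ι)} (hS : PCl S)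
    (hm : ∀ m, Mono m → m ∈ S) {f : A0 → ι × ℕ × Bool} (hf : Red f Set.univ)
    (hne : el f Set.univ ∉ S) (hd : ∀ p, el f (cw S f p) ∈ S) :
    ∃ b : A0 → ℚ, BW S f Set.univ b ∧ (∀ l ∈ b '' Set.univ, blk f Set.univ b {l} ∈ S) ∧
      (∀ l ∈ b '' Set.univ, ∀ m ∈ b '' Set.univ, l < m → ∃ n ∈ b '' Set.univ, l < n ∧ n < m) := by
  have hne' : Nonempty A0 := by
    by_contra hcon
    rw [not_nonempty_iff] at hcon
    apply hne
    rw [Set.univ_eq_empty_iff.2 hcon, el_empty]; exact S.one_mem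
  set cls : A0 → wordGroup ι ⧸ S := fun p => QuotientGroup.mk (el f (Iic p)) with hcls
  have hc : ∀ p q, cls p = cls q ↔ (el f (Iic p))⁻¹ * el f (Iic q) ∈ S := fun p q =>
    QuotientGroup.eq
  set rep : A0 → A0 := fun p => Function.invFun cls (cls p) with hrep
  have hcr : ∀ p, cls (rep p) = cls p := fun p => Function.invFun_eq ⟨p, rfl⟩
  have hrr : ∀ p q, rep p = rep q ↔ cls p = cls q := by
    intro p q; constructor
    · intro h; rw [← hcr p, ← hcr q, h]
    · intro h; simp only [hrep, h]
  have conv : ∀ p q r, p ≤ q → q ≤ r → cls p = cls r → cls p = cls q := by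
    intro p q r h1 h2 h
    rw [hc] at h ⊢
    exact cw_conv hS hm hf h1 h2 h
  set b : A0 → ℚ := fun p => (rep p).1 with hb
  have hbb : ∀ p q, b p = b q ↔ cls p = cls q := by
    intro p q
    rw [← hrr]; exact Subtype.val_injective.eq_iff
  have mono : Monotone b := by
    intro p q hpq
    by_contra hcon
    have hlt : rep q < rep p := not_le.1 hcon
    have hneq : cls p ≠ cls q := by
      intro h; rw [(hrr p q).2 h] at hlt; exact lt_irrefl _ hlt
    rcases le_total p (rep q) with h | h
    · have := conv p (rep q) (rep p) h hlt.le (hcr p).symm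
      exact hneq (this.trans (hcr q))
    · have := conv (rep q) p q h hpq (hcr q)
      exact hneq (this.symm.trans (hcr q))
  have ce : ∀ p ∈ (Set.univ : Set A0), ∀ q ∈ (Set.univ : Set A0), p ≤ q →
      (el f (Set.univ ∩ Icc p q) ∈ S ↔ b p = b q) := by
    intro p _ q _ hpq
    rw [univ_inter, hbb, hc, ce0 hm hf.1 hpq]
  have hblk : ∀ l ∈ b '' Set.univ, blk f Set.univ b {l} ∈ S := by
    rintro _ ⟨p, _, rfl⟩
    have e : (Set.univ : Set A0) ∩ b ⁻¹' {b p} = cw S f p := by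
      ext q
      simp only [univ_inter, mem_preimage, mem_singleton_iff]
      rw [eq_comm, hbb, hc]; rfl
    rw [blk, e]; exact hd p
  refine ⟨b, ⟨hf, mono, ce⟩, hblk, ?_⟩
  rintro _ ⟨p, _, rfl⟩ _ ⟨q, _, rfl⟩ hlt
  by_contra hcon
  push Not at hcon
  have hpq : p < q := by
    by_contra hc
    exact absurd (mono (not_lt.1 hc)) (not_le.2 hlt)
  apply hlt.ne
  rw [← ce p trivial q trivial hpq.le]
  have hr := fun l : ℚ => hf.inter ((ordConnected_singleton (a := l)).preimage_mono mono)
  have h1 := fac_mem hS (hr (b p)) (hblk _ ⟨p, trivial, rfl⟩) (ordConnected_Icc (a := p) (b := q))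
  have h2 := fac_mem hS (hr (b q)) (hblk _ ⟨q, trivial, rfl⟩) (ordConnected_Icc (a := p) (b := q))
  have e : (Set.univ : Set A0) ∩ Icc p q = (Set.univ ∩ b ⁻¹' {b p} ∩ Icc p q) ∪
      (Set.univ ∩ b ⁻¹' {b q} ∩ Icc p q) := by
    ext x
    simp only [univ_inter, mem_union, mem_inter_iff, mem_preimage, mem_singleton_iff]
    constructor
    · intro hx
      rcases eq_or_lt_of_le (mono hx.1) with h | h
      · exact Or.inl ⟨h.symm, hx⟩
      · exact Or.inr ⟨le_antisymm (mono hx.2) (hcon _ ⟨x, trivial, rfl⟩ h), hx⟩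
    · rintro (h | h) <;> exact h.2
  rw [e, el_union (hf.1.mono (subset_univ _)) (hf.1.mono (subset_univ _))]
  · exact S.mul_mem h1 h2
  · intro x hx y hy
    have hx' : b x = b p := hx.1.2
    have hy' : b y = b q := hy.1.2
    by_contra hc
    have := mono (not_lt.1 hc)
    rw [hx', hy'] at this
    exact absurd this (not_le.2 hlt)

end dense

end GW

end

set_option linter.all false

noncomputable section

namespace GW

open Set GriffithsWords Cardinal

section dense
variable {ι ι' : Type} [Sys ι] [Sys ι']

lemma inv_ne_self {g : wordGroup ι} (h : g ≠ 1) : g ≠ g⁻¹ := by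
  intro h1
  apply h
  apply Subtype.ext
  funext N
  have h2 : g.1 N = (g.1 N)⁻¹ := by
    have := congrArg (fun x : wordGroup ι => x.1 N) h1
    simpa using this
  have h3 : (g.1 N) ^ 2 = 1 := by
    rw [pow_two]; nth_rewrite 1 [h2]; exact inv_mul_cancel _
  have : (g.1 N) = 1 := (pow_eq_one_iff_left (two_ne_zero)).1 h3
  exact this

lemma exists_X {L : Type} [LinearOrder L] {f : L → ι × ℕ × Bool} {A : Set L} (hf : Red f A)
    {b : L → ℚ} (hb : Monotone b) :
    ∃ (X : ℚ → Unit × ℕ × Bool) (dec : ℕ → ℚ), Red X (b '' A) ∧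
      (∀ l ∈ b '' A, dec (X l).2.1 ∈ b '' A ∧ blk f A b {l} =
        if (X l).2.2 then blk f A b {dec (X l).2.1} else (blk f A b {dec (X l).2.1})⁻¹) ∧
      (∀ l m, blk f A b {l} = blk f A b {m} → X l = X m) ∧
      (∀ l, ∀ m ∈ b '' A, blk f A b {l} = (blk f A b {m})⁻¹ → X l = linv (X m)) := by
  classical
  set D := b '' A with hD
  set v : ℚ → wordGroup ι := fun l => blk f A b {l} with hv
  have v1 : ∀ l ∈ D, v l ≠ 1 := by
    rintro _ ⟨p, hp, rfl⟩ h1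
    have := hf.2 _ ((ordConnected_singleton (a := b p)).preimage_mono hb) h1
    have h2 : p ∈ A ∩ b ⁻¹' {b p} := ⟨hp, rfl⟩
    rw [this] at h2; exact h2
  have vev : ∀ l N, (v l).1 N = ev f (A ∩ b ⁻¹' {l}) N := fun l N => by
    show (↑(el f (A ∩ b ⁻¹' {l})) : ℕ → FreeGroup (ι × ℕ)) N = _
    rw [coe_el (hf.1.mono inter_subset_left)]
  have vlev : ∀ l N, (v l).1 N ≠ 1 → l ∈ b '' (lev f A N) := by
    intro l N h
    rw [vev, ev] at h
    have : (lev f (A ∩ b ⁻¹' {l}) N).Nonempty := by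
      rw [nonempty_iff_ne_empty]; intro h0; rw [h0, oprod_empty] at h; exact h rfl
    obtain ⟨p, hp⟩ := this
    exact ⟨p, ⟨hp.1.1, hp.2⟩, hp.1.2⟩
  set c : ℚ → ℚ := fun l => Classical.epsilon (fun μ => μ ∈ D ∧ (v μ = v l ∨ v μ = (v l)⁻¹)) with hc
  have cs : ∀ l ∈ D, c l ∈ D ∧ (v (c l) = v l ∨ v (c l) = (v l)⁻¹) := fun l hl =>
    Classical.epsilon_spec (p := fun μ => μ ∈ D ∧ (v μ = v l ∨ v μ = (v l)⁻¹)) ⟨l, hl, Or.inl rfl⟩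
  set dec : ℕ → ℚ := fun n => (Encodable.decode (α := ℚ) n).getD 0 with hdec
  have de : ∀ q, dec (Encodable.encode q) = q := by intro q; simp [hdec]
  set X : ℚ → Unit × ℕ × Bool := fun l => ((), Encodable.encode (c l), decide (v (c l) = v l)) with hX
  have dX : ∀ l, dec (X l).2.1 = c l := fun l => de (c l)
  have ceq : ∀ l m, v l = v m → c l = c m := by
    intro l m h; simp only [hc, h]
  have cinv : ∀ l m, v l = (v m)⁻¹ → c l = c m := by
    intro l m h
    simp only [hc, h, inv_inv]
    congr 1
    funext μ
    rw [or_comm]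
  have val : ∀ l ∈ D, v l = if (X l).2.2 then v (dec (X l).2.1) else (v (dec (X l).2.1))⁻¹ := by
    intro l hl
    rw [dX]
    simp only [hX, decide_eq_true_eq]
    split_ifs with h
    · exact h.symm
    · rw [(cs l hl).2.resolve_left h, inv_inv]
  have hLF : LF X D := by
    intro N
    have hsub : lev X D N ⊆ ⋃ n ∈ Iic N, {l ∈ D | c l = dec n} := by
      rintro l ⟨hl, h⟩
      simp only [mem_iUnion]
      exact ⟨(X l).2.1, h, hl, (dX l).symm⟩
    refine Set.Finite.subset (Set.Finite.biUnion (finite_Iic N) ?_) hsub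
    intro n _
    by_cases hex : ∃ l0 ∈ D, c l0 = dec n
    · obtain ⟨l0, hl0, h0⟩ := hex
      obtain ⟨N', hN'⟩ : ∃ N', (v l0).1 N' ≠ 1 := by
        by_contra hcon
        push Not at hcon
        exact v1 l0 hl0 (Subtype.ext (funext hcon))
      refine ((hf.1 N').image b).subset ?_
      rintro l ⟨hl, h⟩
      apply vlev
      intro h1
      apply hN'
      have a1 := (cs l hl).2
      have a2 := (cs l0 hl0).2
      rw [h] at a1; rw [h0] at a2
      have : v l0 = v l ∨ v l0 = (v l)⁻¹ := by
        rcases a1 with a1 | a1 <;> rcases a2 with a2 | a2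
        · left; rw [← a2, a1]
        · right; rw [← a1, a2, inv_inv]
        · right; rw [← a2, a1]
        · left; rw [← inv_inj, ← a2, a1]
      rcases this with h2 | h2
      · rw [h2]; exact h1
      · rw [h2]
        show (((v l).1)⁻¹ : ℕ → FreeGroup (ι × ℕ)) N' = 1
        rw [Pi.inv_apply, h1, inv_one]
    · convert finite_empty
      ext l; simp only [mem_setOf_eq, mem_empty_iff_false, iff_false]
      exact fun h => hex ⟨l, h⟩
  refine ⟨X, dec, ⟨hLF, ?_⟩, ?_, ?_, ?_⟩
  · intro C hC h1
    have key : el f (A ∩ b ⁻¹' C) = 1 := by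
      have hl : LF f (A ∩ b ⁻¹' C) := hf.1.mono inter_subset_left
      apply Subtype.ext
      rw [coe_el hl]
      funext N
      show ev f (A ∩ b ⁻¹' C) N = 1
      set T := b '' (lev f (A ∩ b ⁻¹' C) N) with hT
      have hTf : T.Finite := (hl N).image b
      have hTD : T ⊆ D ∩ C := by
        rintro _ ⟨p, hp, rfl⟩
        exact ⟨⟨p, hp.1.1, rfl⟩, hp.1.2⟩
      rw [ev_blocks hl (hb.monotoneOn _) hTf le_rfl]
      obtain ⟨K, hK⟩ : ∃ K, ∀ l ∈ T, (X l).2.1 ≤ K := by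
        obtain ⟨K, hK⟩ := (hTf.image (fun l => (X l).2.1)).bddAbove
        exact ⟨K, fun l hl => hK ⟨l, hl, rfl⟩⟩
      have e1 : oprod T (fun l => ev f (A ∩ b ⁻¹' C ∩ b ⁻¹' {l}) N) = oprod T (fun l => (v l).1 N) := by
        apply oprod_congr
        intro l hl
        rw [vev, restrict_blk (f := f) (hTD hl).2]
      rw [e1]
      have hsub : T ⊆ lev X (D ∩ C) K := fun l hl => ⟨hTD hl, hK l hl⟩
      rw [oprod_subset ((hLF.mono inter_subset_left) K) hsub]
      · set θ : FreeGroup (Unit × ℕ) →* FreeGroup (ι × ℕ) :=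
          FreeGroup.lift (fun x => (v (dec x.2)).1 N) with hθ
        have e2 : oprod (lev X (D ∩ C) K) (fun l => (v l).1 N) =
            oprod (lev X (D ∩ C) K) (θ ∘ (gen ∘ X)) := by
          apply oprod_congr
          intro l hl
          have h := val l hl.1.1
          simp only [Function.comp, gen_eq]
          rw [h]
          split_ifs with h'
          · simp [hθ, ix]
          · simp [hθ, ix]
        have : ev X (D ∩ C) K = 1 := by
          rw [← coe_el (hLF.mono inter_subset_left), h1]; rfl
        have e3 : θ (ev X (D ∩ C) K) = oprod (lev X (D ∩ C) K) (θ ∘ (gen ∘ X)) := oprod_map _ _ _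
        rw [e2, ← e3, this, map_one]
      · intro l hl hlT
        by_contra hcon
        apply hlT
        obtain ⟨p, hp, rfl⟩ := vlev l N hcon
        exact ⟨p, ⟨⟨hp.1, hl.1.2⟩, hp.2⟩, rfl⟩
    have := hf.2 _ (hC.preimage_mono hb) key
    rw [eq_empty_iff_forall_notMem]
    rintro _ ⟨⟨p, hp, rfl⟩, hpC⟩
    have h2 : p ∈ A ∩ b ⁻¹' C := ⟨hp, hpC⟩
    rw [this] at h2; exact h2
  · intro l hl
    refine ⟨?_, val l hl⟩
    rw [dX]; exact (cs l hl).1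
  · intro l m h
    simp only [hX, ceq l m h]
    rw [show v l = v m from h]
  · intro l m hm h
    have h : v l = (v m)⁻¹ := h
    simp only [hX, cinv l m h, linv, h]
    refine Prod.ext rfl (Prod.ext rfl ?_)
    simp only
    rcases (cs m hm).2 with h2 | h2
    · simp [h2, inv_ne_self (v1 m hm)]
    · simp [h2, (inv_ne_self (v1 m hm)).symm]

end dense

end GW

end

set_option linter.all false

noncomputable section

namespace GW

open Set GriffithsWords Cardinal

section dense
variable {ι ι' : Type} [Sys ι] [Sys ι']

lemma red_image {L L' : Type} [LinearOrder L] [LinearOrder L'] {f : L → ι × ℕ × Bool}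
    {f' : L' → ι × ℕ × Bool} {A : Set L} (h : Red f A)
    {e : L → L'} (he : StrictMonoOn e A) (hf : ∀ i ∈ A, f' (e i) = f i) : Red f' (e '' A) := by
  refine ⟨h.1.image (fun i hi => by rw [hf i hi]), ?_⟩
  intro C hC h1
  set C' : Set L := {x | (∃ a ∈ A, e a ∈ C ∧ a ≤ x) ∧ (∃ a ∈ A, e a ∈ C ∧ x ≤ a)} with hC'
  have oc : C'.OrdConnected := by
    constructor
    rintro x ⟨⟨a, ha, ha1, ha2⟩, _⟩ y ⟨_, ⟨c, hc, hc1, hc2⟩⟩ z hz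
    exact ⟨⟨a, ha, ha1, ha2.trans hz.1⟩, ⟨c, hc, hc1, hz.2.trans hc2⟩⟩
  have e1 : e '' A ∩ C = e '' (A ∩ C') := by
    ext y; constructor
    · rintro ⟨⟨x, hx, rfl⟩, hxC⟩
      exact ⟨x, ⟨hx, ⟨x, hx, hxC, le_rfl⟩, ⟨x, hx, hxC, le_rfl⟩⟩, rfl⟩
    · rintro ⟨x, ⟨hx, ⟨a, ha, ha1, ha2⟩, ⟨c, hc, hc1, hc2⟩⟩, rfl⟩
      exact ⟨⟨x, hx, rfl⟩, hC.out ha1 hc1 ⟨he.monotoneOn ha hx ha2, he.monotoneOn hx hc hc2⟩⟩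
  rw [e1] at h1 ⊢
  rw [el_image (h.1.mono inter_subset_left) (he.mono inter_subset_left) (fun i hi => hf i hi.1)] at h1
  rw [h.2 _ oc h1, image_empty]

lemma red_subtype {A : Set ℚ} {f : ℚ → ι × ℕ × Bool} (h : Red f A) :
    Red (fun x : A => f x) Set.univ ∧ el (fun x : A => f x) Set.univ = el f A := by
  have hl : LF (fun x : A => f x) Set.univ := by
    intro N
    apply Set.Finite.of_finite_image (f := Subtype.val) _ (Subtype.val_injective.injOn)
    refine (h.1 N).subset ?_
    rintro _ ⟨x, hx, rfl⟩
    exact ⟨x.2, hx.2⟩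
  have key : ∀ C : Set A, el f (Subtype.val '' C) = el (fun x : A => f x) C := fun C =>
    el_image (f := fun x : A => f x) (hl.mono (subset_univ _)) (e := Subtype.val)
      (fun x _ y _ h => h) (fun _ _ => rfl)
  refine ⟨⟨hl, ?_⟩, ?_⟩
  · intro C hC h1
    rw [univ_inter] at h1 ⊢
    set C' : Set ℚ := {x | (∃ a ∈ C, a.1 ≤ x) ∧ (∃ a ∈ C, x ≤ a.1)} with hC'
    have oc : C'.OrdConnected := by
      constructor
      rintro x ⟨⟨a, ha, ha2⟩, _⟩ y ⟨_, ⟨c, hc, hc2⟩⟩ z hz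
      exact ⟨⟨a, ha, ha2.trans hz.1⟩, ⟨c, hc, hz.2.trans hc2⟩⟩
    have e1 : A ∩ C' = Subtype.val '' C := by
      ext y; constructor
      · rintro ⟨hy, ⟨a, ha, ha2⟩, ⟨c, hc, hc2⟩⟩
        exact ⟨⟨y, hy⟩, hC.out ha hc ⟨ha2, hc2⟩, rfl⟩
      · rintro ⟨x, hx, rfl⟩
        exact ⟨x.2, ⟨x, hx, le_rfl⟩, ⟨x, hx, le_rfl⟩⟩
    rw [← key, ← e1] at h1
    have := h.2 _ oc h1
    rw [e1] at this
    exact image_eq_empty.1 this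
  · rw [← key, image_univ, Subtype.range_val]

lemma exists_deep {Γ : Subgroup (wordGroup ι × wordGroup ι')} (H : Half (sw Γ))
    (m2 : ∀ m, Mono m → (1, m) ∈ Γ) {V : wordGroup ι} {s : wordGroup ι'} (hVs : (V, s) ∈ Γ) (K : ℕ) :
    ∃ (f : ℚ → ι' × ℕ × Bool) (B : Set ℚ), B ⊆ Ioo (-1) 1 ∧ Red f B ∧ (∀ t ∈ B, K < (f t).2.1) ∧
      (V, el f B) ∈ Γ := by
  obtain ⟨f, A, hA, rfl⟩ := exists_redrep s
  have hsS : el f A ∈ dm (sw Γ) := mem_dm.2 ⟨V, hVs⟩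
  have P : ∀ F : Set ℚ, F.Finite → ∀ C : Set ℚ, C.OrdConnected → el f ((A \ F) ∩ C) ∈ dm (sw Γ) := by
    intro F hF
    induction F, hF using Set.Finite.induction_on with
    | empty => intro C hC; rw [diff_empty]; exact fac_mem H.pcl hA hsS hC
    | @insert i F hi hF ih =>
      intro C hC
      have e : (A \ insert i F) ∩ C = ((A \ F) ∩ (C ∩ Iio i)) ∪ ((A \ F) ∩ (C ∩ Ioi i)) := by
        ext x
        simp only [mem_inter_iff, mem_diff, mem_insert_iff, not_or, mem_union, mem_Iio, mem_Ioi]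
        constructor
        · rintro ⟨⟨h1, h2, h3⟩, h4⟩
          rcases lt_or_gt_of_ne h2 with h | h
          · exact Or.inl ⟨⟨h1, h3⟩, h4, h⟩
          · exact Or.inr ⟨⟨h1, h3⟩, h4, h⟩
        · rintro (⟨⟨h1, h3⟩, h4, h⟩ | ⟨⟨h1, h3⟩, h4, h⟩)
          · exact ⟨⟨h1, h.ne, h3⟩, h4⟩
          · exact ⟨⟨h1, h.ne', h3⟩, h4⟩
      have hu : el f (((A \ F) ∩ (C ∩ Iio i)) ∪ ((A \ F) ∩ (C ∩ Ioi i))) = _ :=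
        el_union (hA.1.mono (fun x hx => hx.1.1)) (hA.1.mono (fun x hx => hx.1.1))
          (fun x hx y hy => lt_trans hx.2.2 hy.2.2)
      rw [e, hu]
      exact Subgroup.mul_mem _ (ih _ (hC.inter ordConnected_Iio)) (ih _ (hC.inter ordConnected_Ioi))
  have Q : ∀ F : Set ℚ, F.Finite → (V, el f (A \ F)) ∈ Γ := by
    intro F hF
    induction F, hF using Set.Finite.induction_on with
    | empty => rw [diff_empty]; exact hVs
    | @insert i F hi hF ih =>
      by_cases hiA : i ∈ A
      · have hB : LF f (A \ F) := hA.1.mono diff_subset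
        set w1 := el f ((A \ F) ∩ Iio i) with hw1
        set w2 := el f ((A \ F) ∩ Ioi i) with hw2
        have c1 : el f (A \ insert i F) = w1 * w2 := by
          have e : (A \ insert i F) = ((A \ F) ∩ Iio i) ∪ ((A \ F) ∩ Ioi i) := by
            ext x
            simp only [mem_inter_iff, mem_diff, mem_insert_iff, not_or, mem_union, mem_Iio, mem_Ioi]
            constructor
            · rintro ⟨h1, h2, h3⟩
              rcases lt_or_gt_of_ne h2 with h | h
              · exact Or.inl ⟨⟨h1, h3⟩, h⟩
              · exact Or.inr ⟨⟨h1, h3⟩, h⟩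
            · rintro (⟨⟨h1, h3⟩, h⟩ | ⟨⟨h1, h3⟩, h⟩)
              · exact ⟨h1, h.ne, h3⟩
              · exact ⟨h1, h.ne', h3⟩
          rw [e]
          exact el_union (hB.mono inter_subset_left) (hB.mono inter_subset_left)
            (fun x hx y hy => lt_trans hx.2 hy.2)
        have c2 : el f (A \ F) = w1 * (lt1 (f i) * w2) := by
          have e : (A \ F) = ((A \ F) ∩ Iio i) ∪ ({i} ∪ ((A \ F) ∩ Ioi i)) := by
            ext x
            simp only [mem_inter_iff, mem_diff, mem_union, mem_Iio, mem_Ioi, mem_singleton_iff]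
            constructor
            · rintro ⟨h1, h2⟩
              rcases lt_trichotomy x i with h | h | h
              · exact Or.inl ⟨⟨h1, h2⟩, h⟩
              · exact Or.inr (Or.inl h)
              · exact Or.inr (Or.inr ⟨⟨h1, h2⟩, h⟩)
            · rintro (h | h | h)
              · exact h.1
              · rw [h]; exact ⟨hiA, hi⟩
              · exact h.1
          have hu : LF f ({i} ∪ ((A \ F) ∩ Ioi i)) := by
            refine hB.mono ?_
            rintro x (h | h)
            · rw [mem_singleton_iff.1 h]; exact ⟨hiA, hi⟩
            · exact h.1
          have d1 : el f ({i} ∪ ((A \ F) ∩ Ioi i)) = lt1 (f i) * w2 := by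
            have := el_union (LF_fin (f := f) (finite_singleton i)) (hB.mono (inter_subset_left (t := Ioi i)))
              (fun x hx y hy => by rw [mem_singleton_iff.1 hx]; exact hy.2)
            rw [this, el_single]
          have d2 : el f (((A \ F) ∩ Iio i) ∪ ({i} ∪ ((A \ F) ∩ Ioi i))) = w1 * (lt1 (f i) * w2) := by
            rw [el_union (hB.mono inter_subset_left) hu, d1]
            intro x hx y hy
            rcases hy with hy | hy
            · rw [mem_singleton_iff.1 hy]; exact hx.2
            · exact lt_trans hx.2 hy.2
          rw [← d2]
          exact congrArg (el f) e
        obtain ⟨t, ht⟩ := mem_dm.1 (P F hF (Ioi i) ordConnected_Ioi)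
        have ht : (t, w2) ∈ Γ := ht
        have hl : ((1 : wordGroup ι), lt1 (f i)) ∈ Γ := m2 _ (mono_lt1 _)
        have := Γ.mul_mem ih (Γ.mul_mem (Γ.mul_mem (Γ.inv_mem ht) (Γ.inv_mem hl)) ht)
        rw [c1]
        rw [c2] at this
        convert this using 1
        refine Prod.ext ?_ ?_
        · simp
        · simp only [Prod.mk_mul_mk, Prod.inv_mk]
          group
      · have e : A \ insert i F = A \ F := by
          ext x
          simp only [mem_diff, mem_insert_iff, not_or]
          exact ⟨fun h => ⟨h.1, h.2.2⟩, fun h => ⟨h.1, fun h2 => hiA (h2 ▸ h.1), h.2⟩⟩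
        rw [e]; exact ih
  obtain ⟨B, hB, hBr, hBe⟩ := exists_red (hA.1.mono (diff_subset (t := lev f A K)))
  set e : ℚ → ℚ := fun q => (orderIsoIooNegOneOne ℚ q).1 with he
  have hs : StrictMono e := (orderIsoIooNegOneOne ℚ).strictMono
  set f' : ℚ → ι' × ℕ × Bool := fun q => f (Function.invFun e q) with hf'
  have hff : ∀ i ∈ B, f' (e i) = f i := fun i _ => by
    simp only [hf', Function.leftInverse_invFun hs.injective i]
  refine ⟨f', e '' B, ?_, red_image hBr (hs.strictMonoOn _) hff, ?_, ?_⟩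
  · rintro _ ⟨x, _, rfl⟩
    exact (orderIsoIooNegOneOne ℚ x).2
  · rintro _ ⟨x, hx, rfl⟩
    rw [hff x hx]
    by_contra hcon
    exact (hB hx).2 ⟨(hB hx).1, not_lt.1 hcon⟩
  · rw [el_image hBr.1 (hs.strictMonoOn _) hff, hBe]
    exact Q _ (hA.1 K)

lemma ioo_inf {D : Set ℚ} (den : ∀ l ∈ D, ∀ m ∈ D, l < m → ∃ n ∈ D, l < n ∧ n < m)
    {l m : ℚ} (hl : l ∈ D) (hm : m ∈ D) (h : l < m) : (D ∩ Ioo l m).Infinite := by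
  intro hfin
  obtain ⟨n, hn, h1, h2⟩ := den l hl m hm h
  obtain ⟨x, hx, hmax⟩ := Set.exists_max_image _ id hfin ⟨n, hn, h1, h2⟩
  obtain ⟨y, hy, h3, h4⟩ := den x hx.1 m hm hx.2.2
  exact absurd (hmax y ⟨hy, hx.2.1.trans h3, h4⟩) (not_le.2 h3)

lemma fac_clos {L : Type} [LinearOrder L] {f : L → ι × ℕ × Bool} {A : Set L}
    (hA : Red f A) {C : Set L} (hC : C.OrdConnected) :
    el f (A ∩ C) ∈ Subgroup.closure ({g | Mono g} ∪ {x | Pre x (el f A)}) := by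
  set D1 : Set L := {x | ∃ c ∈ C, x ≤ c}
  set D2 : Set L := {x | ∀ c ∈ C, x < c}
  have h1 : IsLowerSet D1 := by rintro x y hxy ⟨c, hc, h⟩; exact ⟨c, hc, hxy.trans h⟩
  have h2 : IsLowerSet D2 := by intro x y hxy h c hc; exact hxy.trans_lt (h c hc)
  by_cases hne : C.Nonempty
  · have a1 : Pre (el f (A ∩ D1)) (el f A) := pre_of_red hA h1
    have a2 : Pre (el f (A ∩ D2)) (el f A) := pre_of_red hA h2
    have e := el_split (hA.1.mono (inter_subset_left (t := D1))) h2
    have e1 : A ∩ D1 ∩ D2 = A ∩ D2 := by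
      ext x; constructor
      · rintro ⟨⟨h, _⟩, h'⟩; exact ⟨h, h'⟩
      · rintro ⟨h, h'⟩
        obtain ⟨c, hc⟩ := hne
        exact ⟨⟨h, c, hc, (h' c hc).le⟩, h'⟩
    have e2 : A ∩ D1 ∩ D2ᶜ = A ∩ C := by
      ext x; constructor
      · rintro ⟨⟨h, c, hc, hxc⟩, h'⟩
        have h' : ¬ ∀ c ∈ C, x < c := h'
        push Not at h'
        obtain ⟨d, hd, hdx⟩ := h'
        exact ⟨h, hC.out hd hc ⟨hdx, hxc⟩⟩
      · rintro ⟨h, hx⟩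
        exact ⟨⟨h, x, hx, le_rfl⟩, fun h' => lt_irrefl x (h' x hx)⟩
    rw [e1, e2] at e
    have : el f (A ∩ C) = (el f (A ∩ D2))⁻¹ * el f (A ∩ D1) := by rw [e, inv_mul_cancel_left]
    rw [this]
    exact Subgroup.mul_mem _ (Subgroup.inv_mem _ (Subgroup.subset_closure (Or.inr a2)))
      (Subgroup.subset_closure (Or.inr a1))
  · rw [not_nonempty_iff_eq_empty.1 hne, inter_empty, el_empty]
    exact Subgroup.one_mem _

end dense

end GW

end

set_option linter.all false

noncomputable section

namespace GW

open Set GriffithsWords Cardinal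

section dense
variable {ι ι' : Type} [Sys ι] [Sys ι']

theorem dense_step {κ : Cardinal.{0}} (h0 : ℵ₀ ≤ κ) (hκ : κ < 𝔠)
    {Γ : Subgroup (wordGroup ι × wordGroup ι')} (hΓ : Stage κ Γ) {g : wordGroup ι}
    (hg : DenseType (dm Γ) g) :
    ∃ Γ₁, Γ ≤ Γ₁ ∧ Stage κ Γ₁ ∧ g ∈ dm Γ₁ := by
  classical
  by_cases hgS : g ∈ dm Γ
  · exact ⟨Γ, le_rfl, hΓ, hgS⟩
  obtain ⟨A0, f, hf, rfl, hd⟩ := hg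
  obtain ⟨b, hbw, hbl, den⟩ := dense_bw hΓ.h1.pcl (fun m hm => mem_dm.2 ⟨1, hΓ.m1 m hm⟩) hf hgS hd
  obtain ⟨X, dec, hX, hval, hXeq, hXinv⟩ := exists_X hf hbw.mono
  set D := b '' Set.univ with hD
  set v : ℚ → wordGroup ι := fun l => blk f Set.univ b {l} with hv
  have pcs : ∀ j : ℕ, ∃ (s : ℚ → ι' × ℕ × Bool) (B : Set ℚ), B ⊆ Ioo (-1) 1 ∧ Red s B ∧
      (∀ t ∈ B, max (Sys.ma (2 ^ (j + 1)) : ι' × ℕ).2 (Sys.mb j : ι' × ℕ).2 < (s t).2.1) ∧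
      (dec j ∈ D → (v (dec j), el s B) ∈ Γ) := by
    intro j
    by_cases hj : dec j ∈ D
    · obtain ⟨s, hs⟩ := mem_dm.1 (hbl _ hj)
      obtain ⟨s', B, h1, h2, h3, h4⟩ := exists_deep hΓ.h2 hΓ.m2 hs
        (max (Sys.ma (2 ^ (j + 1)) : ι' × ℕ).2 (Sys.mb j : ι' × ℕ).2)
      exact ⟨s', B, h1, h2, h3, fun _ => h4⟩
    · exact ⟨(Pcs0 ι').s 0, ∅, empty_subset _, (Pcs0 ι').red 0, fun t ht => absurd ht (by simp),
        fun h => absurd h hj⟩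
  choose s B hB1 hB2 hB3 hB4 using pcs
  set Q : Pcs ι' := ⟨s, B, hB1, hB2, fun j t ht => max_lt_iff.1 (hB3 j t ht)⟩ with hQ
  have hH : ∀ C : Set ℚ, C.OrdConnected → (D ∩ C).Infinite →
      ∃ q ∈ D ∩ C, (D ∩ (C ∩ Ioi q)).Infinite := by
    intro C hC hinf
    obtain ⟨x, hx, y, hy, hxy⟩ := hinf.nontrivial
    have key : ∀ x ∈ D ∩ C, ∀ y ∈ D ∩ C, x < y → ∃ q ∈ D ∩ C, (D ∩ (C ∩ Ioi q)).Infinite := by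
      intro x hx y hy h
      refine ⟨x, hx, (ioo_inf den hx.1 hy.1 h).mono ?_⟩
      rintro z ⟨hz, hz1⟩
      exact ⟨hz, hC.out hx.2 hy.2 ⟨hz1.1.le, hz1.2.le⟩, hz1.1⟩
    rcases lt_or_gt_of_ne hxy with h | h
    · exact key x hx y hy h
    · exact key y hy x hx h
  obtain ⟨r, hr⟩ := Q.generic hX hH hκ hΓ.s2
  have hu : ∀ l ∈ D, (v l, Q.u r (X l)) ∈ Γ := by
    have pos : ∀ j, dec j ∈ D → (v (dec j), Q.u r ((), j, true)) ∈ Γ := by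
      intro j hj
      rw [Q.u_true r j ()]
      have h1 := hΓ.m2 _ (mono_lt1 (pl (Sys.ma (cc r j) : ι' × ℕ)))
      have h2 := hΓ.m2 _ (mono_lt1 (pl (Sys.mb j : ι' × ℕ)))
      have := Γ.mul_mem (Γ.mul_mem h1 (hB4 j hj)) h2
      simpa using this
    intro l hl
    obtain ⟨hd', hvl⟩ := hval l hl
    have hvl : v l = if (X l).2.2 then v (dec (X l).2.1) else (v (dec (X l).2.1))⁻¹ := hvl
    have hp := pos _ hd'
    by_cases h2 : (X l).2.2 = true
    · rw [if_pos h2] at hvl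
      have e : X l = ((), (X l).2.1, true) := Prod.ext rfl (Prod.ext rfl h2)
      rw [hvl, e]; exact hp
    · rw [if_neg h2] at hvl
      have e : X l = linv ((), (X l).2.1, true) :=
        Prod.ext rfl (Prod.ext rfl (by simpa [linv] using h2))
      rw [hvl, e, Q.u_linv]; exact Γ.inv_mem hp
  set U := Q.U r X with hU
  set UA := Q.UA X D with hUA
  have himg : bb '' UA = D := Q.UA_img
  have hUr : Red U UA := Q.U_red r hX
  have hblkU : ∀ l ∈ D, blk U UA bb {l} = Q.u r (X l) := fun l hl => Q.U_block r hl
  have bwU : BW (dm (sw Γ)) U UA bb := by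
    refine ⟨hUr, bb_mono, ?_⟩
    intro p hp q hq hpq
    constructor
    · intro h
      by_contra hne
      have hlt : bb p < bb q := lt_of_le_of_ne (bb_mono hpq) hne
      have hpD : bb p ∈ D := by rw [← himg]; exact ⟨p, hp, rfl⟩
      have hqD : bb q ∈ D := by rw [← himg]; exact ⟨q, hq, rfl⟩
      refine hr (Ioo (bb p) (bb q)) ordConnected_Ioo (ioo_inf den hpD hqD hlt) ?_
      have := fac_mem hΓ.h2.pcl (hUr.inter (ordConnected_Icc (a := p) (b := q))) h
        ((ordConnected_Ioo (a := bb p) (b := bb q)).preimage_mono bb_mono)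
      have e : UA ∩ Icc p q ∩ bb ⁻¹' Ioo (bb p) (bb q) = UA ∩ bb ⁻¹' Ioo (bb p) (bb q) := by
        ext x; constructor
        · rintro ⟨⟨h1, _⟩, h2⟩; exact ⟨h1, h2⟩
        · rintro ⟨h1, h2⟩
          refine ⟨⟨h1, ?_, ?_⟩, h2⟩
          · by_contra hc
            exact absurd (bb_mono (not_le.1 hc).le) (not_le.2 h2.1)
          · by_contra hc
            exact absurd (bb_mono (not_le.1 hc).le) (not_le.2 h2.2)
      rw [e] at this
      exact this
    · intro h
      have hpD : bb p ∈ D := by rw [← himg]; exact ⟨p, hp, rfl⟩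
      have h1 : blk U UA bb {bb p} ∈ dm (sw Γ) := by
        rw [hblkU _ hpD]; exact mem_dm.2 ⟨_, hu _ hpD⟩
      have := fac_mem hΓ.h2.pcl (hUr.inter ((ordConnected_singleton (a := bb p)).preimage_mono bb_mono)) h1
        (ordConnected_Icc (a := p) (b := q))
      have e : UA ∩ bb ⁻¹' {bb p} ∩ Icc p q = UA ∩ Icc p q := by
        ext x; constructor
        · rintro ⟨⟨h1, _⟩, h2⟩; exact ⟨h1, h2⟩
        · rintro ⟨h1, h2⟩
          refine ⟨⟨h1, ?_⟩, h2⟩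
          have a1 := bb_mono h2.1
          have a2 := bb_mono h2.2
          rw [← h] at a2
          exact le_antisymm a2 a1
      rwa [e] at this
  have hvX : ∀ l ∈ D, ∀ m ∈ D, X l = X m → v l = v m := by
    intro l hl m hm h
    have h1 := (hval l hl).2
    have h2 := (hval m hm).2
    rw [h] at h1
    exact h1.trans h2.symm
  have hvXi : ∀ l ∈ D, ∀ m ∈ D, X l = linv (X m) → v l = (v m)⁻¹ := by
    intro l hl m hm h
    have h1 : v l = if (X l).2.2 then v (dec (X l).2.1) else (v (dec (X l).2.1))⁻¹ := (hval l hl).2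
    have h2 : v m = if (X m).2.2 then v (dec (X m).2.1) else (v (dec (X m).2.1))⁻¹ := (hval m hm).2
    rw [h] at h1
    rw [h1, h2]
    cases hc : (X m).2.2 <;> simp [linv, hc]
  have R1 : Rel Γ f Set.univ b U UA bb := by
    refine ⟨hbw, hUr.1, bb_mono, himg, ?_, ?_, ?_, den⟩
    · intro l hl; rw [hblkU l hl]; exact hu l hl
    · intro l hl m hm h
      rw [hblkU l hl, hblkU m hm, hXeq l m h]
    · intro l hl m hm h
      rw [hblkU l hl, hblkU m hm, hXinv l m hm h, Q.u_linv]
  have R2 : Rel (sw Γ) U UA bb f Set.univ b := by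
    refine ⟨bwU, hf.1, hbw.mono, himg.symm, ?_, ?_, ?_, ?_⟩ <;> rw [himg]
    · intro l hl; rw [hblkU l hl]; exact hu l hl
    · intro l hl m hm h
      rw [hblkU l hl, hblkU m hm] at h
      exact hvX l hl m hm (Q.u_inj r h)
    · intro l hl m hm h
      rw [hblkU l hl, hblkU m hm, ← Q.u_linv] at h
      exact hvXi l hl m hm (Q.u_inj r h)
    · exact den
  have e : Prod.swap ⁻¹' (TT f Set.univ b U UA bb) = TT U UA bb f Set.univ b := by
    ext ⟨x, y⟩
    constructor
    · rintro ⟨C, hC, h⟩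
      refine ⟨C, ?_, ?_⟩
      · rw [himg]; exact hC
      · have h1 := congrArg Prod.fst h
        have h2 := congrArg Prod.snd h
        exact Prod.ext h2 h1
    · rintro ⟨C, hC, h⟩
      refine ⟨C, ?_, ?_⟩
      · rw [himg] at hC; exact hC
      · have h1 := congrArg Prod.fst h
        have h2 := congrArg Prod.snd h
        exact Prod.ext h2 h1
  refine ⟨Γ ⊔ Subgroup.closure (TT f Set.univ b U UA bb), le_sup_left, ⟨half_dense hΓ.h1 R1, ?_,
    ?_, ?_, fun m hm => ?_, fun m hm => ?_⟩, ?_⟩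
  · rw [sw_sup_closure, e]
    exact half_dense hΓ.h2 R2
  · refine small_sup h0 hΓ.s1 (el f Set.univ) ?_
    rintro _ ⟨C, hC, rfl⟩
    exact fac_clos hf (hC.oc.preimage_mono hbw.mono)
  · rw [sw_sup_closure, e]
    refine small_sup h0 hΓ.s2 (el U UA) ?_
    rintro _ ⟨C, hC, rfl⟩
    exact fac_clos hUr (hC.oc.preimage_mono bb_mono)
  · exact (le_sup_left : Γ ≤ _) (hΓ.m1 m hm)
  · exact (le_sup_left : Γ ≤ _) (hΓ.m2 m hm)
  · set Γ₁ := Γ ⊔ Subgroup.closure (TT f Set.univ b U UA bb)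
    have hle : dm Γ ≤ dm Γ₁ := by
      intro x hx
      obtain ⟨y, hy⟩ := mem_dm.1 hx
      exact mem_dm.2 ⟨y, (le_sup_left : Γ ≤ _) hy⟩
    have sing : ∀ C : Set ℚ, (D ∩ C).Subsingleton → blk f Set.univ b C ∈ dm Γ₁ := by
      intro C hC
      rcases hC.eq_empty_or_singleton with h | ⟨l, h⟩
      · rw [blk_empty h]; exact Subgroup.one_mem _
      · have hl : l ∈ D ∩ C := by rw [h]; rfl
        have : blk f Set.univ b C = blk f Set.univ b {l} := by
          apply blk_congr
          show D ∩ C = D ∩ {l}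
          rw [h]; ext x; simp only [mem_singleton_iff, mem_inter_iff]
          exact ⟨fun hx => ⟨hx ▸ hl.1, hx⟩, fun hx => hx.2⟩
        rw [this]
        exact hle (hbl l hl.1)
    set E1 : Set ℚ := {c | ∀ l ∈ D, c ≤ l} with hE1
    set E2 : Set ℚ := {c | ∃ m ∈ D, c < m} with hE2
    have l1 : IsLowerSet E1 := by
      intro x y hxy h l hl; exact hxy.trans (h l hl)
    have l2 : IsLowerSet E2 := by
      rintro x y hxy ⟨m, hm, h⟩; exact ⟨m, hm, hxy.trans_lt h⟩
    have e1 : el f Set.univ = blk f Set.univ b Set.univ := by simp [blk]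
    rw [e1, blk_split hf.1 hbw.mono Set.univ l1, blk_split hf.1 hbw.mono (Set.univ ∩ E1ᶜ) l2]
    refine Subgroup.mul_mem _ (sing _ ?_) (Subgroup.mul_mem _ ?_ (sing _ ?_))
    · rintro x ⟨hx, _, hx1⟩ y ⟨hy, _, hy1⟩
      exact le_antisymm (hx1 y hy) (hy1 x hx)
    · by_cases hne : (D ∩ (Set.univ ∩ E1ᶜ ∩ E2)).Nonempty
      · have hO : Ops D (Set.univ ∩ E1ᶜ ∩ E2) := by
          refine ⟨?_, hne, ?_, ?_⟩
          · exact (ordConnected_univ.inter l1.compl.ordConnected).inter l2.ordConnected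
          · rintro l ⟨hl, ⟨_, h1⟩, h2⟩
            have h1' : ¬ ∀ m ∈ D, l ≤ m := h1
            push Not at h1'
            obtain ⟨m, hm, hml⟩ := h1'
            obtain ⟨n, hn, h3, h4⟩ := den m hm l hl hml
            refine ⟨n, ⟨hn, ⟨trivial, fun h => absurd (h m hm) (not_le.2 h3)⟩, ⟨l, hl, h4⟩⟩, h4⟩
          · rintro l ⟨hl, ⟨_, h1⟩, m, hm, hlm⟩
            obtain ⟨n, hn, h3, h4⟩ := den l hl m hm hlm
            refine ⟨n, ⟨hn, ⟨trivial, fun h => absurd (h l hl) (not_le.2 h3)⟩, ⟨m, hm, h4⟩⟩, h3⟩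
        exact mem_dm.2 ⟨_, (le_sup_right : _ ≤ Γ₁) (Subgroup.subset_closure ⟨_, hO, rfl⟩)⟩
      · exact sing _ (by rw [not_nonempty_iff_eq_empty.1 hne]; exact subsingleton_empty)
    · rintro x ⟨hx, _, hx1⟩ y ⟨hy, _, hy1⟩
      have hx2 : ¬ ∃ m ∈ D, x < m := hx1
      have hy2 : ¬ ∃ m ∈ D, y < m := hy1
      push Not at hx2 hy2
      exact le_antisymm (hy2 x hx) (hx2 y hy)

end dense

end GW

end

set_option linter.all false

noncomputable section

namespace GW

open Set GriffithsWords Cardinal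

section stages
variable {ι ι' : Type} [Sys ι] [Sys ι']

lemma Small.mono_card {κ κ' : Cardinal.{0}} (h : κ ≤ κ') {S : Subgroup (wordGroup ι)}
    (hS : Small κ S) : Small κ' S := by
  obtain ⟨A, h1, h2⟩ := hS
  exact ⟨A, h1.trans h, h2⟩

lemma Stage.mono_card {κ κ' : Cardinal.{0}} (h : κ ≤ κ')
    {Γ : Subgroup (wordGroup ι × wordGroup ι')} (hS : Stage κ Γ) : Stage κ' Γ :=
  ⟨hS.h1, hS.h2, hS.s1.mono_card h, hS.s2.mono_card h, hS.m1, hS.m2⟩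

lemma mem_clos_of_pre {x : wordGroup ι} (hx : x ∈ Subgroup.closure {g : wordGroup ι | Mono g})
    {y : wordGroup ι} (hy : Pre y x) : y ∈ Subgroup.closure {g : wordGroup ι | Mono g} :=
  closure_pre (S := {g : wordGroup ι | Mono g}) (fun g hg => Mono.inv hg) (fun g hg x hx => Mono.pre hg hx) hx hy

lemma half_base : Half ((Subgroup.closure {g : wordGroup ι | Mono g}).prod
    (Subgroup.closure {g : wordGroup ι' | Mono g})) := by
  constructor
  · intro g x hg hx
    obtain ⟨s, hs⟩ := mem_dm.1 hg
    rw [Subgroup.mem_prod] at hs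
    refine mem_dm.2 ⟨1, ?_⟩
    rw [Subgroup.mem_prod]
    exact ⟨mem_clos_of_pre hs.1 hx, one_mem _⟩
  · intro s hs
    rw [Subgroup.mem_prod] at hs
    have : Subgroup.closure {g : wordGroup ι' | Mono g} ≤ NN ι' := by
      rw [Subgroup.closure_le]
      intro g hg
      exact mono_mem_NN hg
    exact this hs.2

lemma small_base {κ : Cardinal.{0}} : Small κ (dm ((Subgroup.closure {g : wordGroup ι | Mono g}).prod
    (Subgroup.closure {g : wordGroup ι' | Mono g}))) := by
  refine ⟨∅, by simp, ?_⟩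
  intro g hg
  obtain ⟨s, hs⟩ := mem_dm.1 hg
  rw [Subgroup.mem_prod] at hs
  exact Subgroup.closure_mono subset_union_left hs.1

lemma sw_prod (A : Subgroup (wordGroup ι)) (B : Subgroup (wordGroup ι')) :
    sw (A.prod B) = B.prod A := by
  ext ⟨a, b⟩
  rw [mem_sw, Subgroup.mem_prod, Subgroup.mem_prod]
  exact and_comm

lemma stage_base (ι ι' : Type) [Sys ι] [Sys ι'] (κ : Cardinal.{0}) :
    Stage κ ((Subgroup.closure {g : wordGroup ι | Mono g}).prod
    (Subgroup.closure {g : wordGroup ι' | Mono g})) := by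
  refine ⟨half_base, ?_, small_base, ?_, ?_, ?_⟩
  · rw [sw_prod]; exact half_base
  · rw [sw_prod]; exact small_base
  · intro m hm
    rw [Subgroup.mem_prod]
    exact ⟨Subgroup.subset_closure hm, one_mem _⟩
  · intro m hm
    rw [Subgroup.mem_prod]
    exact ⟨one_mem _, Subgroup.subset_closure hm⟩

lemma half_sup {𝒦 : Set (Subgroup (wordGroup ι × wordGroup ι'))}
    {G : Subgroup (wordGroup ι × wordGroup ι')}
    (hG : ∀ p, p ∈ G ↔ ∃ Γ ∈ 𝒦, p ∈ Γ)
    (h : ∀ Γ ∈ 𝒦, Half Γ) : Half G := by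
  constructor
  · intro g x hg hx
    obtain ⟨s, hs⟩ := mem_dm.1 hg
    obtain ⟨Γ, hΓ, hs⟩ := (hG _).1 hs
    obtain ⟨t, ht⟩ := mem_dm.1 ((h Γ hΓ).pre g x (mem_dm.2 ⟨s, hs⟩) hx)
    exact mem_dm.2 ⟨t, (hG _).2 ⟨Γ, hΓ, ht⟩⟩
  · intro s hs
    obtain ⟨Γ, hΓ, hs⟩ := (hG _).1 hs
    exact (h Γ hΓ).wd s hs

lemma small_Union {κ : Cardinal.{0}} (h0 : ℵ₀ ≤ κ)
    {𝒦 : Set (Subgroup (wordGroup ι × wordGroup ι'))} (hc : #𝒦 ≤ κ)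
    {G : Subgroup (wordGroup ι × wordGroup ι')}
    (hG : ∀ p, p ∈ G → ∃ Γ ∈ 𝒦, p ∈ Γ)
    (h : ∀ Γ ∈ 𝒦, Small κ (dm Γ)) : Small κ (dm G) := by
  choose A hA hA' using fun Γ : 𝒦 => h Γ.1 Γ.2
  refine ⟨⋃ Γ : 𝒦, A Γ, ?_, ?_⟩
  · refine (mk_iUnion_le _).trans ?_
    calc #𝒦 * ⨆ i, #(A i) ≤ κ * κ := mul_le_mul' hc (ciSup_le' hA)
      _ = κ := mul_eq_self h0
  · intro g hg
    obtain ⟨s, hs⟩ := mem_dm.1 hg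
    obtain ⟨Γ, hΓ, hs⟩ := hG _ hs
    refine Subgroup.closure_mono ?_ (hA' ⟨Γ, hΓ⟩ (mem_dm.2 ⟨s, hs⟩))
    rintro x (hx | ⟨a, ha, hx⟩)
    · exact Or.inl hx
    · exact Or.inr ⟨a, mem_iUnion.2 ⟨_, ha⟩, hx⟩

lemma stage_sSup {κ : Cardinal.{0}} (h0 : ℵ₀ ≤ κ)
    {𝒦 : Set (Subgroup (wordGroup ι × wordGroup ι'))} (hne : 𝒦.Nonempty)
    (hd : DirectedOn (· ≤ ·) 𝒦) (hc : #𝒦 ≤ κ) (h : ∀ Γ ∈ 𝒦, Stage κ Γ) :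
    Stage κ (sSup 𝒦) := by
  have hG : ∀ p, p ∈ sSup 𝒦 ↔ ∃ Γ ∈ 𝒦, p ∈ Γ :=
    fun p => Subgroup.mem_sSup_of_directedOn hne hd
  have hG' : ∀ p, p ∈ sw (sSup 𝒦) ↔ ∃ Γ ∈ sw '' 𝒦, p ∈ Γ := by
    rintro ⟨a, b⟩
    rw [mem_sw, hG]
    simp
  have hc' : #(sw '' 𝒦 : Set _) ≤ κ := mk_image_le.trans hc
  obtain ⟨Γ, hΓ⟩ := hne
  refine ⟨half_sup hG (fun Γ hΓ => (h Γ hΓ).h1), half_sup hG' ?_,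
    small_Union h0 hc (fun p hp => (hG p).1 hp) (fun Γ hΓ => (h Γ hΓ).s1),
    small_Union h0 hc' (fun p hp => (hG' p).1 hp) ?_, ?_, ?_⟩
  · rintro _ ⟨Γ, hΓ, rfl⟩
    exact (h Γ hΓ).h2
  · rintro _ ⟨Γ, hΓ, rfl⟩
    exact (h Γ hΓ).s2
  · intro m hm
    exact (hG _).2 ⟨Γ, hΓ, (h Γ hΓ).m1 m hm⟩
  · intro m hm
    exact (hG _).2 ⟨Γ, hΓ, (h Γ hΓ).m2 m hm⟩

end stages

section exhaust
variable {ι : Type} [Sys ι]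

lemma omega_count {S : Subgroup (wordGroup ι)} {T : wordGroup ι} (hT : OmegaType S T) :
    ∃ U : Set (wordGroup ι), U.Countable ∧ U ⊆ S ∧
      ∀ Δ : Subgroup (wordGroup ι), U ⊆ Δ → Δ ≤ S → PCl Δ → OmegaType Δ T := by
  obtain ⟨f, A, hA, rfl⟩ := exists_redrep T
  refine ⟨(fun p => el f (A ∩ Iio p)) '' A, A.to_countable.image _, ?_, ?_⟩
  · rintro _ ⟨p, hp, rfl⟩
    refine hT.2 _ (pre_of_red hA (isLowerSet_Iio p)) ?_
    intro he
    have e : el f A = el f (A ∩ Iio p) * el f (A ∩ (Iio p)ᶜ) := el_split hA.1 (isLowerSet_Iio p)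
    have e1 : el f (A ∩ (Iio p)ᶜ) = 1 := by
      simp only at he
      rw [he] at e
      exact (mul_eq_left.1 e.symm)
    rw [compl_Iio] at e1
    have := hA.2 _ ordConnected_Ici e1
    exact (this ▸ (⟨hp, le_refl p⟩ : p ∈ A ∩ Ici p) : p ∈ (∅ : Set ℚ))
  · intro Δ hU hle hΔ
    refine ⟨fun h => hT.1 (hle h), ?_⟩
    intro x hx hne
    obtain ⟨D, hD, rfl⟩ := hx.rep hA.1 rfl
    have : ∃ p ∈ A, p ∉ D := by
      by_contra hcon
      push Not at hcon
      exact hne (by rw [inter_eq_left.2 hcon])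
    obtain ⟨p, hp, hpD⟩ := this
    have e : A ∩ D = (A ∩ Iio p) ∩ D := by
      ext q
      constructor
      · rintro ⟨h1, h2⟩
        exact ⟨⟨h1, lt_of_not_ge (fun h => hpD (hD h h2))⟩, h2⟩
      · rintro ⟨⟨h1, _⟩, h2⟩
        exact ⟨h1, h2⟩
    rw [e]
    exact hΔ _ _ (hU ⟨p, hp, rfl⟩) (pre_of_red (hA.inter ordConnected_Iio) hD)

lemma dense_count {S : Subgroup (wordGroup ι)} {g : wordGroup ι} (hg : DenseType S g) :
    ∃ U : Set (wordGroup ι), U.Countable ∧ U ⊆ S ∧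
      ∀ Δ : Subgroup (wordGroup ι), U ⊆ Δ → Δ ≤ S → DenseType Δ g := by
  obtain ⟨A0, f, hf, rfl, h⟩ := hg
  refine ⟨Set.range (fun p => el f (cw S f p)) ∪
    ((Set.range (fun pq : A0 × A0 => (el f (Iic pq.1))⁻¹ * el f (Iic pq.2))) ∩ S),
    (countable_range _).union ((countable_range _).mono inter_subset_left), ?_, ?_⟩
  · rintro _ (⟨p, rfl⟩ | ⟨_, h'⟩)
    · exact h p
    · exact h'
  · intro Δ hU hle
    refine ⟨A0, f, hf, rfl, fun p => ?_⟩
    have e : cw Δ f p = cw S f p := by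
      ext q
      constructor
      · intro hq; exact hle hq
      · intro hq; exact hU (Or.inr ⟨⟨(p, q), rfl⟩, hq⟩)
    rw [e]
    exact hU (Or.inl ⟨p, rfl⟩)

/-- dichotomy -/
lemma exists_type {S : Subgroup (wordGroup ι)} (hS : PCl S) (hm : ∀ m, Mono m → m ∈ S)
    (g : wordGroup ι) : (∃ T, OmegaType S T) ∨ DenseType S g := by
  obtain ⟨f0, A0, hA, rfl⟩ := exists_redrep g
  obtain ⟨hr, he⟩ := red_subtype hA
  set f : A0 → ι × ℕ × Bool := fun x => f0 x with hfdef
  by_cases hd : ∀ p, el f (cw S f p) ∈ S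
  · exact Or.inr ⟨A0, f, hr, he, hd⟩
  left
  push Not at hd
  obtain ⟨p, hp⟩ := hd
  set C := cw S f p with hC
  have hpC : p ∈ C := by
    show (el f (Iic p))⁻¹ * el f (Iic p) ∈ S
    simp
  have rC : ∀ D : Set A0, D.OrdConnected → Red f D := by
    intro D hD
    have := hr.inter hD
    rwa [univ_inter] at this
  have up : ∀ q ∈ C, p ≤ q → el f (Icc p q) ∈ S := fun q hq hpq => (ce0 hm hr.1 hpq).1 hq
  have dn : ∀ q ∈ C, q ≤ p → el f (Icc q p) ∈ S := by
    intro q hq hqp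
    refine (ce0 hm hr.1 hqp).1 ?_
    have hq : (el f (Iic p))⁻¹ * el f (Iic q) ∈ S := hq
    have := S.inv_mem hq
    rwa [mul_inv_rev, inv_inv] at this
  have up' : ∀ q, p ≤ q → el f (Icc p q) ∈ S → q ∈ C := fun q hpq h => (ce0 hm hr.1 hpq).2 h
  have dn' : ∀ q, q ≤ p → el f (Icc q p) ∈ S → q ∈ C := by
    intro q hqp h
    have := S.inv_mem ((ce0 hm hr.1 hqp).2 h)
    rw [mul_inv_rev, inv_inv] at this
    exact this
  have u1 : ∀ q ∈ C, ∀ r, p ≤ r → r ≤ q → r ∈ C := by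
    intro q hq r h1 h2
    apply up' r h1
    have := fac_mem hS (rC (Icc p q) ordConnected_Icc) (up q hq (h1.trans h2)) (C := Iic r) ordConnected_Iic
    convert this using 2
    ext x
    simp only [mem_Icc, mem_inter_iff, mem_Iic]
    constructor
    · rintro ⟨a, b⟩; exact ⟨⟨a, b.trans h2⟩, b⟩
    · rintro ⟨⟨a, b⟩, c⟩; exact ⟨a, c⟩
  have d1 : ∀ q ∈ C, ∀ r, q ≤ r → r ≤ p → r ∈ C := by
    intro q hq r h1 h2
    apply dn' r h2
    have := fac_mem hS (rC (Icc q p) ordConnected_Icc) (dn q hq (h1.trans h2)) (C := Ici r) ordConnected_Ici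
    convert this using 2
    ext x
    simp only [mem_Icc, mem_inter_iff, mem_Ici]
    constructor
    · rintro ⟨a, b⟩; exact ⟨⟨h1.trans a, b⟩, a⟩
    · rintro ⟨⟨a, b⟩, c⟩; exact ⟨c, b⟩
  have oU : (C ∩ Ici p).OrdConnected := by
    constructor
    rintro a ⟨ha, ha'⟩ b ⟨hb, hb'⟩ c ⟨h1, h2⟩
    have : p ≤ c := le_trans ha' h1
    exact ⟨u1 b hb c this h2, this⟩
  have oD : (C ∩ Iio p).OrdConnected := by
    constructor
    rintro a ⟨ha, ha'⟩ b ⟨hb, hb'⟩ c ⟨h1, h2⟩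
    have : c < p := lt_of_le_of_lt h2 hb'
    exact ⟨d1 a ha c h1 this.le, this⟩
  have hsplit : el f C = el f (C ∩ Iio p) * el f (C ∩ (Iio p)ᶜ) :=
    el_split (hr.1.mono (subset_univ _)) (isLowerSet_Iio p)
  rw [compl_Iio] at hsplit
  by_cases hU : el f (C ∩ Ici p) ∈ S
  · have hD : el f (C ∩ Iio p) ∉ S := by
      intro h
      exact hp (by rw [hsplit]; exact S.mul_mem h hU)
    refine ⟨(el f (C ∩ Iio p))⁻¹, fun h => hD (by simpa using S.inv_mem h), ?_⟩
    intro x hx hne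
    have h2 := hx.inv
    rw [inv_inv] at h2
    obtain ⟨D, hDl, e⟩ := h2.rep (rC _ oD).1 rfl
    have ex : x = (el f (C ∩ Iio p ∩ Dᶜ))⁻¹ := by
      have h3 : el f (C ∩ Iio p) = el f (C ∩ Iio p ∩ D) * el f (C ∩ Iio p ∩ Dᶜ) :=
        el_split (rC _ oD).1 hDl
      rw [e] at h3
      have h4 : x * el f (C ∩ Iio p ∩ Dᶜ) = 1 := by
        rw [mul_assoc, left_eq_mul] at h3
        exact h3
      exact eq_inv_of_mul_eq_one_left h4
    have : ∃ q ∈ C ∩ Iio p, q ∈ D := by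
      by_contra hcon
      push Not at hcon
      apply hne
      rw [ex]
      congr 2
      exact inter_eq_left.2 hcon
    obtain ⟨q, hq, hqD⟩ := this
    rw [ex]
    refine S.inv_mem ?_
    have hk := fac_mem hS (rC (Icc q p) ordConnected_Icc) (dn q hq.1 (le_of_lt hq.2))
      (C := Iio p ∩ Dᶜ) (ordConnected_Iio.inter (hDl.compl.ordConnected))
    convert hk using 2
    ext r
    constructor
    · rintro ⟨⟨h1, h2⟩, h3⟩
      exact ⟨⟨le_of_not_ge (fun h => h3 (hDl h hqD)), le_of_lt h2⟩, h2, h3⟩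
    · rintro ⟨⟨h1, h2⟩, h3, h4⟩
      exact ⟨⟨d1 q hq.1 r h1 h2, h3⟩, h4⟩
  · refine ⟨el f (C ∩ Ici p), hU, ?_⟩
    intro x hx hne
    obtain ⟨D, hDl, rfl⟩ := hx.rep (rC _ oU).1 rfl
    have : ∃ q ∈ C ∩ Ici p, q ∉ D := by
      by_contra hcon
      push Not at hcon
      exact hne (by rw [inter_eq_left.2 hcon])
    obtain ⟨q, hq, hqD⟩ := this
    have hk := fac_mem hS (rC (Icc p q) ordConnected_Icc) (up q hq.1 hq.2)
      (C := D) hDl.ordConnected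
    convert hk using 2
    ext r
    constructor
    · rintro ⟨⟨h1, h2⟩, h3⟩
      exact ⟨⟨h2, le_of_not_ge (fun h => hqD (hDl h h3))⟩, h3⟩
    · rintro ⟨⟨h1, h2⟩, h3⟩
      exact ⟨⟨u1 q hq.1 r h1 h2, h1⟩, h3⟩

theorem exhaust {I : Type} [LinearOrder I] [Nonempty I] (hcof : ∀ s : ℕ → I, ∃ i, ∀ n, s n ≤ i)
    (S : I → Subgroup (wordGroup ι)) (hmono : Monotone S) (hp : ∀ i, PCl (S i))
    (hm : ∀ i m, Mono m → m ∈ S i)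
    (hcatch : ∀ g i, ∃ Δ, S i ≤ Δ ∧ PCl Δ ∧ (∃ k, Δ ≤ S k) ∧
      ((OmegaType Δ g ∨ DenseType Δ g) → ∃ j, g ∈ S j)) (g : wordGroup ι) : ∃ j, g ∈ S j := by
  have hmem : ∀ x, x ∈ iSup S ↔ ∃ i, x ∈ S i :=
    fun x => Subgroup.mem_iSup_of_directed hmono.directed_le
  have hcount : ∀ U : Set (wordGroup ι), U.Countable → U ⊆ (iSup S : Subgroup (wordGroup ι)) → ∃ i, U ⊆ S i := by
    intro U hU hUS
    obtain ⟨u, hu⟩ := (hU.insert 1).exists_eq_range (insert_nonempty _ _)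
    have : ∀ n, ∃ i, u n ∈ S i := by
      intro n
      have : u n ∈ insert 1 U := hu ▸ mem_range_self n
      rcases this with h | h
      · rw [h]; exact ⟨Classical.arbitrary I, one_mem _⟩
      · exact (hmem _).1 (hUS h)
    choose s hs using this
    obtain ⟨i, hi⟩ := hcof s
    refine ⟨i, fun x hx => ?_⟩
    have : x ∈ Set.range u := hu ▸ mem_insert_of_mem _ hx
    obtain ⟨n, rfl⟩ := this
    exact hmono (hi n) (hs n)
  have hPC : PCl (iSup S) := by
    intro g x hg hx
    obtain ⟨i, hi⟩ := (hmem g).1 hg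
    exact (hmem x).2 ⟨i, hp i g x hi hx⟩
  have hM : ∀ m, Mono m → m ∈ iSup S := fun m h => (hmem m).2 ⟨Classical.arbitrary I, hm _ m h⟩
  have hno : ¬ ∃ T, OmegaType (iSup S) T := by
    rintro ⟨T, hT⟩
    obtain ⟨U, h1, h2, h3⟩ := omega_count hT
    obtain ⟨i, hi⟩ := hcount U h1 h2
    obtain ⟨Δ, d1, d2, ⟨k, d3⟩, d4⟩ := hcatch T i
    have := h3 Δ (hi.trans d1) (d3.trans (le_iSup S k)) d2
    exact hT.1 ((hmem T).2 (d4 (Or.inl this)))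
  rcases exists_type hPC hM g with h | h
  · exact absurd h hno
  obtain ⟨U, h1, h2, h3⟩ := dense_count h
  obtain ⟨i, hi⟩ := hcount U h1 h2
  obtain ⟨Δ, d1, d2, ⟨k, d3⟩, d4⟩ := hcatch g i
  exact d4 (Or.inr (h3 Δ (hi.trans d1) (d3.trans (le_iSup S k))))

end exhaust

end GW

end

set_option linter.all false

noncomputable section

namespace GW

open Set GriffithsWords Cardinal

section recursion
variable {ι ι' : Type} [Sys ι] [Sys ι']

/-- the target of a step has been reached -/
def Good (t : wordGroup ι ⊕ wordGroup ι') (Γ : Subgroup (wordGroup ι × wordGroup ι')) : Prop :=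
  Sum.elim (fun g => g ∈ dm Γ) (fun g => g ∈ dm (sw Γ)) t

/-- one step -/
def stp (κ : Cardinal.{0}) (t : wordGroup ι ⊕ wordGroup ι')
    (Γ : Subgroup (wordGroup ι × wordGroup ι')) : Subgroup (wordGroup ι × wordGroup ι') :=
  open Classical in
  if h : ∃ Γ₁, Γ ≤ Γ₁ ∧ Stage κ Γ₁ ∧ Good t Γ₁ then h.choose else Γ

lemma stp_le (κ : Cardinal.{0}) (t : wordGroup ι ⊕ wordGroup ι')
    (Γ : Subgroup (wordGroup ι × wordGroup ι')) : Γ ≤ stp κ t Γ := by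
  unfold stp
  split_ifs with h
  · exact h.choose_spec.1
  · exact le_rfl

lemma stp_stage {κ : Cardinal.{0}} (t : wordGroup ι ⊕ wordGroup ι')
    {Γ : Subgroup (wordGroup ι × wordGroup ι')} (hΓ : Stage κ Γ) : Stage κ (stp κ t Γ) := by
  unfold stp
  split_ifs with h
  · exact h.choose_spec.2.1
  · exact hΓ

lemma stp_good {κ : Cardinal.{0}} {t : wordGroup ι ⊕ wordGroup ι'}
    {Γ : Subgroup (wordGroup ι × wordGroup ι')} (h : ∃ Γ₁, Γ ≤ Γ₁ ∧ Stage κ Γ₁ ∧ Good t Γ₁) :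
    Good t (stp κ t Γ) := by
  unfold stp
  rw [dif_pos h]
  exact h.choose_spec.2.2

lemma dm_mono {Γ Γ₁ : Subgroup (wordGroup ι × wordGroup ι')} (h : Γ ≤ Γ₁) : dm Γ ≤ dm Γ₁ :=
  Subgroup.map_mono h

lemma sw_mono {Γ Γ₁ : Subgroup (wordGroup ι × wordGroup ι')} (h : Γ ≤ Γ₁) : sw Γ ≤ sw Γ₁ :=
  Subgroup.comap_mono h

theorem exists_final {I : Type} [LinearOrder I] [WellFoundedLT I] [Nonempty I]
    (hI : ∀ i : I, #(Iio i) < 𝔠) (hcof : ∀ s : ℕ → I, ∃ i, ∀ n, s n ≤ i)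
    (e : I → wordGroup ι ⊕ wordGroup ι') (he : ∀ t i, ∃ j, i < j ∧ e j = t) :
    ∃ G : Subgroup (wordGroup ι × wordGroup ι'), Half G ∧ Half (sw G) ∧
      (∀ m, Mono m → (m, 1) ∈ G) ∧ (∀ m, Mono m → (1, m) ∈ G) ∧
      (∀ g, g ∈ dm G) ∧ (∀ g, g ∈ dm (sw G)) := by
  set Γ₀ := (Subgroup.closure {g : wordGroup ι | Mono g}).prod
    (Subgroup.closure {g : wordGroup ι' | Mono g}) with hΓ₀
  set κ : I → Cardinal.{0} := fun i => max ℵ₀ #(Iio i) with hκ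
  have k0 : ∀ i, ℵ₀ ≤ κ i := fun i => le_max_left _ _
  have k1 : ∀ i, κ i < 𝔠 := fun i => max_lt aleph0_lt_continuum (hI i)
  have k2 : ∀ i j, i ≤ j → κ i ≤ κ j := fun i j h =>
    max_le_max le_rfl (mk_le_mk_of_subset (Iio_subset_Iio h))
  let F : I → Subgroup (wordGroup ι × wordGroup ι') :=
    (wellFounded_lt (α := I)).fix (fun i F => stp (κ i) (e i)
      (sSup (insert Γ₀ {Γ | ∃ j, ∃ h : j < i, F j h = Γ})))
  let bs : I → Subgroup (wordGroup ι × wordGroup ι') := fun i => sSup (insert Γ₀ (F '' Iio i))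
  have hF : ∀ i, F i = stp (κ i) (e i) (bs i) := by
    intro i
    have h1 : F i = stp (κ i) (e i)
      (sSup (insert Γ₀ {Γ | ∃ j, ∃ h : j < i, F j = Γ})) := (wellFounded_lt (α := I)).fix_eq _ i
    rw [h1]
    have e1 : {Γ | ∃ j, ∃ h : j < i, F j = Γ} = F '' Iio i := by
      ext Γ; simp
    rw [e1]
  have b1 : ∀ i, bs i ≤ F i := fun i => by rw [hF]; exact stp_le _ _ _
  have b2 : ∀ i j, i < j → F i ≤ bs j := fun i j h =>
    le_sSup (mem_insert_of_mem _ ⟨i, h, rfl⟩)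
  have b0 : ∀ i, Γ₀ ≤ bs i := fun i => le_sSup (mem_insert _ _)
  have hmono : Monotone F := by
    intro i j h
    rcases h.eq_or_lt with rfl | h
    · exact le_rfl
    · exact (b2 i j h).trans (b1 j)
  have hbs : ∀ i, (∀ j < i, Stage (κ j) (F j)) → Stage (κ i) (bs i) := by
    intro i ih
    refine stage_sSup (k0 i) (insert_nonempty _ _) ?_ ?_ ?_
    · rintro _ (rfl | ⟨a, ha, rfl⟩) _ (rfl | ⟨b, hb, rfl⟩)
      · exact ⟨_, mem_insert _ _, le_rfl, le_rfl⟩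
      · exact ⟨F b, Or.inr ⟨b, hb, rfl⟩, (b0 b).trans (b1 b), le_rfl⟩
      · exact ⟨F a, Or.inr ⟨a, ha, rfl⟩, le_rfl, (b0 a).trans (b1 a)⟩
      · rcases le_total a b with h | h
        · exact ⟨F b, Or.inr ⟨b, hb, rfl⟩, hmono h, le_rfl⟩
        · exact ⟨F a, Or.inr ⟨a, ha, rfl⟩, le_rfl, hmono h⟩
    · refine mk_insert_le.trans (add_le_of_le (k0 i) (mk_image_le.trans (le_max_right _ _))
        (one_le_aleph0.trans (k0 i)))
    · rintro _ (rfl | ⟨a, ha, rfl⟩)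
      · exact stage_base _ _ _
      · exact (ih a ha).mono_card (k2 _ _ (le_of_lt ha))
  have hst : ∀ i, Stage (κ i) (F i) := by
    intro i
    induction i using (wellFounded_lt (α := I)).induction with
    | _ i ih =>
      rw [hF]
      exact stp_stage _ (hbs i ih)
  have hbst : ∀ i, Stage (κ i) (bs i) := fun i => hbs i (fun j _ => hst j)
  have X1 : ∀ g, ∃ j, g ∈ dm (F j) := by
    refine exhaust hcof (fun i => dm (F i)) (fun i j h => dm_mono (hmono h))
      (fun i => (hst i).h1.pcl) (fun i m hm => mem_dm.2 ⟨1, (hst i).m1 m hm⟩) ?_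
    intro g i
    obtain ⟨j, hij, hj⟩ := he (Sum.inl g) i
    refine ⟨dm (bs j), dm_mono (b2 i j hij), (hbst j).h1.pcl, ⟨j, dm_mono (b1 j)⟩, ?_⟩
    intro h
    refine ⟨j, ?_⟩
    have : ∃ Γ₁, bs j ≤ Γ₁ ∧ Stage (κ j) Γ₁ ∧ g ∈ dm Γ₁ := by
      rcases h with h | h
      · exact omega_step (k0 j) (k1 j) (hbst j) h
      · exact dense_step (k0 j) (k1 j) (hbst j) h
    have h2 : Good (Sum.inl g) (stp (κ j) (Sum.inl g) (bs j)) := stp_good this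
    simp only [hF, hj]
    exact h2
  have X2 : ∀ g, ∃ j, g ∈ dm (sw (F j)) := by
    refine exhaust hcof (fun i => dm (sw (F i))) (fun i j h => dm_mono (sw_mono (hmono h)))
      (fun i => (hst i).h2.pcl) (fun i m hm => mem_dm.2 ⟨1, (hst i).m2 m hm⟩) ?_
    intro g i
    obtain ⟨j, hij, hj⟩ := he (Sum.inr g) i
    refine ⟨dm (sw (bs j)), dm_mono (sw_mono (b2 i j hij)), (hbst j).h2.pcl,
      ⟨j, dm_mono (sw_mono (b1 j))⟩, ?_⟩
    intro h
    refine ⟨j, ?_⟩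
    have : ∃ Γ₁, sw (bs j) ≤ Γ₁ ∧ Stage (κ j) Γ₁ ∧ g ∈ dm Γ₁ := by
      rcases h with h | h
      · exact omega_step (k0 j) (k1 j) (hbst j).swap h
      · exact dense_step (k0 j) (k1 j) (hbst j).swap h
    obtain ⟨Γ₁, a1, a2, a3⟩ := this
    have h2 : Good (Sum.inr g) (stp (κ j) (Sum.inr g) (bs j)) :=
      stp_good ⟨sw Γ₁, sw_mono a1, a2.swap, a3⟩
    simp only [hF, hj]
    exact h2
  have hG : ∀ p, p ∈ iSup F ↔ ∃ i, p ∈ F i :=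
    fun p => Subgroup.mem_iSup_of_directed hmono.directed_le
  have i0 : I := Classical.arbitrary I
  refine ⟨iSup F, ?_, ?_, ?_, ?_, ?_, ?_⟩
  · refine half_sup (𝒦 := Set.range F) ?_ ?_
    · intro p; rw [hG]; simp
    · rintro _ ⟨i, rfl⟩; exact (hst i).h1
  · refine half_sup (𝒦 := Set.range (fun i => sw (F i))) ?_ ?_
    · rintro ⟨a, b⟩; rw [mem_sw, hG]; simp
    · rintro _ ⟨i, rfl⟩; exact (hst i).h2
  · intro m hm; exact (hG _).2 ⟨i0, (hst i0).m1 m hm⟩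
  · intro m hm; exact (hG _).2 ⟨i0, (hst i0).m2 m hm⟩
  · intro g
    obtain ⟨j, hj⟩ := X1 g
    exact dm_mono (le_iSup F j) hj
  · intro g
    obtain ⟨j, hj⟩ := X2 g
    exact dm_mono (sw_mono (le_iSup F j)) hj

lemma nn_mem_of_full {G : Subgroup (wordGroup ι × wordGroup ι')}
    (m1 : ∀ m, Mono m → (m, 1) ∈ G) (d : ∀ g, g ∈ dm G) {n : wordGroup ι} (hn : n ∈ NN ι) :
    (n, (1 : wordGroup ι')) ∈ G := by
  have hN : (G.comap (MonoidHom.inl (wordGroup ι) (wordGroup ι'))).Normal := by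
    constructor
    intro n hn g
    obtain ⟨s, hs⟩ := mem_dm.1 (d g)
    have hn : (n, (1 : wordGroup ι')) ∈ G := hn
    have := G.mul_mem (G.mul_mem hs hn) (G.inv_mem hs)
    show (g * n * g⁻¹, (1 : wordGroup ι')) ∈ G
    simpa using this
  have : NN ι ≤ G.comap (MonoidHom.inl (wordGroup ι) (wordGroup ι')) :=
    Subgroup.normalClosure_le_normal (fun m hm => m1 m hm)
  exact this hn

theorem iso_of_final {G : Subgroup (wordGroup ι × wordGroup ι')} (H1 : Half G) (H2 : Half (sw G))
    (m1 : ∀ m, Mono m → (m, 1) ∈ G) (m2 : ∀ m, Mono m → (1, m) ∈ G)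
    (d1 : ∀ g, g ∈ dm G) (d2 : ∀ g, g ∈ dm (sw G)) : Nonempty (QQ ι ≃* QQ ι') := by
  choose φ hφ using fun g => mem_dm.1 (d1 g)
  have key : ∀ g s, (g, s) ∈ G → (QuotientGroup.mk s : wordGroup ι' ⧸ NN ι') = QuotientGroup.mk (φ g) := by
    intro g s h
    rw [QuotientGroup.eq]
    apply H1.wd
    have := G.mul_mem (G.inv_mem h) (hφ g)
    simpa using this
  let Φ : wordGroup ι →* wordGroup ι' ⧸ NN ι' :=
    MonoidHom.mk' (fun g => QuotientGroup.mk (φ g)) (by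
      intro a b
      have := key (a * b) (φ a * φ b) (G.mul_mem (hφ a) (hφ b))
      rw [← this]
      rfl)
  have hs : Function.Surjective Φ := by
    intro y
    obtain ⟨s, rfl⟩ := QuotientGroup.mk_surjective y
    obtain ⟨g, hg⟩ := mem_dm.1 (d2 s)
    exact ⟨g, (key g s hg).symm⟩
  have hk : Φ.ker = NN ι := by
    ext g
    rw [MonoidHom.mem_ker]
    constructor
    · intro h
      have h : (QuotientGroup.mk (φ g) : wordGroup ι' ⧸ NN ι') = 1 := h
      have hn : φ g ∈ NN ι' := (QuotientGroup.eq_one_iff _).1 h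
      have : (φ g, (1 : wordGroup ι)) ∈ sw G := nn_mem_of_full (G := sw G) m2 d2 hn
      have h3 : ((1 : wordGroup ι), φ g) ∈ G := this
      have h4 := G.mul_mem (hφ g) (G.inv_mem h3)
      apply H2.wd
      rw [mem_sw]
      simpa using h4
    · intro h
      have := key g 1 (nn_mem_of_full m1 d1 h)
      exact this.symm
  exact ⟨(QuotientGroup.quotientMulEquivOfEq hk.symm).trans
    (QuotientGroup.quotientKerEquivOfSurjective Φ hs)⟩

lemma mk_wordGroup_le [Countable ι] : #(wordGroup ι) ≤ 𝔠 := by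
  have : Countable (FreeGroup (ι × ℕ)) := by
    exact Function.Surjective.countable (f := FreeGroup.mk) Quot.mk_surjective
  calc #(wordGroup ι) ≤ #(ℕ → FreeGroup (ι × ℕ)) := mk_subtype_le _
    _ = #(FreeGroup (ι × ℕ)) ^ #ℕ := by simp
    _ ≤ ℵ₀ ^ ℵ₀ := by
      rw [mk_nat]
      exact power_le_power_right mk_le_aleph0
    _ = 𝔠 := aleph0_power_aleph0

theorem main [Countable ι] [Countable ι'] : Nonempty (QQ ι ≃* QQ ι') := by
  let I := (𝔠 : Cardinal.{0}).ord.ToType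
  have cI : #I = 𝔠 := mk_ord_toType _
  have hI : ∀ i : I, #(Iio i) < 𝔠 := fun i => mk_Iio_toType_ord_lt i
  have : Nonempty I := by
    rw [← mk_ne_zero_iff, cI]
    exact continuum_ne_zero
  have hcof : ∀ s : ℕ → I, ∃ i, ∀ n, s n ≤ i := by
    intro s
    by_contra hcon
    push Not at hcon
    have h1 : IsCofinal (Set.range s) := by
      intro i
      obtain ⟨n, hn⟩ := hcon i
      exact ⟨s n, mem_range_self n, hn.le⟩
    have h2 := Order.cof_le h1
    rw [Ordinal.cof_toType] at h2
    have h3 : ℵ₀ < ((2 : Cardinal.{0}) ^ ℵ₀).ord.cof := lt_cof_ord_power le_rfl one_lt_two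
    rw [two_power_aleph0] at h3
    have h4 : #(Set.range s) ≤ ℵ₀ := (countable_range s).le_aleph0
    exact absurd (h3.trans_le (h2.trans h4)) (lt_irrefl _)
  have hc : #((wordGroup ι ⊕ wordGroup ι') × I) ≤ #I := by
    rw [mk_prod, mk_sum]
    simp only [lift_id, cI]
    calc (#(wordGroup ι) + #(wordGroup ι')) * 𝔠 ≤ (𝔠 + 𝔠) * 𝔠 := by
          gcongr
          · exact mk_wordGroup_le
          · exact mk_wordGroup_le
      _ = 𝔠 := by simp
  have : Nonempty ((wordGroup ι ⊕ wordGroup ι') × I) := ⟨(Sum.inl 1, Classical.arbitrary I)⟩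
  obtain ⟨⟨inj, hinj⟩⟩ := hc
  let r := Function.invFun inj
  have hr : Function.LeftInverse r inj := Function.leftInverse_invFun hinj
  have he : ∀ t (i : I), ∃ j, i < j ∧ (r j).1 = t := by
    intro t i
    by_contra hcon
    push Not at hcon
    have hsub : ∀ k : I, inj (t, k) ∈ Iic i := by
      intro k
      by_contra hk
      have hk : i < inj (t, k) := lt_of_not_ge hk
      exact hcon _ hk (by rw [hr])
    have h1 : #I ≤ #(Iic i) := by
      refine mk_le_of_injective (f := fun k => (⟨inj (t, k), hsub k⟩ : Iic i)) ?_
      intro a b hab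
      have := hinj (congrArg Subtype.val hab)
      exact (Prod.mk.injEq _ _ _ _ ▸ this : t = t ∧ a = b).2
    have h2 : #(Iic i) < 𝔠 := by
      rw [← Iio_insert]
      exact mk_insert_le.trans_lt (add_lt_of_lt aleph0_le_continuum (hI i)
        (one_lt_aleph0.trans aleph0_lt_continuum))
    rw [cI] at h1
    exact absurd (h1.trans_lt h2) (lt_irrefl _)
  obtain ⟨G, a1, a2, a3, a4, a5, a6⟩ := exists_final (ι := ι) (ι' := ι') hI hcof (fun j => (r j).1) he
  exact iso_of_final a1 a2 a3 a4 a5 a6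

end recursion

end GW

end

set_option linter.all false

noncomputable section

namespace GW

open Set GriffithsWords Cardinal

section final

lemma red_word {ι : Type} {f : ℚ → ι × ℕ × Bool} {A : Set ℚ} (h : Red f A) :
    ∃ W : Word ι, W.dom = A ∧ W.letter = f ∧ W.Reduced := by
  refine ⟨⟨A, f, fun N => h.1 N⟩, rfl, rfl, ?_⟩
  intro J hJ hs
  obtain ⟨hJ1, hJ2⟩ := hJ
  have e : A ∩ {x | ∃ a ∈ J, ∃ c ∈ J, a ≤ x ∧ x ≤ c} = J := by
    ext x
    constructor
    · rintro ⟨hx, a, ha, c, hc, h1, h2⟩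
      exact hJ2 a ha c hc x hx h1 h2
    · intro hx
      exact ⟨hJ1 hx, x, hx, x, hx, le_rfl, le_rfl⟩
  have hC : ({x | ∃ a ∈ J, ∃ c ∈ J, a ≤ x ∧ x ≤ c} : Set ℚ).OrdConnected := by
    constructor
    rintro x ⟨a, ha, c, hc, h1, h2⟩ y ⟨a', ha', c', hc', h1', h2'⟩ z ⟨hz1, hz2⟩
    exact ⟨a, ha, c', hc', h1.trans hz1, hz2.trans h2'⟩
  rw [← e]
  apply h.2 _ hC
  rw [e]
  apply Subtype.ext
  rw [coe_el (h.1.mono hJ1)]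
  have h3 := Phi_eq (Word.restrict ⟨A, f, fun N => h.1 N⟩ J)
  have h4 : (Word.restrict ⟨A, f, fun N => h.1 N⟩ J).dom = J := inter_eq_right.2 hJ1
  rw [h4] at h3
  have h5 : ev f J = (Word.restrict ⟨A, f, fun N => h.1 N⟩ J).Phi := h3.symm
  rw [h5]
  funext N
  exact hs N

lemma mono_iff {ι : Type} [Sys ι] (g : wordGroup ι) :
    Mono g ↔ ∃ W : Word ι, W.Reduced ∧ (∃ c, ∀ q ∈ W.dom, lcol (W.letter q) = c) ∧
      W.Phi = (g : (N : ℕ) → FreeGroup (ι × ℕ)) := by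
  constructor
  · intro h
    obtain ⟨f, A, hA, rfl, c, hc⟩ := h.red
    obtain ⟨W, rfl, rfl, hW⟩ := red_word hA
    exact ⟨W, hW, ⟨c, hc⟩, by rw [Phi_eq, coe_el hA.1]⟩
  · rintro ⟨W, hW, ⟨c, hc⟩, he⟩
    have hL : LF W.letter W.dom := fun N => W.finite_le N
    have : g = el W.letter W.dom := by
      apply Subtype.ext
      rw [coe_el hL, ← Phi_eq, he]
    rw [this]
    exact mono_el hL c hc

instance sysTwo : Sys (Fin 2) where
  default := 0
  C := Fin 2
  col := fun x => x.1
  ma := fun i => (0, i)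
  mb := fun i => (1, i)
  ma_mono := fun a b h => h
  mb_mono := fun a b h => h
  col_ne := fun i j => by simp

instance sysUnit : Sys Unit where
  default := ()
  C := ℕ
  col := fun x => x.2
  ma := fun i => ((), 2 * i)
  mb := fun i => ((), 2 * i + 1)
  ma_mono := fun a b h => by simp only; omega
  mb_mono := fun a b h => by simp only; omega
  col_ne := fun i j => by simp only; omega

lemma nn_two : NN (Fin 2) = Subgroup.normalClosure (pureClasses (Fin 2)) := by
  have : {g : wordGroup (Fin 2) | Mono g} = pureClasses (Fin 2) := by
    ext g
    exact mono_iff g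
  unfold NN
  rw [this]

lemma nn_unit : NN Unit = Subgroup.normalClosure cPureClasses := by
  have : {g : wordGroup Unit | Mono g} = cPureClasses := by
    ext g
    exact mono_iff g
  unfold NN
  rw [this]

theorem final_iso : Nonempty (ConeGroup (Fin 2) ≃* HAGroup) := by
  obtain ⟨φ⟩ := main (ι := Fin 2) (ι' := Unit)
  have a : (wordGroup (Fin 2) ⧸ Subgroup.normalClosure (pureClasses (Fin 2))) ≃*
      (wordGroup (Fin 2) ⧸ NN (Fin 2)) := QuotientGroup.quotientMulEquivOfEq nn_two.symm
  have b : (wordGroup Unit ⧸ NN Unit) ≃*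
      (wordGroup Unit ⧸ Subgroup.normalClosure cPureClasses) := QuotientGroup.quotientMulEquivOfEq nn_unit
  exact ⟨(a.trans φ).trans b⟩

end final

end GW

end

open GriffithsWords in
/-- **Theorem D (Cannon–Conner conjecture).** The cone group `𝒞₂` (the fundamental group of
the Griffiths double cone) is isomorphic to `Red_c/⟪Pure(Red_c)⟫` (the fundamental group of
the harmonic archipelago). -/
theorem coneGroup_two_iso_HAGroup :
    Nonempty (ConeGroup (Fin 2) ≃* HAGroup) := by
  exact GW.final_iso
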